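/- arXiv:2304.12095 — 4 statements merged into one kernel-verified Lean document; each statement's English description precedes it below -/
import Mathlib

section
/- (Anticode Bound) For every 𝔽_q-linear sum-rank metric code 𝒞 ⊆ 𝕄 one has dim_{𝔽_q}(𝒞) ≤ max_{C ∈ 𝒞} Σ_{i=1}^ℓ m_i·rk(C_i). -/
open Matrix Finset

section SumRank

variable {F : Type*} [Field F] [Fintype F] {ℓ : ℕ} {m n : Fin ℓ → ℕ}

/-- The weighted sum `∑ m i * rank (C i)`. -/
noncomputable def wsum (C : ∀ i : Fin ℓ, Matrix (Fin (m i)) (Fin (n i)) F) : ℕ :=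
  ∑ i, m i * (C i).rank

end SumRank

theorem ab_step {K ι α β : Type*} [Field K] [Fintype ι] [DecidableEq ι] [LinearOrder α]
    [LinearOrder β] (r : ι → α) (c : ι → β) (hr : Function.Injective r)
    (hc : Function.Injective c) (B : ι → Matrix ι ι K)
    (h1 : ∀ t p q, r p < r t → B t p q = 0)
    (h2 : ∀ t q, c q < c t → B t t q = 0)
    (h3 : ∀ t, B t t t ≠ 0) :
    ∃ x : ι → K, (∑ t, x t • B t).det ≠ 0 := by
  suffices H : ∀ s : Finset ι, ∃ x : ι → K,
      (Matrix.of fun p q => if p ∈ s then (∑ t, x t • B t) p q else B p p q).det ≠ 0 by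
    obtain ⟨x, hx⟩ := H Finset.univ
    refine ⟨x, ?_⟩
    convert hx using 2
    ext p q
    simp
  intro s
  induction s using Finset.induction_on_max_value r with
  | empty =>
    refine ⟨0, ?_⟩
    simp only [Finset.notMem_empty, if_false]
    let _ : LinearOrder ι := LinearOrder.lift' c hc
    rw [Matrix.det_of_isUpperTriangular]
    · simp only [Matrix.of_apply]
      exact Finset.prod_ne_zero_iff.2 fun t _ => h3 t
    · intro p q hpq
      exact h2 p q hpq
  | insert a s ha hmax ih =>
    obtain ⟨x, hx⟩ := ih
    set M : Matrix ι ι K :=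
      Matrix.of fun p q => if p ∈ s then (∑ t, x t • B t) p q else B p p q with hM
    let u : ι → K := fun q => ∑ t ∈ Finset.univ.erase a, x t * B t a q
    have key : ∀ y : K, (Matrix.of fun p q => if p ∈ insert a s then
        (∑ t, (Function.update x a y) t • B t) p q else B p p q)
        = M.updateRow a (u + y • (B a a)) := by
      intro y
      ext p q
      by_cases hp : p = a
      · subst hp
        simp only [Matrix.of_apply, Finset.mem_insert_self, if_true, Matrix.updateRow_self,
          Matrix.sum_apply, Matrix.smul_apply, Pi.add_apply, Pi.smul_apply, smul_eq_mul, u]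
        rw [← Finset.sum_erase_add _ _ (Finset.mem_univ p)]
        congr 1
        · refine Finset.sum_congr rfl fun t ht => ?_
          rw [Function.update_of_ne (Finset.ne_of_mem_erase ht)]
        · simp
      · rw [Matrix.updateRow_ne hp]
        simp only [hM, Matrix.of_apply, Finset.mem_insert, hp, false_or]
        split_ifs with hps
        · simp only [Matrix.sum_apply, Matrix.smul_apply, smul_eq_mul]
          refine Finset.sum_congr rfl fun t _ => ?_
          by_cases hta : t = a
          · subst hta
            rw [h1 t p q (lt_of_le_of_ne (hmax p hps) fun h => hp (hr h))]
            simp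
          · rw [Function.update_of_ne hta]
        · rfl
    have hMa : M.updateRow a (B a a) = M := by
      ext p q
      by_cases hp : p = a
      · subst hp
        simp [hM, ha]
      · rw [Matrix.updateRow_ne hp]
    have hdet : ∀ y : K, (M.updateRow a (u + y • (B a a))).det
        = (M.updateRow a u).det + y * M.det := by
      intro y
      rw [Matrix.det_updateRow_add, Matrix.det_updateRow_smul, hMa]
    by_cases h0 : (M.updateRow a u).det = 0
    · refine ⟨Function.update x a 1, ?_⟩
      rw [key, hdet, h0]
      simpa using hx
    · refine ⟨Function.update x a 0, ?_⟩
      rw [key, hdet]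
      simpa using h0

theorem ab_block {K : Type*} [Field K] {ℓ : ℕ} {κ : Fin ℓ → Type*} [∀ i, Fintype (κ i)]
    [∀ i, DecidableEq (κ i)] (D : ∀ i, Matrix (κ i) (κ i) K)
    (h : (Matrix.blockDiagonal' D).det ≠ 0) (i : Fin ℓ) : IsUnit (D i) := by
  set N := (Matrix.blockDiagonal' D)⁻¹
  have hN : Matrix.blockDiagonal' D * N = 1 :=
    Matrix.mul_nonsing_inv _ (isUnit_iff_ne_zero.2 h)
  have : D i * Matrix.blockDiag' N i = 1 := by
    ext a b
    have := congrFun (congrFun hN ⟨i, a⟩) ⟨i, b⟩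
    rw [Matrix.mul_apply, Fintype.sum_sigma, Finset.sum_eq_single i] at this
    · simp only [Matrix.blockDiagonal'_apply_eq] at this
      rw [Matrix.mul_apply]
      simp only [Matrix.blockDiag'_apply]
      rw [this]
      simp [Matrix.one_apply]
    · intro j _ hj
      refine Finset.sum_eq_zero fun y _ => ?_
      rw [Matrix.blockDiagonal'_apply_ne _ _ _ (Ne.symm hj), zero_mul]
    · simp
  exact IsUnit.of_mul_eq_one _ this

theorem ab_color {a b : ℕ} (ha : 0 < a) (S : Finset (Fin a × Fin b)) :
    ∃ c : ℕ, S.card ≤ a * (S.filter fun p => (p.1.val + p.2.val) % a = c).card := by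
  by_contra! hcon
  have h := Finset.card_eq_sum_card_fiberwise (s := S) (t := Finset.range a)
    (f := fun p => (p.1.val + p.2.val) % a) (fun p _ => by
      simpa using Nat.mod_lt _ ha)
  have h2 : ∑ c ∈ Finset.range a, a * (S.filter fun p => (p.1.val + p.2.val) % a = c).card
      < ∑ c ∈ Finset.range a, S.card :=
    Finset.sum_lt_sum_of_nonempty ⟨0, by simpa using ha⟩ fun c _ => hcon c
  rw [← Finset.mul_sum, ← h] at h2
  simp at h2

theorem ab_mod {a x y z : ℕ} (hy : y < a) (hz : z < a) (h : (x + y) % a = (x + z) % a) :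
    y = z := by
  have : y ≡ z [MOD a] := Nat.ModEq.add_left_cancel' x h
  exact Nat.ModEq.eq_of_lt_of_lt this hy hz

/-- Leading positions. -/
def abLead {F : Type*} [Field F] {ℓ : ℕ} {m n : Fin ℓ → ℕ}
    (V : Submodule F (∀ i : Fin ℓ, Matrix (Fin (m i)) (Fin (n i)) F))
    (i : Fin ℓ) (p : Fin (m i) × Fin (n i)) : Prop :=
  ∃ A ∈ V, A i p.1 p.2 ≠ 0 ∧ (∀ j, j < i → ∀ r c, A j r c = 0) ∧
    (∀ r c, r < p.1 → A i r c = 0) ∧ (∀ c, c < p.2 → A i p.1 c = 0)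

theorem ab_exists_lead {F : Type*} [Field F] {ℓ : ℕ} {m n : Fin ℓ → ℕ}
    (V : Submodule F (∀ i : Fin ℓ, Matrix (Fin (m i)) (Fin (n i)) F))
    (A : ∀ i : Fin ℓ, Matrix (Fin (m i)) (Fin (n i)) F) (hA : A ∈ V) (h0 : A ≠ 0) :
    ∃ i p, abLead V i p ∧ A i p.1 p.2 ≠ 0 := by
  classical
  have e1 : ∃ i, A i ≠ 0 := by
    by_contra! h
    exact h0 (funext h)
  obtain ⟨i, hi, hi'⟩ := WellFounded.has_min (wellFounded_lt (α := Fin ℓ)) {i | A i ≠ 0} e1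
  have e2 : ∃ r, A i r ≠ 0 := by
    by_contra! h
    exact hi (funext h)
  obtain ⟨r, hr, hr'⟩ := WellFounded.has_min (wellFounded_lt (α := Fin (m i))) {r | A i r ≠ 0} e2
  have e3 : ∃ c, A i r c ≠ 0 := by
    by_contra! h
    exact hr (funext h)
  obtain ⟨c, hc, hc'⟩ := WellFounded.has_min (wellFounded_lt (α := Fin (n i))) {c | A i r c ≠ 0} e3
  refine ⟨i, (r, c), ⟨A, hA, hc, ?_, ?_, ?_⟩, hc⟩
  · intro j hj r c
    have : A j = 0 := by
      by_contra h
      exact hi' j h hj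
    rw [this]; rfl
  · intro r' c' h
    have : A i r' = 0 := by
      by_contra h'
      exact hr' r' h' h
    rw [this]; rfl
  · intro c' h
    by_contra h'
    exact hc' c' h' h

open Classical in
/-- The finite set of leading positions in block `i`. -/
noncomputable def abS {F : Type*} [Field F] {ℓ : ℕ} {m n : Fin ℓ → ℕ}
    (V : Submodule F (∀ i : Fin ℓ, Matrix (Fin (m i)) (Fin (n i)) F))
    (i : Fin ℓ) : Finset (Fin (m i) × Fin (n i)) :=
  Finset.univ.filter (abLead V i)

theorem ab_dim {F : Type*} [Field F] {ℓ : ℕ} {m n : Fin ℓ → ℕ}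
    (V : Submodule F (∀ i : Fin ℓ, Matrix (Fin (m i)) (Fin (n i)) F)) :
    Module.finrank F V ≤ ∑ i, (abS V i).card := by
  let f : V →ₗ[F] ((Σ i, abS V i) → F) :=
    { toFun := fun A t => A.1 t.1 t.2.1.1 t.2.1.2
      map_add' := fun _ _ => rfl
      map_smul' := fun _ _ => rfl }
  have hf : Function.Injective f := by
    rw [← LinearMap.ker_eq_bot, LinearMap.ker_eq_bot']
    intro A hA
    by_contra h
    obtain ⟨i, p, hp, hne⟩ := ab_exists_lead V A.1 A.2 (fun h' => h (Subtype.ext h'))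
    exact hne (congrFun hA ⟨i, ⟨p, by simpa [abS] using hp⟩⟩)
  have := LinearMap.finrank_le_finrank_of_injective hf
  simpa using this

/-- **Anticode Bound.** For every `𝔽_q`-linear sum-rank metric code `𝒞 ⊆ 𝕄` one has
`dim 𝒞 ≤ max_{C ∈ 𝒞} ∑ i, m i * rank (C i)`. -/
theorem anticode_bound {F : Type*} [Field F] [Fintype F] {ℓ : ℕ} (m n : Fin ℓ → ℕ)
    (hℓ : 0 < ℓ) (hm : ∀ i j : Fin ℓ, i ≤ j → m j ≤ m i) (hmpos : ∀ i, 0 < m i)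
    (hnm : ∀ i, n i ≤ m i) (hnpos : ∀ i, 0 < n i)
    (𝒞 : Submodule F (∀ i : Fin ℓ, Matrix (Fin (m i)) (Fin (n i)) F)) :
    Module.finrank F 𝒞 ≤ sSup {w | ∃ C ∈ 𝒞, w = wsum C} := by
  classical
  choose c hc using fun i => ab_color (hmpos i) (abS 𝒞 i)
  let M : ∀ i, Finset (Fin (m i) × Fin (n i)) := fun i =>
    (abS 𝒞 i).filter fun p => (p.1.val + p.2.val) % m i = c i
  have hlead : ∀ t : Σ i, M i, abLead 𝒞 t.1 t.2.1 := by
    rintro ⟨i, p, hp⟩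
    simp only [M, abS, Finset.mem_filter] at hp
    exact hp.1.2
  have hcol : ∀ t : Σ i, M i, (t.2.1.1.val + t.2.1.2.val) % m t.1 = c t.1 := by
    rintro ⟨i, p, hp⟩
    simp only [M, Finset.mem_filter] at hp
    exact hp.2
  choose A hA hA0 hA1 hA2 hA3 using hlead
  let B : (Σ i, M i) → Matrix (Σ i, M i) (Σ i, M i) F := fun t =>
    Matrix.blockDiagonal' fun i => (A t i).submatrix (fun p : M i => p.1.1) (fun p : M i => p.1.2)
  let r : (Σ i, M i) → Fin ℓ ×ₗ ℕ := fun t => toLex (t.1, t.2.1.1.val)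
  let k : (Σ i, M i) → Fin ℓ ×ₗ ℕ := fun t => toLex (t.1, t.2.1.2.val)
  have hr : Function.Injective r := by
    rintro ⟨i, ⟨a, b⟩, hp⟩ ⟨j, ⟨a', b'⟩, hq⟩ h
    have h' := toLex.injective h
    simp only [Prod.mk.injEq] at h'
    obtain ⟨rfl, h2⟩ := h'
    have e1 := hcol ⟨i, ⟨a, b⟩, hp⟩
    have e2 := hcol ⟨i, ⟨a', b'⟩, hq⟩
    simp only at e1 e2
    obtain rfl : a = a' := Fin.ext h2
    obtain rfl : b = b' := Fin.ext
      (ab_mod (b.2.trans_le (hnm i)) (b'.2.trans_le (hnm i)) (e1.trans e2.symm))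
    rfl
  have hk : Function.Injective k := by
    rintro ⟨i, ⟨a, b⟩, hp⟩ ⟨j, ⟨a', b'⟩, hq⟩ h
    have h' := toLex.injective h
    simp only [Prod.mk.injEq] at h'
    obtain ⟨rfl, h2⟩ := h'
    have e1 := hcol ⟨i, ⟨a, b⟩, hp⟩
    have e2 := hcol ⟨i, ⟨a', b'⟩, hq⟩
    simp only at e1 e2
    obtain rfl : b = b' := Fin.ext h2
    rw [add_comm] at e1 e2
    obtain rfl : a = a' := Fin.ext (ab_mod a.2 a'.2 (e1.trans e2.symm))
    rfl
  obtain ⟨x, hx⟩ := ab_step r k hr hk B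
    (by
      rintro t ⟨i, p⟩ ⟨j, q⟩ h
      by_cases hij : i = j
      · subst hij
        simp only [B, Matrix.blockDiagonal'_apply_eq, Matrix.submatrix_apply]
        rcases Prod.Lex.toLex_lt_toLex.1 h with h | ⟨h, h'⟩
        · exact hA1 t i h _ _
        · obtain ⟨i', t'⟩ := t
          simp only at h h'
          subst h
          exact hA2 _ _ _ h'
      · exact Matrix.blockDiagonal'_apply_ne _ _ _ hij)
    (by
      rintro ⟨i, p⟩ ⟨j, q⟩ h
      by_cases hij : i = j
      · subst hij
        simp only [B, Matrix.blockDiagonal'_apply_eq, Matrix.submatrix_apply]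
        rcases Prod.Lex.toLex_lt_toLex.1 h with h | ⟨h, h'⟩
        · exact absurd h (lt_irrefl _)
        · exact hA3 ⟨i, p⟩ _ h'
      · exact Matrix.blockDiagonal'_apply_ne _ _ _ hij)
    (by
      rintro ⟨i, p⟩
      simp only [B, Matrix.blockDiagonal'_apply_eq, Matrix.submatrix_apply]
      exact hA0 ⟨i, p⟩)
  let C := ∑ t, x t • A t
  have hC : C ∈ 𝒞 := Submodule.sum_mem _ fun t _ => Submodule.smul_mem _ _ (hA t)
  have hBC : ∑ t, x t • B t = Matrix.blockDiagonal' fun i =>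
      (C i).submatrix (fun p : M i => p.1.1) (fun p : M i => p.1.2) := by
    ext ⟨i, p⟩ ⟨j, q⟩
    by_cases hij : i = j
    · subst hij
      simp [Matrix.sum_apply, B, C, Finset.sum_apply]
    · rw [Matrix.blockDiagonal'_apply_ne _ _ _ hij, Matrix.sum_apply]
      refine Finset.sum_eq_zero fun t _ => ?_
      simp only [B, Matrix.smul_apply]
      rw [Matrix.blockDiagonal'_apply_ne _ _ _ hij, smul_zero]
  rw [hBC] at hx
  have hrank : ∀ i, (M i).card ≤ (C i).rank := by
    intro i
    have h1 := Matrix.rank_of_isUnit _ (ab_block _ hx i)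
    rw [Fintype.card_coe] at h1
    rw [← h1]
    exact Matrix.rank_submatrix_le _ _ _
  have hle : Module.finrank F 𝒞 ≤ wsum C := by
    refine (ab_dim 𝒞).trans (Finset.sum_le_sum fun i _ => (hc i).trans ?_)
    exact Nat.mul_le_mul_left _ (hrank i)
  refine hle.trans (le_csSup ?_ ⟨C, hC, rfl⟩)
  refine ⟨∑ i, m i * n i, ?_⟩
  rintro w ⟨D, _, rfl⟩
  exact Finset.sum_le_sum fun i _ => Nat.mul_le_mul_left _ (Matrix.rank_le_width _)
end

section
/- (Classification of optimal anticodes) Let k = 0 if m_1 = 1 and k = max{i ∈ {1,…,ℓ} : m_i > 1} otherwise. A code 𝒞 ⊆ 𝕄 is an optimal anticode if and only if there exist an optimal anticode 𝒞′ ⊆ 𝔽_q^{ℓ−k} (that is, an 𝔽_q-subspace with dim(𝒞′) equal to the maximum Hamming weight of its elements) and, for each i ∈ {1,…,k}, an optimal rank-metric anticode 𝒞_i ⊆ 𝔽_q^{m_i×n_i} (that is, an 𝔽_q-subspace with dim(𝒞_i) = m_i · max_{M ∈ 𝒞_i} rk(M)) such that 𝒞 = 𝒞_1 × … × 𝒞_k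 × 𝒞′. -/
open Matrix Finset

section SumRank

variable {F : Type*} [Field F] [Fintype F] {ℓ : ℕ} {m n : Fin ℓ → ℕ}

/-- An optimal rank-metric anticode in `F^(m×n)`:
an `F`-subspace whose dimension equals `m` times the maximum rank of its elements. -/
def IsOptRkAnticode {m n : ℕ} (A : Submodule F (Matrix (Fin m) (Fin n) F)) : Prop :=
  Module.finrank F A = m * sSup {r | ∃ M ∈ A, (M : Matrix (Fin m) (Fin n) F).rank = r}

/-- An optimal sum-rank-metric anticode: a code attaining the anticode bound
`dim 𝒞 = max_{C ∈ 𝒞} ∑ i, m i * rank (C i)`. -/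
def IsOptAnticode (𝒞 : Submodule F (∀ i : Fin ℓ, Matrix (Fin (m i)) (Fin (n i)) F)) : Prop :=
  Module.finrank F 𝒞 = sSup {w | ∃ C ∈ 𝒞, w = wsum C}

/-- An optimal Hamming-metric anticode (on a product of `1 × 1` matrix blocks):
an `F`-subspace whose dimension equals the maximum Hamming weight of its elements. -/
def IsOptHammingAnticode {ι : Type*} {M : ι → Type*} [∀ i, AddCommGroup (M i)]
    [∀ i, Module F (M i)] (A : Submodule F (∀ i, M i)) : Prop :=
  Module.finrank F A = sSup {w | ∃ C ∈ A, w = Nat.card {i // C i ≠ 0}}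

end SumRank
section Helpers

/-- Triangular families are linearly independent. -/
theorem aux_tri {F E ι κ : Type*} [Field F] [AddCommGroup E] [Module F E] [Fintype ι]
    [LinearOrder κ] (key : ι → κ) (hkey : Function.Injective key)
    (v : ι → E) (φ : ι → E →ₗ[F] F) (h0 : ∀ s t, key t < key s → φ t (v s) = 0)
    (h1 : ∀ s, φ s (v s) ≠ 0) : LinearIndependent F v := by
  classical
  rw [Fintype.linearIndependent_iff]
  intro g hg
  by_contra! hne
  have hne' : (univ.filter fun i => g i ≠ 0).Nonempty := by
    obtain ⟨i, hi⟩ := hne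
    exact ⟨i, by simpa using hi⟩
  obtain ⟨s, hs, hmin⟩ := Finset.exists_min_image _ key hne'
  have hs' : g s ≠ 0 := by simpa using hs
  have h := congrArg (φ s) hg
  rw [map_sum, map_zero, Finset.sum_eq_single s] at h
  · rw [map_smul, smul_eq_mul] at h
    exact (mul_ne_zero hs' (h1 s)) h
  · intro t _ hts
    rw [map_smul, smul_eq_mul]
    by_cases hgt : g t = 0
    · rw [hgt, zero_mul]
    · have h2 : key s ≤ key t := hmin t (by simpa using hgt)
      have h3 : key s < key t := lt_of_le_of_ne h2 (fun h => hts (hkey h).symm)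
      rw [h0 t s h3, mul_zero]
  · intro h; exact absurd (Finset.mem_univ s) h

theorem aux_update {F E ι : Type*} [Field F] [AddCommGroup E] [Module F E] [Fintype ι]
    [DecidableEq ι] (g : ι → E) (hg : LinearIndependent F g) (a : ι) (y : E)
    (hy : y ∉ Submodule.span F (g '' {a}ᶜ)) :
    LinearIndependent F (Function.update g a y) := by
  rw [Fintype.linearIndependent_iff] at hg ⊢
  intro c hc
  rw [← Finset.add_sum_erase _ _ (Finset.mem_univ a)] at hc
  rw [Function.update_self] at hc
  have hsum : ∑ x ∈ univ.erase a, c x • Function.update g a y x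
      = ∑ x ∈ univ.erase a, c x • g x := by
    refine Finset.sum_congr rfl fun x hx => ?_
    rw [Function.update_of_ne (Finset.ne_of_mem_erase hx)]
  rw [hsum] at hc
  have hca : c a = 0 := by
    by_contra hca
    apply hy
    have h1 : c a • y ∈ Submodule.span F (g '' {a}ᶜ) := by
      rw [eq_neg_of_add_eq_zero_left hc]
      refine Submodule.neg_mem _ (Submodule.sum_mem _ fun x hx => ?_)
      refine Submodule.smul_mem _ _ (Submodule.subset_span ⟨x, ?_, rfl⟩)
      simpa using Finset.ne_of_mem_erase hx
    exact (Submodule.smul_mem_iff _ hca).1 h1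
  apply hg
  rw [← Finset.add_sum_erase _ _ (Finset.mem_univ a), hca, zero_smul]
  rw [hca, zero_smul] at hc
  exact hc

theorem aux_exch {F E ι : Type*} [Field F] [AddCommGroup E] [Module F E] [Fintype ι]
    [DecidableEq ι] (g : ι → E) (hg : LinearIndependent F g) (a : ι) (y z : E)
    (hyz : z - y = g a) :
    LinearIndependent F (Function.update g a y) ∨ LinearIndependent F (Function.update g a z) := by
  by_contra! h
  have h1 : y ∈ Submodule.span F (g '' {a}ᶜ) := by
    by_contra h'; exact h.1 (aux_update g hg a y h')
  have h2 : z ∈ Submodule.span F (g '' {a}ᶜ) := by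
    by_contra h'; exact h.2 (aux_update g hg a z h')
  have h3 := Submodule.sub_mem _ h2 h1
  rw [hyz] at h3
  have := linearIndependent_iff_notMem_span.1 hg a
  rw [← Set.compl_eq_univ_sdiff] at this
  exact this h3

theorem aux_choice {F E ι κ : Type*} [Field F] [AddCommGroup E] [Module F E] [Fintype ι]
    [DecidableEq ι] [LinearOrder κ] (key : ι → κ) (hkey : Function.Injective key)
    (r : ι → E) (hr : LinearIndependent F r) (w : ι → (ι → Bool) → E)
    (hw : ∀ s a x b, key s < key a → w s (Function.update x a b) = w s x)
    (hd : ∀ s x, w s (Function.update x s true) - w s (Function.update x s false) = r s) :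
    ∃ x, LinearIndependent F (fun s => w s x) := by
  have key1 : ∀ J : Finset ι, ∃ x, LinearIndependent F (fun s => if s ∈ J then w s x else r s) := by
    intro J
    induction J using Finset.induction_on_max_value key with
    | empty => exact ⟨fun _ => false, by simpa using hr⟩
    | insert a s ha hmax ih =>
      obtain ⟨x, hx⟩ := ih
      have hb : ∀ b, Function.update (fun t => if t ∈ s then w t x else r t) a
          (w a (Function.update x a b)) =
          fun t => if t ∈ insert a s then w t (Function.update x a b) else r t := by
        intro b
        funext t
        by_cases hta : t = a
        · subst hta; simp
        · rw [Function.update_of_ne hta]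
          by_cases hts : t ∈ s
          · have : key t < key a :=
              lt_of_le_of_ne (hmax t hts) (fun h => hta (hkey h))
            simp [hts, hw t a x b this]
          · simp [hts, hta]
      rcases aux_exch _ hx a (w a (Function.update x a false)) (w a (Function.update x a true))
        (by simp [ha, hd]) with h | h
      · exact ⟨_, by rw [hb] at h; exact h⟩
      · exact ⟨_, by rw [hb] at h; exact h⟩
  obtain ⟨x, hx⟩ := key1 univ
  exact ⟨x, by simpa using hx⟩

end Helpers
section Positions

variable {F : Type*} [Field F] {ℓ : ℕ} {m n : Fin ℓ → ℕ}

/-- Lexicographic key of an entry position. -/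
def posKey (p : Σ i : Fin ℓ, Fin (m i) × Fin (n i)) : ℕ ×ₗ (ℕ ×ₗ ℕ) :=
  toLex ((p.1 : ℕ), toLex ((p.2.1 : ℕ), (p.2.2 : ℕ)))

theorem posKey_injective :
    Function.Injective (posKey : (Σ i : Fin ℓ, Fin (m i) × Fin (n i)) → _) := by
  rintro ⟨i, a, b⟩ ⟨j, c, d⟩ h
  simp only [posKey, EmbeddingLike.apply_eq_iff_eq, Prod.mk.injEq] at h
  obtain ⟨h1, h2, h3⟩ := h
  have := Fin.ext h1
  subst this
  have h2 := Fin.ext h2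
  have h3 := Fin.ext h3
  subst h2 h3
  rfl

/-- `p` is the leading position of `C`. -/
def IsLead (C : ∀ i : Fin ℓ, Matrix (Fin (m i)) (Fin (n i)) F)
    (p : Σ i : Fin ℓ, Fin (m i) × Fin (n i)) : Prop :=
  C p.1 p.2.1 p.2.2 ≠ 0 ∧ ∀ q : (Σ i : Fin ℓ, Fin (m i) × Fin (n i)),
    posKey q < posKey p → C q.1 q.2.1 q.2.2 = 0

theorem exists_isLead (C : ∀ i : Fin ℓ, Matrix (Fin (m i)) (Fin (n i)) F) (hC : C ≠ 0) :
    ∃ p, IsLead C p := by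
  classical
  have hne : (univ.filter fun p : (Σ i : Fin ℓ, Fin (m i) × Fin (n i)) =>
      C p.1 p.2.1 p.2.2 ≠ 0).Nonempty := by
    by_contra h
    apply hC
    funext i
    ext a b
    by_contra h'
    exact h ⟨⟨i, a, b⟩, by simpa using h'⟩
  obtain ⟨p, hp, hmin⟩ := Finset.exists_min_image _ posKey hne
  refine ⟨p, by simpa using hp, fun q hq => ?_⟩
  by_contra h
  exact absurd (hmin q (by simpa using h)) (not_le.2 hq)

open Classical in
/-- The set of leading positions of a subspace. -/
noncomputable def leads (V : Submodule F (∀ i : Fin ℓ, Matrix (Fin (m i)) (Fin (n i)) F)) :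
    Finset (Σ i : Fin ℓ, Fin (m i) × Fin (n i)) :=
  univ.filter fun p => ∃ C ∈ V, IsLead C p

theorem mem_leads (V : Submodule F (∀ i : Fin ℓ, Matrix (Fin (m i)) (Fin (n i)) F)) (p) :
    p ∈ leads V ↔ ∃ C ∈ V, IsLead C p := by
  simp [leads]

theorem finrank_le_leads (V : Submodule F (∀ i : Fin ℓ, Matrix (Fin (m i)) (Fin (n i)) F)) :
    Module.finrank F V ≤ (leads V).card := by
  let f : V →ₗ[F] (leads V → F) :=
    { toFun := fun C p => C.1 p.1.1 p.1.2.1 p.1.2.2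
      map_add' := fun _ _ => rfl
      map_smul' := fun _ _ => rfl }
  have hf : Function.Injective f := by
    rw [← LinearMap.ker_eq_bot, LinearMap.ker_eq_bot']
    intro C hC
    by_contra hne
    obtain ⟨p, hp⟩ := exists_isLead C.1 (fun h => hne (Subtype.ext h))
    have hmem : p ∈ leads V := (mem_leads V p).2 ⟨C.1, C.2, hp⟩
    exact hp.1 (congrFun hC ⟨p, hmem⟩)
  simpa using LinearMap.finrank_le_finrank_of_injective hf

/-- The diagonal of a position. -/
def diag' (p : Σ i : Fin ℓ, Fin (m i) × Fin (n i)) : ℕ :=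
  if (p.2.2 : ℕ) ≤ p.2.1 then p.2.1 - p.2.2 else p.2.1 + m p.1 - p.2.2

theorem exists_matching (hnm : ∀ i, n i ≤ m i) (S : Finset (Σ i : Fin ℓ, Fin (m i) × Fin (n i))) :
    ∃ T ⊆ S, (∀ p ∈ T, ∀ q ∈ T, p.1 = q.1 → (p.2.1 : ℕ) = q.2.1 → p = q) ∧
      (∀ p ∈ T, ∀ q ∈ T, p.1 = q.1 → (p.2.2 : ℕ) = q.2.2 → p = q) ∧
      S.card ≤ ∑ i, m i * (T.filter fun p => p.1 = i).card := by
  classical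
  have h1 : ∀ i, ∃ c, (S.filter fun p => p.1 = i).card ≤
      m i * ((S.filter fun p => p.1 = i).filter fun p => diag' p = c).card := by
    intro i
    by_contra! h
    have hm : Set.MapsTo diag' (↑(S.filter fun p => p.1 = i) :
        Set (Σ i : Fin ℓ, Fin (m i) × Fin (n i))) (↑(range (m i)) : Set ℕ) := by
      rintro ⟨j, a, b⟩ hp
      have hj : j = i := by
        have := hp
        simp only [coe_filter, Set.mem_ofPred_eq] at this
        exact this.2
      subst hj
      have := hnm j
      simp only [diag', coe_range, Set.mem_Iio]
      split_ifs <;> omega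
    have h2 := Finset.card_eq_sum_card_fiberwise hm
    have h3 : m i * (S.filter fun p => p.1 = i).card =
        ∑ b ∈ range (m i), m i * ((S.filter fun p => p.1 = i).filter fun p => diag' p = b).card := by
      rw [← Finset.mul_sum, ← h2]
    have hmi : 0 < m i := by
      obtain ⟨p, hp⟩ : (S.filter fun p => p.1 = i).Nonempty := by
        rw [← Finset.card_pos]
        exact lt_of_le_of_lt (Nat.zero_le _) (h 0)
      have := hm hp
      simp at this
      omega
    have h4 : ∑ b ∈ range (m i), m i * ((S.filter fun p => p.1 = i).filter fun p => diag' p = b).card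
        < ∑ b ∈ range (m i), (S.filter fun p => p.1 = i).card :=
      Finset.sum_lt_sum_of_nonempty (by simpa using hmi.ne') (fun b _ => h b)
    rw [← h3] at h4
    simp at h4
  choose c hc using h1
  refine ⟨S.filter fun p => diag' p = c p.1, Finset.filter_subset _ _, ?_, ?_, ?_⟩
  · rintro ⟨i, a, b⟩ hp ⟨j, a', b'⟩ hq hij h
    simp only at hij
    subst hij
    have e1 := (mem_filter.1 hp).2.trans (mem_filter.1 hq).2.symm
    simp only [diag'] at e1 h
    have := hnm i
    have e2 : a = a' := Fin.ext h
    have e3 : b = b' := by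
      apply Fin.ext
      split_ifs at e1 <;> omega
    rw [e2, e3]
  · rintro ⟨i, a, b⟩ hp ⟨j, a', b'⟩ hq hij h
    simp only at hij
    subst hij
    have e1 := (mem_filter.1 hp).2.trans (mem_filter.1 hq).2.symm
    simp only [diag'] at e1 h
    have := hnm i
    have e2 : b = b' := Fin.ext h
    have e3 : a = a' := by
      apply Fin.ext
      split_ifs at e1 <;> omega
    rw [e2, e3]
  · rw [Finset.card_eq_sum_card_fiberwise (f := fun p => p.1) (t := univ) (by simp [Set.MapsTo])]
    refine Finset.sum_le_sum fun i _ => (hc i).trans (le_of_eq ?_)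
    congr 2
    ext p
    simp only [mem_filter]
    constructor
    · rintro ⟨⟨h, rfl⟩, h'⟩; exact ⟨⟨h, h'⟩, rfl⟩
    · rintro ⟨⟨h, h'⟩, rfl⟩; exact ⟨⟨h, rfl⟩, h'⟩

theorem card_le_rank (C : ∀ i : Fin ℓ, Matrix (Fin (m i)) (Fin (n i)) F)
    (T : Finset (Σ i : Fin ℓ, Fin (m i) × Fin (n i)))
    (h : LinearIndependent F (fun s : T =>
      (Pi.single s.1.1 (C s.1.1 s.1.2.1) : ∀ i : Fin ℓ, Fin (n i) → F))) (i : Fin ℓ) :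
    (T.filter fun p => p.1 = i).card ≤ (C i).rank := by
  classical
  let ι := {q : Fin (m i) × Fin (n i) // (⟨i, q⟩ : Σ i : Fin ℓ, Fin (m i) × Fin (n i)) ∈ T}
  have hcard : (T.filter fun p => p.1 = i).card = Fintype.card ι := by
    rw [← Fintype.card_coe]
    symm
    refine Fintype.card_of_bijective (f := fun q : ι => ⟨⟨i, q.1⟩, by simp [q.2]⟩) ⟨?_, ?_⟩
    · rintro ⟨q, hq⟩ ⟨q', hq'⟩ h
      exact Subtype.ext (by simpa using h)
    · rintro ⟨⟨j, q⟩, hp⟩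
      have h1 := (mem_filter.1 hp)
      obtain ⟨h2, h3⟩ := h1
      simp only at h3
      subst h3
      exact ⟨⟨q, h2⟩, rfl⟩
  have h1 : LinearIndependent F (fun q : ι => C i q.1.1) := by
    have h2 := h.comp (fun q : ι => (⟨⟨i, q.1⟩, q.2⟩ : T)) (by
      rintro ⟨q, hq⟩ ⟨q', hq'⟩ h
      exact Subtype.ext (by simpa using h))
    exact LinearIndependent.of_comp (LinearMap.single F (fun i : Fin ℓ => Fin (n i) → F) i) h2
  rw [hcard, ← finrank_span_eq_card h1, Matrix.rank_eq_finrank_span_row]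
  apply Submodule.finrank_mono
  apply Submodule.span_mono
  rintro _ ⟨q, rfl⟩
  exact ⟨q.1.1, rfl⟩

theorem core_lemma (hnm : ∀ i, n i ≤ m i) (S : Finset (Σ i : Fin ℓ, Fin (m i) × Fin (n i)))
    (M : (Σ i : Fin ℓ, Fin (m i) × Fin (n i)) → ∀ i : Fin ℓ, Matrix (Fin (m i)) (Fin (n i)) F)
    (hM : ∀ p ∈ S, IsLead (M p) p) (a : ∀ i : Fin ℓ, Matrix (Fin (m i)) (Fin (n i)) F) :
    ∃ U ⊆ S, S.card ≤ wsum (a + ∑ p ∈ U, M p) := by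
  classical
  obtain ⟨T, hTS, hrow, hcol, hcard⟩ := exists_matching hnm S
  let C : (T → Bool) → ∀ i : Fin ℓ, Matrix (Fin (m i)) (Fin (n i)) F :=
    fun x => a + ∑ t : T, if x t then M t.1 else 0
  have hupd : ∀ (x : T → Bool) (s : T), C (Function.update x s true) =
      C (Function.update x s false) + M s.1 := by
    intro x s
    simp only [C]
    rw [← Finset.add_sum_erase _ _ (Finset.mem_univ s), ← Finset.add_sum_erase _ _ (Finset.mem_univ s)]
    have : ∀ b, ∑ t ∈ univ.erase s, (if Function.update x s b t = true then M t.1 else 0)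
        = ∑ t ∈ univ.erase s, (if x t = true then M t.1 else 0) := by
      intro b
      refine Finset.sum_congr rfl fun t ht => ?_
      rw [Function.update_of_ne (Finset.ne_of_mem_erase ht)]
    rw [this, this]
    simp only [Function.update_self, if_true, Bool.false_eq_true, if_false]
    abel
  -- the row of `M t` through `s` vanishes when `s` comes before `t`
  have hzero : ∀ s t : T, posKey s.1 < posKey t.1 → M t.1 s.1.1 s.1.2.1 = 0 := by
    rintro ⟨⟨i, b, c⟩, hs⟩ ⟨⟨j, d, e⟩, ht⟩ hlt
    funext c'
    refine (hM _ (hTS ht)).2 ⟨i, b, c'⟩ ?_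
    simp only [posKey, Prod.Lex.toLex_lt_toLex] at hlt ⊢
    rcases hlt with hlt | ⟨h1, hlt | ⟨h2, hlt⟩⟩
    · exact Or.inl hlt
    · exact Or.inr ⟨h1, Or.inl hlt⟩
    · exfalso
      have := hrow _ hs _ ht (Fin.ext h1) h2
      rw [Sigma.mk.injEq] at this
      obtain ⟨rfl, h⟩ := this
      simp only [heq_eq_eq, Prod.mk.injEq] at h
      rw [h.2] at hlt
      exact lt_irrefl _ hlt
  have hlow : ∀ (s t : T) x b, posKey s.1 < posKey t.1 →
      C (Function.update x t b) s.1.1 s.1.2.1 = C x s.1.1 s.1.2.1 := by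
    intro s t x b hlt
    have h1 : C (Function.update x t true) s.1.1 s.1.2.1 =
        C (Function.update x t false) s.1.1 s.1.2.1 := by
      rw [hupd]
      change C (Function.update x t false) s.1.1 s.1.2.1 + M t.1 s.1.1 s.1.2.1 = _
      rw [hzero s t hlt, add_zero]
    have h2 : ∀ b b', C (Function.update x t b) s.1.1 s.1.2.1 =
        C (Function.update x t b') s.1.1 s.1.2.1 := by
      intro b b'
      cases b <;> cases b' <;> simp [h1]
    rw [h2 b (x t), Function.update_eq_self]
  let r : T → ∀ i : Fin ℓ, Fin (n i) → F := fun s => Pi.single s.1.1 (M s.1 s.1.1 s.1.2.1)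
  have hr : LinearIndependent F r := by
    refine aux_tri (κ := ℕ ×ₗ ℕ) (fun s : T => toLex ((s.1.1 : ℕ), (s.1.2.2 : ℕ))) ?_ r
      (fun s => (LinearMap.proj s.1.2.2 : (Fin (n s.1.1) → F) →ₗ[F] F).comp
        (LinearMap.proj s.1.1)) ?_ ?_
    · intro s t h
      simp only [EmbeddingLike.apply_eq_iff_eq, Prod.mk.injEq] at h
      exact Subtype.ext (hcol _ s.2 _ t.2 (Fin.ext h.1) h.2)
    · rintro ⟨⟨i, b, c⟩, hs⟩ ⟨⟨j, d, e⟩, ht⟩ hlt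
      simp only [Prod.Lex.toLex_lt_toLex] at hlt
      simp only [r, LinearMap.comp_apply, LinearMap.proj_apply]
      by_cases hij : j = i
      · subst hij
        rw [Pi.single_eq_same]
        refine (hM _ (hTS hs)).2 ⟨j, b, e⟩ ?_
        simp only [posKey, Prod.Lex.toLex_lt_toLex]
        rcases hlt with hlt | ⟨_, hlt⟩
        · exact absurd hlt (lt_irrefl _)
        · exact Or.inr ⟨by simp, Or.inr ⟨by simp, hlt⟩⟩
      · rw [Pi.single_eq_of_ne hij]; rfl
    · rintro ⟨⟨i, b, c⟩, hs⟩
      simp only [r, LinearMap.comp_apply, LinearMap.proj_apply, Pi.single_eq_same]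
      exact (hM _ (hTS hs)).1
  obtain ⟨x, hx⟩ := aux_choice (fun s : T => posKey s.1)
    (fun s t h => Subtype.ext (posKey_injective h)) r hr
    (fun s x => Pi.single s.1.1 (C x s.1.1 s.1.2.1))
    (by intro s t x b hlt; simp only [hlow s t x b hlt])
    (by
      intro s x
      rw [← Pi.single_sub, hupd]
      simp only [r]
      congr 1
      change C (Function.update x s false) s.1.1 s.1.2.1 + M s.1 s.1.1 s.1.2.1 - _ = _
      exact add_sub_cancel_left _ _)
  refine ⟨(univ.filter fun t : T => x t = true).image Subtype.val, ?_, ?_⟩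
  · intro p hp
    obtain ⟨t, _, rfl⟩ := Finset.mem_image.1 hp
    exact hTS t.2
  · have hCx : a + ∑ p ∈ (univ.filter fun t : T => x t = true).image Subtype.val, M p = C x := by
      simp only [C]
      rw [Finset.sum_image (fun _ _ _ _ h => Subtype.ext h), Finset.sum_filter]
    rw [hCx]
    refine hcard.trans (Finset.sum_le_sum fun i _ => Nat.mul_le_mul_left _ ?_)
    exact card_le_rank (C x) T hx i

/-- Coset version of the anticode bound. -/
theorem coset_bound (hnm : ∀ i, n i ≤ m i)
    (V : Submodule F (∀ i : Fin ℓ, Matrix (Fin (m i)) (Fin (n i)) F))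
    (a : ∀ i : Fin ℓ, Matrix (Fin (m i)) (Fin (n i)) F) :
    ∃ v ∈ V, Module.finrank F V ≤ wsum (a + v) := by
  classical
  have h : ∀ p, ∃ C : ∀ i : Fin ℓ, Matrix (Fin (m i)) (Fin (n i)) F,
      p ∈ leads V → C ∈ V ∧ IsLead C p := by
    intro p
    by_cases hp : p ∈ leads V
    · obtain ⟨C, h1, h2⟩ := (mem_leads V p).1 hp
      exact ⟨C, fun _ => ⟨h1, h2⟩⟩
    · exact ⟨0, fun h => absurd h hp⟩
  choose M hM using h
  obtain ⟨U, hU, hle⟩ := core_lemma hnm (leads V) M (fun p hp => (hM p hp).2) a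
  exact ⟨_, Submodule.sum_mem _ fun p hp => (hM p (hU hp)).1, (finrank_le_leads V).trans hle⟩

/-- Two-coset version of the anticode bound. -/
theorem two_coset_bound (hnm : ∀ i, n i ≤ m i)
    (V : Submodule F (∀ i : Fin ℓ, Matrix (Fin (m i)) (Fin (n i)) F))
    (a e : ∀ i : Fin ℓ, Matrix (Fin (m i)) (Fin (n i)) F) (he : e ∉ V) :
    ∃ v ∈ V, Module.finrank F V + 1 ≤ wsum (a + v) ∨ Module.finrank F V + 1 ≤ wsum (a + e + v) := by
  classical
  have hne : (univ.filter fun p : (Σ i : Fin ℓ, Fin (m i) × Fin (n i)) =>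
      ∃ v ∈ V, IsLead (e + v) p).Nonempty := by
    obtain ⟨p, hp⟩ := exists_isLead e (fun h => he (h ▸ V.zero_mem))
    exact ⟨p, by simpa using ⟨0, V.zero_mem, by simpa using hp⟩⟩
  obtain ⟨p₀, hp₀, hmax⟩ := Finset.exists_max_image _ posKey hne
  obtain ⟨v₀, hv₀, hlead⟩ : ∃ v ∈ V, IsLead (e + v) p₀ := by simpa using hp₀
  have hnot : p₀ ∉ leads V := by
    intro hmem
    obtain ⟨C, hC, hCl⟩ := (mem_leads V p₀).1 hmem
    set lam : F := (e + v₀) p₀.1 p₀.2.1 p₀.2.2 / C p₀.1 p₀.2.1 p₀.2.2 with hlam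
    have hv1 : v₀ - lam • C ∈ V := V.sub_mem hv₀ (V.smul_mem _ hC)
    have hne1 : e + (v₀ - lam • C) ≠ 0 := by
      intro h
      apply he
      rw [eq_neg_of_add_eq_zero_left h]
      exact V.neg_mem hv1
    obtain ⟨p₁, hp₁⟩ := exists_isLead _ hne1
    have hle : posKey p₁ ≤ posKey p₀ := hmax p₁ (by simpa using ⟨_, hv1, hp₁⟩)
    apply hp₁.1
    have hval : ∀ q : (Σ i : Fin ℓ, Fin (m i) × Fin (n i)),
        (e + (v₀ - lam • C)) q.1 q.2.1 q.2.2 =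
        (e + v₀) q.1 q.2.1 q.2.2 - lam * C q.1 q.2.1 q.2.2 := by
      intro q
      rw [← add_sub_assoc]
      rfl
    rw [hval]
    rcases hle.lt_or_eq with hlt | heq
    · rw [hlead.2 _ hlt, hCl.2 _ hlt]; simp
    · have := posKey_injective heq
      subst this
      rw [hlam, div_mul_cancel₀ _ hCl.1, sub_self]
  have h : ∀ p, ∃ C : ∀ i : Fin ℓ, Matrix (Fin (m i)) (Fin (n i)) F,
      (p ∈ leads V → C ∈ V ∧ IsLead C p) ∧ (p = p₀ → C = e + v₀) := by
    intro p
    by_cases hp : p ∈ leads V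
    · obtain ⟨C, h1, h2⟩ := (mem_leads V p).1 hp
      exact ⟨C, fun _ => ⟨h1, h2⟩, fun h => absurd (h ▸ hp) hnot⟩
    · exact ⟨e + v₀, fun h => absurd h hp, fun _ => rfl⟩
  choose M hM using h
  obtain ⟨U, hU, hle⟩ := core_lemma hnm (insert p₀ (leads V)) M (fun p hp => by
    rcases Finset.mem_insert.1 hp with rfl | hp
    · rw [(hM p).2 rfl]; exact hlead
    · exact ((hM p).1 hp).2) a
  rw [Finset.card_insert_of_notMem hnot] at hle
  have hle := (Nat.add_le_add_right (finrank_le_leads V) 1).trans hle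
  have hsub : ∀ p ∈ U, p ≠ p₀ → M p ∈ V := by
    intro p hp hne
    rcases Finset.mem_insert.1 (hU hp) with h | h
    · exact absurd h hne
    · exact ((hM p).1 h).1
  by_cases hpU : p₀ ∈ U
  · refine ⟨v₀ + ∑ p ∈ U.erase p₀, M p, V.add_mem hv₀ (Submodule.sum_mem _ fun p hp =>
      hsub p (Finset.mem_of_mem_erase hp) (Finset.ne_of_mem_erase hp)), Or.inr ?_⟩
    rw [← Finset.add_sum_erase _ _ hpU, (hM p₀).2 rfl] at hle
    have e1 : a + e + (v₀ + ∑ p ∈ U.erase p₀, M p) = a + (e + v₀ + ∑ p ∈ U.erase p₀, M p) := by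
      abel
    rw [e1]
    exact hle
  · exact ⟨_, Submodule.sum_mem _ fun p hp => hsub p hp (fun h => hpU (h ▸ hp)), Or.inl hle⟩

end Positions
section Splitting

variable {F : Type*} [Field F] {ℓ : ℕ} {m n : Fin ℓ → ℕ}

theorem rank_nullity_le {V W : Type*} [AddCommGroup V] [Module F V] [FiniteDimensional F V]
    [AddCommGroup W] [Module F W] (f : V →ₗ[F] W) (U : Submodule F V) :
    Module.finrank F U ≤ Module.finrank F (U.map f) +
      Module.finrank F (U ⊓ LinearMap.ker f : Submodule F V) := by
  have h := LinearMap.finrank_range_add_finrank_ker (f.domRestrict U)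
  rw [LinearMap.range_domRestrict, LinearMap.ker_domRestrict,
    ← Submodule.finrank_map_subtype_eq, Submodule.map_comap_subtype] at h
  exact h.ge

/-- Keep the blocks in `s`, put zero elsewhere. -/
def blockPr (s : Finset (Fin ℓ)) : (∀ i : Fin ℓ, Matrix (Fin (m i)) (Fin (n i)) F) →ₗ[F]
    (∀ i : Fin ℓ, Matrix (Fin (m i)) (Fin (n i)) F) where
  toFun C i := if i ∈ s then C i else 0
  map_add' C D := by funext i; by_cases h : i ∈ s <;> simp [h]
  map_smul' c C := by funext i; by_cases h : i ∈ s <;> simp [h]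

theorem blockPr_apply (s : Finset (Fin ℓ)) (C : ∀ i : Fin ℓ, Matrix (Fin (m i)) (Fin (n i)) F)
    (i : Fin ℓ) : blockPr s C i = if i ∈ s then C i else 0 := rfl

theorem blockPr_add_compl (s : Finset (Fin ℓ))
    (C : ∀ i : Fin ℓ, Matrix (Fin (m i)) (Fin (n i)) F) :
    blockPr s C + blockPr sᶜ C = C := by
  funext i
  by_cases h : i ∈ s <;> simp [blockPr_apply, h]

theorem blockPr_eq_self (s : Finset (Fin ℓ))
    (C : ∀ i : Fin ℓ, Matrix (Fin (m i)) (Fin (n i)) F) (h : blockPr sᶜ C = 0) :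
    blockPr s C = C := by
  have := blockPr_add_compl s C
  rwa [h, add_zero] at this

theorem blockPr_compl_self (s : Finset (Fin ℓ))
    (C : ∀ i : Fin ℓ, Matrix (Fin (m i)) (Fin (n i)) F) :
    blockPr sᶜ (blockPr s C) = 0 := by
  funext i
  by_cases h : i ∈ s <;> simp [blockPr_apply, h]

theorem blockPr_self_compl (s : Finset (Fin ℓ))
    (C : ∀ i : Fin ℓ, Matrix (Fin (m i)) (Fin (n i)) F) :
    blockPr s (blockPr sᶜ C) = 0 := by
  funext i
  by_cases h : i ∈ s <;> simp [blockPr_apply, h]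

theorem wsum_blockPr (s : Finset (Fin ℓ))
    (C : ∀ i : Fin ℓ, Matrix (Fin (m i)) (Fin (n i)) F) :
    wsum (blockPr s C) = ∑ i ∈ s, m i * (C i).rank := by
  rw [wsum, ← Finset.sum_subset (Finset.subset_univ s)]
  · exact Finset.sum_congr rfl fun i hi => by rw [blockPr_apply, if_pos hi]
  · intro i _ hi
    rw [blockPr_apply, if_neg hi, Matrix.rank_zero, mul_zero]

theorem wsum_split (s : Finset (Fin ℓ))
    (C : ∀ i : Fin ℓ, Matrix (Fin (m i)) (Fin (n i)) F) :
    wsum C = wsum (blockPr s C) + wsum (blockPr sᶜ C) := by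
  rw [wsum_blockPr, wsum_blockPr, Finset.sum_add_sum_compl]
  rfl

/-- The splitting lemma: a block with `m i > 1` splits off. -/
theorem split_block (hnm : ∀ i, n i ≤ m i)
    (V : Submodule F (∀ i : Fin ℓ, Matrix (Fin (m i)) (Fin (n i)) F))
    (hV : ∀ C ∈ V, wsum C ≤ Module.finrank F V) (i : Fin ℓ) (hi : 1 < m i)
    (e : ∀ i : Fin ℓ, Matrix (Fin (m i)) (Fin (n i)) F) (he : e ∈ V) :
    blockPr {i} e ∈ V := by
  obtain ⟨s, hs⟩ : ∃ s : Finset (Fin ℓ), s = {i} := ⟨_, rfl⟩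
  rw [← hs]
  obtain ⟨I, hI⟩ : ∃ I : Submodule F (∀ i : Fin ℓ, Matrix (Fin (m i)) (Fin (n i)) F),
    I = V ⊓ LinearMap.ker (blockPr sᶜ) := ⟨_, rfl⟩
  obtain ⟨K, hK⟩ : ∃ K : Submodule F (∀ i : Fin ℓ, Matrix (Fin (m i)) (Fin (n i)) F),
    K = V ⊓ LinearMap.ker (blockPr s) := ⟨_, rfl⟩
  have hImem : ∀ v, v ∈ I ↔ v ∈ V ∧ blockPr sᶜ v = 0 := by
    intro v; rw [hI, Submodule.mem_inf, LinearMap.mem_ker]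
  have hKmem : ∀ v, v ∈ K ↔ v ∈ V ∧ blockPr s v = 0 := by
    intro v; rw [hK, Submodule.mem_inf, LinearMap.mem_ker]
  have hIV : ∀ v ∈ I, v ∈ V := fun v hv => ((hImem v).1 hv).1
  have hIzero : ∀ v ∈ I, blockPr sᶜ v = 0 := fun v hv => ((hImem v).1 hv).2
  have hIself : ∀ v ∈ I, blockPr s v = v := fun v hv => blockPr_eq_self s v (hIzero v hv)
  have hws : ∀ C : ∀ i : Fin ℓ, Matrix (Fin (m i)) (Fin (n i)) F,
      wsum (blockPr s C) = m i * (C i).rank := by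
    intro C; rw [wsum_blockPr, hs, Finset.sum_singleton]
  have hsum : ∀ c, ∀ v ∈ I, wsum (c + v) = wsum (blockPr s c + v) + wsum (blockPr sᶜ c) := by
    intro c v hv
    rw [wsum_split s (c + v), map_add, map_add, hIself v hv, hIzero v hv, add_zero]
  -- divisibility
  have hdvd : m i ∣ Module.finrank F I := by
    obtain ⟨q, hq, hle⟩ := coset_bound hnm (V.map (blockPr sᶜ)) 0
    obtain ⟨c, hc, rfl⟩ := hq
    rw [zero_add] at hle
    obtain ⟨v, hv, hle2⟩ := coset_bound hnm I (blockPr s c)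
    have h1 := rank_nullity_le (blockPr sᶜ) V
    have h2 := hV (c + v) (V.add_mem hc (hIV v hv))
    rw [hsum c v hv] at h2
    have h3 : wsum (blockPr s c + v) = Module.finrank F I := by
      rw [← hI] at h1
      omega
    rw [← h3]
    have h4 : blockPr s c + v = blockPr s (c + v) := by rw [map_add, hIself v hv]
    rw [h4, hws]
    exact dvd_mul_right _ _
  by_contra hnot
  have heIK : e ∉ I ⊔ K := by
    intro h
    obtain ⟨u, hu, k, hk, rfl⟩ := Submodule.mem_sup.1 h
    apply hnot
    rw [map_add, hIself u hu, ((hKmem k).1 hk).2, add_zero]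
    exact hIV u hu
  obtain ⟨f, hfe, hf⟩ := Submodule.exists_le_ker_of_notMem heIK
  obtain ⟨H, hH⟩ : ∃ H : Submodule F (∀ i : Fin ℓ, Matrix (Fin (m i)) (Fin (n i)) F),
    H = V ⊓ LinearMap.ker f := ⟨_, rfl⟩
  have hHmem : ∀ v, v ∈ H ↔ v ∈ V ∧ f v = 0 := by
    intro v; rw [hH, Submodule.mem_inf, LinearMap.mem_ker]
  have hHdim : Module.finrank F V ≤ Module.finrank F H + 1 := by
    have h1 := rank_nullity_le f V
    have h2 : Module.finrank F (V.map f) ≤ 1 := by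
      simpa using Submodule.finrank_le (V.map f)
    rw [← hH] at h1
    omega
  obtain ⟨Q, hQ⟩ : ∃ Q : Submodule F (∀ i : Fin ℓ, Matrix (Fin (m i)) (Fin (n i)) F),
    Q = H.map (blockPr sᶜ) := ⟨_, rfl⟩
  have hQmem : ∀ q ∈ Q, ∃ h ∈ H, blockPr sᶜ h = q := by
    intro q hq
    rw [hQ] at hq
    exact Submodule.mem_map.1 hq
  have hQdim : Module.finrank F H ≤ Module.finrank F Q + Module.finrank F I := by
    have h1 := rank_nullity_le (blockPr sᶜ) H
    rw [← hQ] at h1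
    refine h1.trans (Nat.add_le_add_left (Submodule.finrank_mono ?_) _)
    intro v hv
    rw [Submodule.mem_inf, LinearMap.mem_ker] at hv
    exact (hImem v).2 ⟨((hHmem v).1 hv.1).1, hv.2⟩
  obtain ⟨q, hq, hle⟩ := coset_bound hnm Q 0
  obtain ⟨c, hc, rfl⟩ := hQmem q hq
  obtain ⟨q, hq, hle'⟩ := coset_bound hnm Q (blockPr sᶜ e)
  obtain ⟨h', hh', rfl⟩ := hQmem q hq
  rw [zero_add] at hle
  rw [← map_add] at hle'
  have hh' := (hHmem h').1 hh'
  have hc := (hHmem c).1 hc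
  obtain ⟨c', hc'⟩ : ∃ c', c' = e + h' := ⟨_, rfl⟩
  rw [← hc'] at hle'
  have hc'V : c' ∈ V := by rw [hc']; exact V.add_mem he hh'.1
  have hfc : f c = 0 := hc.2
  have hfc' : f c' ≠ 0 := by
    rw [hc', map_add, hh'.2, add_zero]; exact hfe
  have hdel : blockPr s (c' - c) ∉ I := by
    intro hmem
    have h1 : blockPr sᶜ (c' - c) ∈ K := by
      refine (hKmem _).2 ⟨?_, blockPr_self_compl s _⟩
      have h2 : blockPr sᶜ (c' - c) = (c' - c) - blockPr s (c' - c) :=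
        eq_sub_of_add_eq' (blockPr_add_compl s _)
      rw [h2]
      exact V.sub_mem (V.sub_mem hc'V hc.1) (hIV _ hmem)
    have h2 : c' - c ∈ I ⊔ K := by
      rw [← blockPr_add_compl s (c' - c)]
      exact Submodule.add_mem_sup hmem h1
    have h3 : f (c' - c) = 0 := hf h2
    rw [map_sub, hfc, sub_zero] at h3
    exact hfc' h3
  obtain ⟨v, hv, hor⟩ := two_coset_bound hnm I (blockPr s c) _ hdel
  have hfin : ∀ d ∈ V, Module.finrank F Q ≤ wsum (blockPr sᶜ d) →
      Module.finrank F I + 1 ≤ wsum (blockPr s d + v) → False := by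
    intro d hd h1 h2
    have h3 := hV (d + v) (V.add_mem hd (hIV v hv))
    rw [hsum d v hv] at h3
    have h4 : blockPr s d + v = blockPr s (d + v) := by rw [map_add, hIself v hv]
    have h5 : wsum (blockPr s d + v) = m i * ((d + v) i).rank := by rw [h4, hws]
    obtain ⟨t, ht⟩ := hdvd
    have h6 : t < ((d + v) i).rank := by
      by_contra h
      have := Nat.mul_le_mul_left (m i) (not_lt.1 h)
      omega
    have h7 := Nat.mul_le_mul_left (m i) (Nat.succ_le_of_lt h6)
    rw [Nat.mul_succ] at h7
    omega
  rcases hor with h | h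
  · exact hfin c hc.1 hle h
  · refine hfin c' hc'V hle' ?_
    have h1 : blockPr s c + blockPr s (c' - c) = blockPr s c' := by
      rw [← map_add, add_sub_cancel]
    rwa [h1] at h

theorem part_bound (hnm : ∀ i, n i ≤ m i)
    (V : Submodule F (∀ i : Fin ℓ, Matrix (Fin (m i)) (Fin (n i)) F))
    (hV : ∀ C ∈ V, wsum C ≤ Module.finrank F V) (s : Finset (Fin ℓ))
    (u : ∀ i : Fin ℓ, Matrix (Fin (m i)) (Fin (n i)) F) (hu : u ∈ V) (hu' : blockPr sᶜ u = 0) :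
    wsum u ≤ Module.finrank F (V.map (blockPr s)) := by
  have h1 := rank_nullity_le (blockPr s) V
  obtain ⟨v, hv, hle⟩ := coset_bound hnm (V ⊓ LinearMap.ker (blockPr s)) 0
  rw [zero_add] at hle
  have h2 := hV (u + v) (V.add_mem hu hv.1)
  have hv0 : blockPr s v = 0 := hv.2
  have hvv : blockPr sᶜ v = v := by
    have := blockPr_add_compl s v
    rwa [hv0, zero_add] at this
  rw [wsum_split s, map_add, map_add, hv0, hu', zero_add, add_zero, hvv,
    blockPr_eq_self s u hu'] at h2
  omega

end Splitting

section Optimality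

set_option linter.unusedSectionVars false

variable {F : Type*} [Field F] [Fintype F] {ℓ : ℕ} {m n : Fin ℓ → ℕ}

theorem isOptAnticode_iff (hnm : ∀ i, n i ≤ m i)
    (V : Submodule F (∀ i : Fin ℓ, Matrix (Fin (m i)) (Fin (n i)) F)) :
    IsOptAnticode V ↔ ∀ C ∈ V, wsum C ≤ Module.finrank F V := by
  have hfin : BddAbove {w | ∃ C ∈ V, w = wsum C} := by
    apply Set.Finite.bddAbove
    refine (Set.finite_range (wsum : (∀ i : Fin ℓ, Matrix (Fin (m i)) (Fin (n i)) F) → ℕ)).subset ?_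
    rintro _ ⟨C, _, rfl⟩
    exact ⟨C, rfl⟩
  constructor
  · intro h C hC
    rw [h]
    exact le_csSup hfin ⟨C, hC, rfl⟩
  · intro h
    apply le_antisymm
    · obtain ⟨v, hv, hle⟩ := coset_bound hnm V 0
      rw [zero_add] at hle
      exact hle.trans (le_csSup hfin ⟨v, hv, rfl⟩)
    · refine csSup_le ⟨_, 0, V.zero_mem, rfl⟩ ?_
      rintro _ ⟨C, hC, rfl⟩
      exact h C hC

theorem wsum_single (i : Fin ℓ) (M : Matrix (Fin (m i)) (Fin (n i)) F) :
    wsum (Pi.single i M : ∀ i : Fin ℓ, Matrix (Fin (m i)) (Fin (n i)) F) = m i * M.rank := by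
  rw [wsum, Finset.sum_eq_single i]
  · rw [Pi.single_eq_same]
  · intro j _ hj
    rw [Pi.single_eq_of_ne hj, Matrix.rank_zero, mul_zero]
  · simp

theorem isOptRk_iff (hnm : ∀ i, n i ≤ m i) (i : Fin ℓ)
    (A : Submodule F (Matrix (Fin (m i)) (Fin (n i)) F)) :
    IsOptRkAnticode A ↔ ∀ M ∈ A, m i * M.rank ≤ Module.finrank F A := by
  have hfin : BddAbove {r | ∃ M ∈ A, (M : Matrix (Fin (m i)) (Fin (n i)) F).rank = r} := by
    apply Set.Finite.bddAbove
    refine (Set.finite_range (rank : Matrix (Fin (m i)) (Fin (n i)) F → ℕ)).subset ?_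
    rintro _ ⟨C, _, rfl⟩
    exact ⟨C, rfl⟩
  constructor
  · intro h C hC
    rw [h]
    exact Nat.mul_le_mul_left _ (le_csSup hfin ⟨C, hC, rfl⟩)
  · intro h
    apply le_antisymm
    · obtain ⟨v, hv, hle⟩ := coset_bound hnm
        (A.map (LinearMap.single F (fun i : Fin ℓ => Matrix (Fin (m i)) (Fin (n i)) F) i)) 0
      rw [zero_add] at hle
      obtain ⟨M, hM, rfl⟩ := hv
      rw [← LinearEquiv.finrank_eq (Submodule.equivMapOfInjective
        (LinearMap.single F (fun i : Fin ℓ => Matrix (Fin (m i)) (Fin (n i)) F) i)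
        (Pi.single_injective (M := fun i : Fin ℓ => Matrix (Fin (m i)) (Fin (n i)) F) i) A)] at hle
      exact hle.trans ((wsum_single i M).le.trans
        (Nat.mul_le_mul_left _ (le_csSup hfin ⟨M, hM, rfl⟩)))
    · obtain ⟨M, hM, hMr⟩ := Nat.sSup_mem (s := {r | ∃ M ∈ A,
        (M : Matrix (Fin (m i)) (Fin (n i)) F).rank = r}) ⟨_, 0, A.zero_mem, rfl⟩ hfin
      rw [← hMr]
      exact h M hM

/-- Extension by zero from the blocks with index at least `k`. -/
def extZero (k : ℕ) :
    (∀ i : {i : Fin ℓ // k ≤ (i : ℕ)}, Matrix (Fin (m i)) (Fin (n i)) F) →ₗ[F]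
    (∀ i : Fin ℓ, Matrix (Fin (m i)) (Fin (n i)) F) where
  toFun C i := if h : k ≤ (i : ℕ) then C ⟨i, h⟩ else 0
  map_add' C D := by funext i; by_cases h : k ≤ (i : ℕ) <;> simp [h]
  map_smul' c C := by funext i; by_cases h : k ≤ (i : ℕ) <;> simp [h]

theorem extZero_apply (k : ℕ)
    (C : ∀ i : {i : Fin ℓ // k ≤ (i : ℕ)}, Matrix (Fin (m i)) (Fin (n i)) F) (i : Fin ℓ) :
    extZero k C i = if h : k ≤ (i : ℕ) then C ⟨i, h⟩ else 0 := rfl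

theorem extZero_injective (k : ℕ) : Function.Injective (extZero k :
    (∀ i : {i : Fin ℓ // k ≤ (i : ℕ)}, Matrix (Fin (m i)) (Fin (n i)) F) →ₗ[F] _) := by
  intro C D h
  funext i
  have := congrFun h i.1
  simpa [extZero_apply, i.2] using this

open Classical in
theorem rank_oneByOne (M : Matrix (Fin 1) (Fin 1) F) : M.rank = if M = 0 then 0 else 1 := by
  split_ifs with h
  · rw [h, Matrix.rank_zero]
  · apply le_antisymm
    · exact (Matrix.rank_le_width M)
    · by_contra h'
      apply h
      have h0 : M.rank = 0 := by omega
      rw [Matrix.rank_eq_finrank_span_row, Submodule.finrank_eq_zero, Submodule.span_eq_bot] at h0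
      ext a b
      exact congrFun (h0 (M.row a) ⟨a, rfl⟩) b

open Classical in
theorem rank_of_one {a b : ℕ} (ha : a = 1) (hb : b = 1) (M : Matrix (Fin a) (Fin b) F) :
    a * M.rank = if M = 0 then 0 else 1 := by
  subst ha hb
  rw [rank_oneByOne, one_mul]

theorem wsum_tail (k : ℕ) (hm1 : ∀ i : Fin ℓ, k ≤ (i : ℕ) → m i = 1)
    (hn1 : ∀ i : Fin ℓ, k ≤ (i : ℕ) → n i = 1)
    (C : ∀ i : Fin ℓ, Matrix (Fin (m i)) (Fin (n i)) F) :
    ∑ i ∈ univ.filter (fun i : Fin ℓ => k ≤ (i : ℕ)), m i * (C i).rank =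
      Nat.card {i : {i : Fin ℓ // k ≤ (i : ℕ)} // C i ≠ 0} := by
  classical
  rw [Finset.sum_congr rfl (g := fun i => if C i = 0 then 0 else 1)]
  · rw [← Finset.sum_subtype_of_mem (p := fun i : Fin ℓ => k ≤ (i : ℕ)) (fun i => if C i = 0 then 0 else 1)
      (by simp), Nat.card_eq_fintype_card, Fintype.card_subtype, Finset.card_filter]
    refine Finset.sum_congr (by ext i; simpa using i.2) fun i _ => by simp [ite_not]
  · intro i hi
    have hi' : k ≤ (i : ℕ) := by simpa using hi
    exact rank_of_one (hm1 i hi') (hn1 i hi') (C i)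

theorem wsum_extZero (k : ℕ) (hm1 : ∀ i : Fin ℓ, k ≤ (i : ℕ) → m i = 1)
    (hn1 : ∀ i : Fin ℓ, k ≤ (i : ℕ) → n i = 1)
    (C : ∀ i : {i : Fin ℓ // k ≤ (i : ℕ)}, Matrix (Fin (m i)) (Fin (n i)) F) :
    wsum (extZero k C) = Nat.card {i // C i ≠ 0} := by
  have h1 : (fun i : {i : Fin ℓ // k ≤ (i : ℕ)} => extZero k C i) = C := by
    funext i
    rw [extZero_apply, dif_pos i.2]
  have h2 := wsum_tail k hm1 hn1 (extZero k C)
  have h3 : Nat.card {i : {i : Fin ℓ // k ≤ (i : ℕ)} // extZero k C i ≠ 0} =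
      Nat.card {i // C i ≠ 0} := by
    congr! 3 with i
    rw [congrFun h1 i]
  rw [← h3, ← h2, wsum]
  symm
  apply Finset.sum_subset (Finset.subset_univ _)
  intro i _ hi
  have hi' : ¬ k ≤ (i : ℕ) := by simpa using hi
  rw [extZero_apply, dif_neg hi', Matrix.rank_zero, mul_zero]

theorem isOptHamming_iff (hnm : ∀ i, n i ≤ m i) (k : ℕ)
    (hm1 : ∀ i : Fin ℓ, k ≤ (i : ℕ) → m i = 1) (hn1 : ∀ i : Fin ℓ, k ≤ (i : ℕ) → n i = 1)
    (A : Submodule F (∀ i : {i : Fin ℓ // k ≤ (i : ℕ)}, Matrix (Fin (m i)) (Fin (n i)) F)) :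
    IsOptHammingAnticode A ↔ ∀ C ∈ A, Nat.card {i // C i ≠ 0} ≤ Module.finrank F A := by
  have hfin : BddAbove {w | ∃ C ∈ A, w = Nat.card {i // C i ≠ 0}} := by
    apply Set.Finite.bddAbove
    refine (Set.finite_range (fun C : (∀ i : {i : Fin ℓ // k ≤ (i : ℕ)},
      Matrix (Fin (m i)) (Fin (n i)) F) => Nat.card {i // C i ≠ 0})).subset ?_
    rintro _ ⟨C, _, rfl⟩
    exact ⟨C, rfl⟩
  constructor
  · intro h C hC
    rw [h]
    exact le_csSup hfin ⟨C, hC, rfl⟩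
  · intro h
    apply le_antisymm
    · obtain ⟨v, hv, hle⟩ := coset_bound hnm (A.map (extZero k)) 0
      rw [zero_add] at hle
      obtain ⟨M, hM, rfl⟩ := hv
      rw [(LinearEquiv.finrank_eq (Submodule.equivMapOfInjective _ (extZero_injective k) A)).symm,
        wsum_extZero k hm1 hn1] at hle
      exact hle.trans (le_csSup hfin ⟨M, hM, rfl⟩)
    · refine csSup_le ⟨_, 0, A.zero_mem, rfl⟩ ?_
      rintro _ ⟨C, hC, rfl⟩
      exact h C hC

end Optimality
section Assembly

set_option linter.unusedSectionVars false

variable {F : Type*} [Field F] [Fintype F] {ℓ : ℕ} {m n : Fin ℓ → ℕ}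

theorem blockPr_singleton (i : Fin ℓ) (C : ∀ i : Fin ℓ, Matrix (Fin (m i)) (Fin (n i)) F) :
    blockPr {i} C = Pi.single i (C i) := by
  funext j
  by_cases h : j = i
  · subst h; simp [blockPr_apply]
  · simp [blockPr_apply, h]

theorem blockPr_tail (k : ℕ) (C : ∀ i : Fin ℓ, Matrix (Fin (m i)) (Fin (n i)) F) :
    blockPr (univ.filter fun i : Fin ℓ => k ≤ (i : ℕ)) C =
      extZero k (fun i : {i : Fin ℓ // k ≤ (i : ℕ)} => C i) := by
  funext j
  by_cases h : k ≤ (j : ℕ) <;> simp [blockPr_apply, extZero_apply, h]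

theorem decomp (k : ℕ) (C : ∀ i : Fin ℓ, Matrix (Fin (m i)) (Fin (n i)) F) :
    C = (∑ i ∈ univ.filter (fun i : Fin ℓ => (i : ℕ) < k), Pi.single i (C i)) +
      extZero k (fun i : {i : Fin ℓ // k ≤ (i : ℕ)} => C i) := by
  funext j
  rw [Pi.add_apply, Finset.sum_apply, extZero_apply]
  by_cases h : k ≤ (j : ℕ)
  · rw [dif_pos h, Finset.sum_eq_zero, zero_add]
    intro i hi
    have hi' : (i : ℕ) < k := by simpa using hi
    rw [Pi.single_eq_of_ne]
    rintro rfl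
    omega
  · rw [dif_neg h, add_zero, Finset.sum_eq_single j]
    · rw [Pi.single_eq_same]
    · intro i _ hij
      rw [Pi.single_eq_of_ne hij.symm]
    · intro h'
      exact absurd (by simpa using h) h'

theorem forward (hnm : ∀ i, n i ≤ m i) (k : ℕ)
    (hk1 : ∀ i : Fin ℓ, (i : ℕ) < k → 1 < m i)
    (hm1 : ∀ i : Fin ℓ, k ≤ (i : ℕ) → m i = 1) (hn1 : ∀ i : Fin ℓ, k ≤ (i : ℕ) → n i = 1)
    (V : Submodule F (∀ i : Fin ℓ, Matrix (Fin (m i)) (Fin (n i)) F)) (hV : IsOptAnticode V) :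
    ∃ (𝒜 : ∀ i : Fin ℓ, Submodule F (Matrix (Fin (m i)) (Fin (n i)) F))
      (𝒞' : Submodule F (∀ i : {i : Fin ℓ // k ≤ (i : ℕ)}, Matrix (Fin (m i)) (Fin (n i)) F)),
      (∀ i : Fin ℓ, (i : ℕ) < k → IsOptRkAnticode (𝒜 i)) ∧
      IsOptHammingAnticode 𝒞' ∧
      (∀ C : ∀ i : Fin ℓ, Matrix (Fin (m i)) (Fin (n i)) F,
        C ∈ V ↔
          (∀ i : Fin ℓ, (i : ℕ) < k → C i ∈ 𝒜 i) ∧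
          (fun i : {i : Fin ℓ // k ≤ (i : ℕ)} => C i) ∈ 𝒞') := by
  rw [isOptAnticode_iff hnm] at hV
  have hsingle : ∀ i : Fin ℓ, (i : ℕ) < k → ∀ C ∈ V,
      (Pi.single i (C i) : ∀ i : Fin ℓ, Matrix (Fin (m i)) (Fin (n i)) F) ∈ V := by
    intro i hi C hC
    rw [← blockPr_singleton]
    exact split_block hnm V hV i (hk1 i hi) C hC
  have htail : ∀ C ∈ V, extZero k (fun i : {i : Fin ℓ // k ≤ (i : ℕ)} => C i) ∈ V := by
    intro C hC
    rw [eq_sub_of_add_eq' (decomp k C).symm]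
    exact V.sub_mem hC (V.sum_mem fun i hi => hsingle i (by simpa using hi) C hC)
  refine ⟨fun i => V.comap (LinearMap.single F (fun i : Fin ℓ => Matrix (Fin (m i)) (Fin (n i)) F) i),
    V.comap (extZero k), ?_, ?_, ?_⟩
  · intro i hi
    rw [isOptRk_iff hnm]
    intro M hM
    have hM' : (Pi.single i M : ∀ i : Fin ℓ, Matrix (Fin (m i)) (Fin (n i)) F) ∈ V := hM
    have h1 := part_bound hnm V hV {i} _ hM' (by
      have := blockPr_compl_self {i}
        (Pi.single i M : ∀ i : Fin ℓ, Matrix (Fin (m i)) (Fin (n i)) F)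
      rwa [blockPr_singleton, Pi.single_eq_same] at this)
    rw [wsum_single] at h1
    refine h1.trans ?_
    refine le_trans (Submodule.finrank_mono ?_) (Submodule.finrank_map_le
      (LinearMap.single F (fun i : Fin ℓ => Matrix (Fin (m i)) (Fin (n i)) F) i) _)
    rintro _ ⟨C, hC, rfl⟩
    exact ⟨C i, hsingle i hi C hC, (blockPr_singleton i C).symm⟩
  · rw [isOptHamming_iff hnm k hm1 hn1]
    intro C hC
    have hres : (fun i : {i : Fin ℓ // k ≤ (i : ℕ)} => extZero k C i) = C := by
      funext i
      rw [extZero_apply, dif_pos i.2]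
    have hC' : extZero k C ∈ V := hC
    have h1 := part_bound hnm V hV (univ.filter fun i : Fin ℓ => k ≤ (i : ℕ)) _ hC' (by
      have := blockPr_compl_self (univ.filter fun i : Fin ℓ => k ≤ (i : ℕ)) (extZero k C)
      rwa [blockPr_tail, hres] at this)
    rw [wsum_extZero k hm1 hn1] at h1
    refine h1.trans ?_
    refine le_trans (Submodule.finrank_mono ?_) (Submodule.finrank_map_le (extZero k) _)
    rintro _ ⟨D, hD, rfl⟩
    exact ⟨_, htail D hD, (blockPr_tail k D).symm⟩
  · intro C
    constructor
    · intro hC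
      exact ⟨fun i hi => hsingle i hi C hC, htail C hC⟩
    · rintro ⟨h1, h2⟩
      rw [decomp k C]
      exact V.add_mem (V.sum_mem fun i hi => h1 i (by simpa using hi)) h2

theorem backward (hnm : ∀ i, n i ≤ m i) (k : ℕ)
    (hm1 : ∀ i : Fin ℓ, k ≤ (i : ℕ) → m i = 1) (hn1 : ∀ i : Fin ℓ, k ≤ (i : ℕ) → n i = 1)
    (V : Submodule F (∀ i : Fin ℓ, Matrix (Fin (m i)) (Fin (n i)) F))
    (𝒜 : ∀ i : Fin ℓ, Submodule F (Matrix (Fin (m i)) (Fin (n i)) F))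
    (𝒞' : Submodule F (∀ i : {i : Fin ℓ // k ≤ (i : ℕ)}, Matrix (Fin (m i)) (Fin (n i)) F))
    (hA : ∀ i : Fin ℓ, (i : ℕ) < k → IsOptRkAnticode (𝒜 i))
    (hC' : IsOptHammingAnticode 𝒞')
    (hV : ∀ C : ∀ i : Fin ℓ, Matrix (Fin (m i)) (Fin (n i)) F,
        C ∈ V ↔
          (∀ i : Fin ℓ, (i : ℕ) < k → C i ∈ 𝒜 i) ∧
          (fun i : {i : Fin ℓ // k ≤ (i : ℕ)} => C i) ∈ 𝒞') : IsOptAnticode V := by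
  rw [isOptAnticode_iff hnm]
  rw [isOptHamming_iff hnm k hm1 hn1] at hC'
  intro C hC
  let f : ((∀ i : {i : Fin ℓ // (i : ℕ) < k}, 𝒜 i) × 𝒞') →ₗ[F] V :=
    { toFun := fun x => ⟨fun i => if h : (i : ℕ) < k then (x.1 ⟨i, h⟩).1
          else x.2.1 ⟨i, not_lt.1 h⟩, by
        rw [hV]
        refine ⟨fun i hi => ?_, ?_⟩
        · rw [dif_pos hi]; exact (x.1 ⟨i, hi⟩).2
        · have : (fun i : {i : Fin ℓ // k ≤ (i : ℕ)} => if h : (i.1 : ℕ) < k then (x.1 ⟨i.1, h⟩).1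
              else x.2.1 ⟨i.1, not_lt.1 h⟩) = x.2.1 := by
            funext i
            rw [dif_neg (not_lt.2 i.2)]
          rw [this]
          exact x.2.2⟩
      map_add' := fun x y => by
        apply Subtype.ext
        funext i
        by_cases h : (i : ℕ) < k <;> simp [h]
      map_smul' := fun c x => by
        apply Subtype.ext
        funext i
        by_cases h : (i : ℕ) < k <;> simp [h] }
  have hf : Function.Injective f := by
    intro x y hxy
    have h1 : ∀ i, (f x).1 i = (f y).1 i := fun i => by rw [hxy]
    apply Prod.ext
    · funext i
      apply Subtype.ext
      have := h1 i.1
      simpa [f, i.2] using this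
    · apply Subtype.ext
      funext i
      have := h1 i.1
      simpa [f, not_lt.2 i.2] using this
  have hdim := LinearMap.finrank_le_finrank_of_injective hf
  rw [Module.finrank_prod, Module.finrank_pi_fintype] at hdim
  refine le_trans ?_ hdim
  obtain ⟨hC1, hC2⟩ := (hV C).1 hC
  have h3 := hC' _ hC2
  rw [← wsum_tail k hm1 hn1 C] at h3
  have h4 : wsum C = ∑ i ∈ univ.filter (fun i : Fin ℓ => (i : ℕ) < k), m i * (C i).rank +
      ∑ i ∈ univ.filter (fun i : Fin ℓ => k ≤ (i : ℕ)), m i * (C i).rank := by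
    rw [wsum, ← Finset.sum_filter_add_sum_filter_not univ (fun i : Fin ℓ => (i : ℕ) < k)]
    simp only [not_lt]
  rw [h4]
  refine Nat.add_le_add ?_ h3
  rw [Finset.sum_subtype (p := fun i : Fin ℓ => (i : ℕ) < k) _ (by simp)]
  exact Finset.sum_le_sum fun i _ =>
    (isOptRk_iff hnm i.1 (𝒜 i.1)).1 (hA i.1 i.2) _ (hC1 i.1 i.2)

end Assembly

/-- **Classification of optimal anticodes.**  Let `k = 0` if `m 1 = 1` and
`k = max {i ∈ [ℓ] : m i > 1}` otherwise (1-based indexing).  A code `𝒞 ⊆ 𝕄` is an optimal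
anticode if and only if it is a product `𝒞₁ × ⋯ × 𝒞_k × 𝒞′` of optimal rank-metric anticodes
`𝒞_i ⊆ F^(m i × n i)` for `i ∈ [k]` and an optimal Hamming-metric anticode `𝒞′` on the
remaining `ℓ - k` coordinates. -/
theorem optimal_anticode_classification {F : Type*} [Field F] [Fintype F] {ℓ : ℕ}
    (m n : Fin ℓ → ℕ) (hℓ : 0 < ℓ) (hm : ∀ i j : Fin ℓ, i ≤ j → m j ≤ m i)
    (hmpos : ∀ i, 0 < m i) (hnm : ∀ i, n i ≤ m i) (hnpos : ∀ i, 0 < n i)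
    (k : ℕ)
    (hk : (m ⟨0, hℓ⟩ = 1 ∧ k = 0) ∨
      (m ⟨0, hℓ⟩ ≠ 1 ∧ IsGreatest {j : ℕ | ∃ i : Fin ℓ, j = (i : ℕ) + 1 ∧ 1 < m i} k))
    (𝒞 : Submodule F (∀ i : Fin ℓ, Matrix (Fin (m i)) (Fin (n i)) F)) :
    IsOptAnticode 𝒞 ↔
      ∃ (𝒜 : ∀ i : Fin ℓ, Submodule F (Matrix (Fin (m i)) (Fin (n i)) F))
        (𝒞' : Submodule F (∀ i : {i : Fin ℓ // k ≤ (i : ℕ)}, Matrix (Fin (m i)) (Fin (n i)) F)),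
        (∀ i : Fin ℓ, (i : ℕ) < k → IsOptRkAnticode (𝒜 i)) ∧
        IsOptHammingAnticode 𝒞' ∧
        (∀ C : ∀ i : Fin ℓ, Matrix (Fin (m i)) (Fin (n i)) F,
          C ∈ 𝒞 ↔
            (∀ i : Fin ℓ, (i : ℕ) < k → C i ∈ 𝒜 i) ∧
            (fun i : {i : Fin ℓ // k ≤ (i : ℕ)} => C i) ∈ 𝒞') := by
  have hk1 : ∀ i : Fin ℓ, (i : ℕ) < k → 1 < m i := by
    intro i hi
    rcases hk with ⟨_, h⟩ | ⟨_, ⟨j, hj, hmj⟩, _⟩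
    · omega
    · exact lt_of_lt_of_le hmj (hm i j (by rw [Fin.le_def]; omega))
  have hm1 : ∀ i : Fin ℓ, k ≤ (i : ℕ) → m i = 1 := by
    intro i hi
    have hpos := hmpos i
    rcases hk with ⟨h, _⟩ | ⟨_, _, hub⟩
    · have := hm ⟨0, hℓ⟩ i (by rw [Fin.le_def]; exact Nat.zero_le _)
      omega
    · by_contra hne
      have := hub ⟨i, rfl, by omega⟩
      omega
  have hn1 : ∀ i : Fin ℓ, k ≤ (i : ℕ) → n i = 1 := by
    intro i hi
    have h1 := hm1 i hi
    have h2 := hnm i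
    have h3 := hnpos i
    omega
  constructor
  · exact forward hnm k hk1 hm1 hn1 𝒞
  · rintro ⟨𝒜, 𝒞', hA, hC', hV⟩
    exact backward hnm k hm1 hn1 𝒞 𝒜 𝒞' hA hC' hV
end

section
/- Assume that either q ≠ 2 or m_{ℓ−1} ≥ 2, and let 𝒞 ⊆ 𝕄 be an optimal anticode. Then 𝒞 is generated, as an 𝔽_q-vector space, by its elements of maximum sum-rank weight, i.e. 𝒞 = span_{𝔽_q}{C ∈ 𝒞 : srk(C) = maxsrk(𝒞)}. -/
open Matrix Finset

section SumRank

variable {F : Type*} [Field F] [Fintype F] {ℓ : ℕ} {m n : Fin ℓ → ℕ}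

/-- The sum-rank weight of a tuple of matrices. -/
noncomputable def srk (C : ∀ i : Fin ℓ, Matrix (Fin (m i)) (Fin (n i)) F) : ℕ :=
  ∑ i, (C i).rank

/-- The maximum sum-rank weight of a code. -/
noncomputable def maxsrk (𝒞 : Submodule F (∀ i : Fin ℓ, Matrix (Fin (m i)) (Fin (n i)) F)) : ℕ :=
  sSup {w | ∃ C ∈ 𝒞, srk C = w}

end SumRank


theorem li_exchange {F E ι : Type*} [Field F] [AddCommGroup E] [Module F E] [Fintype ι] [DecidableEq ι]
    (f : ι → E) (hf : LinearIndependent F f) (k : ι) (c : E) :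
    LinearIndependent F (Function.update f k c) ∨ LinearIndependent F (Function.update f k (c + f k)) := by
  obtain ⟨φ, hφ⟩ : ∃ φ : E →ₗ[F] F, ∀ i, φ (f i) = if i = k then 1 else 0 := by
    obtain ⟨g, hg⟩ := LinearMap.exists_extend ((Finsupp.lapply k).comp hf.repr : Submodule.span F (Set.range f) →ₗ[F] F)
    refine ⟨g, fun i => ?_⟩
    have := LinearMap.congr_fun hg ⟨f i, Submodule.subset_span ⟨i, rfl⟩⟩
    simp only [LinearMap.comp_apply, Submodule.subtype_apply] at this
    rw [this]
    simp [hf.repr_eq_single i ⟨f i, Submodule.subset_span ⟨i, rfl⟩⟩ rfl, Finsupp.single_apply]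
  have key : ∀ d : E, φ d ≠ 0 → LinearIndependent F (Function.update f k d) := by
    intro d hd
    rw [Fintype.linearIndependent_iff] at hf ⊢
    intro g hg
    have hk : g k = 0 := by
      have := congrArg φ hg
      rw [map_sum, Finset.sum_eq_single k] at this
      · simpa [hd] using this
      · intro i _ hi
        simp [hφ, hi]
      · simp
    apply hf
    rw [← hg]
    refine Finset.sum_congr rfl fun i _ => ?_
    by_cases hi : i = k
    · subst hi; simp [hk]
    · rw [Function.update_of_ne hi]
  by_cases h : φ c = 0
  · right; apply key; simp [h, hφ]
  · left; exact key _ h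

theorem li_echelon {F ι : Type*} [Field F] [Fintype ι] {n : ℕ} (b : ι → Fin n → F) (σ : ι → Fin n)
    (hσ : Function.Injective σ) (h0 : ∀ i, ∀ j < σ i, b i j = 0) (h1 : ∀ i, b i (σ i) ≠ 0) :
    LinearIndependent F b := by
  classical
  rw [Fintype.linearIndependent_iff]
  intro g hg
  by_contra! hne
  obtain ⟨i0, hi0⟩ := hne
  obtain ⟨i, hi, hmin⟩ := Finset.exists_min_image (univ.filter fun i => g i ≠ 0) σ ⟨i0, by simp [hi0]⟩
  have := congrFun hg (σ i)
  rw [Finset.sum_apply, Finset.sum_eq_single i] at this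
  · simp at this hi
    exact this.elim hi (h1 i)
  · intro j _ hj
    by_cases hgj : g j = 0
    · simp [hgj]
    · have := hmin j (by simp [hgj])
      have : σ i < σ j := lt_of_le_of_ne this (fun h => hj (hσ h.symm))
      simp [h0 j _ this]
  · simp

theorem single_block {F : Type*} [Field F] {m n : ℕ} (hnm : n ≤ m)
    (U : Submodule F (Matrix (Fin m) (Fin n) F)) (A : Matrix (Fin m) (Fin n) F) :
    ∃ u ∈ U, Module.finrank F U ≤ m * (A + u).rank := by
  classical
  rcases Nat.eq_zero_or_pos m with hm0 | hmpos
  · subst hm0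
    refine ⟨0, U.zero_mem, ?_⟩
    have := Submodule.finrank_le U
    simpa [Module.finrank_matrix] using this
  let Q : Fin m × Fin n → Matrix (Fin m) (Fin n) F → Prop := fun p u =>
    u ∈ U ∧ (∀ i < p.1, u i = 0) ∧ (∀ j < p.2, u p.1 j = 0) ∧ u p.1 p.2 ≠ 0
  let P : Finset (Fin m × Fin n) := univ.filter fun p => ∃ u, Q p u
  have hP : Module.finrank F U ≤ P.card := by
    let L : U →ₗ[F] (P → F) :=
      { toFun := fun u p => u.1 p.1.1 p.1.2
        map_add' := by intros; rfl
        map_smul' := by intros; rfl }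
    have hL : Function.Injective L := by
      rw [← LinearMap.ker_eq_bot, LinearMap.ker_eq_bot']
      rintro ⟨u, hu⟩ h
      by_contra hne
      have hne' : ∃ i, u i ≠ 0 := by
        by_contra! hh
        exact hne (Subtype.ext (funext hh))
      obtain ⟨i, hi, himin⟩ := WellFounded.has_min (wellFounded_lt (α := Fin m)) {i | u i ≠ 0} hne'
      have hne2 : ∃ j, u i j ≠ 0 := by
        by_contra! hh
        exact hi (funext hh)
      obtain ⟨j, hj, hjmin⟩ := WellFounded.has_min (wellFounded_lt (α := Fin n)) {j | u i j ≠ 0} hne2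
      have hmem : (i, j) ∈ P := by
        simp only [P, Finset.mem_filter, Finset.mem_univ, true_and]
        refine ⟨u, hu, fun i' h' => ?_, fun j' h' => ?_, hj⟩
        · by_contra hc; exact himin i' hc h'
        · by_contra hc; exact hjmin j' hc h'
      exact hj (congrFun h ⟨(i, j), hmem⟩)
    simpa using LinearMap.finrank_le_finrank_of_injective hL
  -- pigeonhole
  obtain ⟨c, hc⟩ : ∃ c : ℕ, P.card ≤ m * (P.filter fun p => (p.1.val + p.2.val) % m = c).card := by
    by_contra! hcon
    have h1 := Finset.card_eq_sum_card_fiberwise (s := P) (t := range m)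
      (f := fun p => (p.1.val + p.2.val) % m) (by
        intro p _; simp [Nat.mod_lt _ hmpos])
    have h2 : m * P.card < m * P.card := by
      calc m * P.card = ∑ c ∈ range m, m * (P.filter fun p => (p.1.val + p.2.val) % m = c).card := by
            rw [← Finset.mul_sum, ← h1]
        _ < ∑ c ∈ range m, P.card := by
            apply Finset.sum_lt_sum_of_nonempty
            · simpa using hmpos.ne'
            · intro c _; exact hcon c
        _ = m * P.card := by simp
    exact lt_irrefl _ h2
  set Pc := P.filter fun p => (p.1.val + p.2.val) % m = c with hPc
  have hmodeq : ∀ p q : Pc, (p.1.1.val + p.1.2.val) ≡ (q.1.1.val + q.1.2.val) [MOD m] := by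
    intro p q
    have h1 := (Finset.mem_filter.1 p.2).2
    have h2 := (Finset.mem_filter.1 q.2).2
    exact h1.trans h2.symm
  have hrow : Function.Injective (fun p : Pc => p.1.1) := by
    intro p q h
    have h3 := hmodeq p q
    have h' : p.1.1 = q.1.1 := h
    rw [h'] at h3
    have := Nat.ModEq.add_left_cancel' _ h3
    have := Nat.ModEq.eq_of_lt_of_lt this (p.1.2.2.trans_le hnm) (q.1.2.2.trans_le hnm)
    exact Subtype.ext (Prod.ext h' (Fin.ext this))
  have hcol : Function.Injective (fun p : Pc => p.1.2) := by
    intro p q h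
    have h3 := hmodeq p q
    have h' : p.1.2 = q.1.2 := h
    rw [h'] at h3
    have := Nat.ModEq.add_right_cancel' _ h3
    have := Nat.ModEq.eq_of_lt_of_lt this p.1.1.2 q.1.1.2
    exact Subtype.ext (Prod.ext (Fin.ext this) h')
  have hex : ∀ p : Pc, ∃ u, Q p.1 u := fun p => by
    have := (Finset.mem_filter.1 p.2).1
    exact (Finset.mem_filter.1 this).2
  choose w hwU hw0 hw1 hw2 using hex
  let b : Pc → Fin n → F := fun p => w p p.1.1
  have hb : LinearIndependent F b := li_echelon b (fun p => p.1.2) hcol hw1 hw2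
  have step : ∀ k : ℕ, ∃ u ∈ U, LinearIndependent F
      (fun p : Pc => if p.1.1.val < k then (A + u) p.1.1 else b p) := by
    intro k
    induction k with
    | zero => exact ⟨0, U.zero_mem, by simpa using hb⟩
    | succ k ih =>
      obtain ⟨u, hu, hli⟩ := ih
      by_cases hk : ∃ p : Pc, p.1.1.val = k
      · obtain ⟨p, hp⟩ := hk
        have hne : ∀ q : Pc, q ≠ p → q.1.1.val ≠ k := by
          intro q hq h
          exact hq (hrow (Fin.ext (h.trans hp.symm)))
        rcases li_exchange _ hli p ((A + u) p.1.1) with h | h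
        · refine ⟨u, hu, ?_⟩
          convert h using 1
          funext q
          by_cases hq : q = p
          · subst hq; simp [hp]
          · rw [Function.update_of_ne hq]
            have := hne q hq
            have : (q.1.1.val < k + 1) ↔ q.1.1.val < k := by omega
            simp only [this]
          rfl
        · refine ⟨u + w p, U.add_mem hu (hwU p), ?_⟩
          convert h using 1
          funext q
          by_cases hq : q = p
          · subst hq
            simp only [hp, Function.update_self, lt_irrefl, if_false, Nat.lt_succ_self, if_true, b]
            rw [← add_assoc]; rfl
          · rw [Function.update_of_ne hq]
            have := hne q hq
            by_cases hlt : q.1.1.val < k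
            · have h' : q.1.1.val < k + 1 := by omega
              simp only [hlt, h', if_true]
              have hz : w p q.1.1 = 0 := hw0 p _ (by rw [Fin.lt_def]; omega)
              rw [← add_assoc]
              change (A + u) q.1.1 + w p q.1.1 = _
              rw [hz, add_zero]
            · have h' : ¬ q.1.1.val < k + 1 := by omega
              simp only [hlt, h', if_false]
          rfl
      · refine ⟨u, hu, ?_⟩
        convert hli using 1
        funext q
        have : q.1.1.val ≠ k := fun h => hk ⟨q, h⟩
        have : (q.1.1.val < k + 1) ↔ q.1.1.val < k := by omega
        simp only [this]
  obtain ⟨u, hu, hli⟩ := step m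
  refine ⟨u, hu, hP.trans (hc.trans (Nat.mul_le_mul_left _ ?_))⟩
  simp only [Fin.is_lt, if_true] at hli
  have h1 := LinearIndependent.rank_matrix (M := (A + u).submatrix (fun p : Pc => p.1.1) id) hli
  have h2 := Matrix.rank_submatrix_le (A + u) (fun p : Pc => p.1.1) id
  rw [h1] at h2
  simpa using h2

section Blocks

variable {F : Type*} [Field F] {ℓ : ℕ} {m n : Fin ℓ → ℕ}

/-- Codewords supported on the blocks with index `< j`. -/
def tailSub (𝒞 : Submodule F (∀ i : Fin ℓ, Matrix (Fin (m i)) (Fin (n i)) F)) (j : ℕ) :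
    Submodule F (∀ i : Fin ℓ, Matrix (Fin (m i)) (Fin (n i)) F) where
  carrier := {C | C ∈ 𝒞 ∧ ∀ i : Fin ℓ, j ≤ i.val → C i = 0}
  add_mem' := by
    rintro a b ⟨ha, ha'⟩ ⟨hb, hb'⟩
    exact ⟨𝒞.add_mem ha hb, fun i hi => by simp [ha' i hi, hb' i hi]⟩
  zero_mem' := ⟨𝒞.zero_mem, fun i _ => rfl⟩
  smul_mem' := by
    rintro c a ⟨ha, ha'⟩
    exact ⟨𝒞.smul_mem c ha, fun i hi => by simp [ha' i hi]⟩

/-- Number of pivots in block `i`. -/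
noncomputable def blockDim (𝒞 : Submodule F (∀ i : Fin ℓ, Matrix (Fin (m i)) (Fin (n i)) F))
    (i : Fin ℓ) : ℕ :=
  Module.finrank F ((tailSub 𝒞 (i.val + 1)).map (LinearMap.proj i))

variable (𝒞 : Submodule F (∀ i : Fin ℓ, Matrix (Fin (m i)) (Fin (n i)) F))

theorem mem_tailSub {j : ℕ} {C : ∀ i : Fin ℓ, Matrix (Fin (m i)) (Fin (n i)) F} :
    C ∈ tailSub 𝒞 j ↔ C ∈ 𝒞 ∧ ∀ i : Fin ℓ, j ≤ i.val → C i = 0 := Iff.rfl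

theorem tailSub_mono {j k : ℕ} (h : j ≤ k) : tailSub 𝒞 j ≤ tailSub 𝒞 k :=
  fun _ hC => ⟨hC.1, fun i hi => hC.2 i (h.trans hi)⟩

theorem tailSub_top : tailSub 𝒞 ℓ = 𝒞 := by
  ext C
  exact ⟨fun h => h.1, fun h => ⟨h, fun i hi => absurd i.2 (by omega)⟩⟩

theorem mem_tailSub_of_succ {j : Fin ℓ} {C : ∀ i : Fin ℓ, Matrix (Fin (m i)) (Fin (n i)) F}
    (hC : C ∈ tailSub 𝒞 (j.val + 1)) (h0 : C j = 0) : C ∈ tailSub 𝒞 j.val := by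
  refine ⟨hC.1, fun i hi => ?_⟩
  by_cases h : i = j
  · subst h; exact h0
  · exact hC.2 i (by
      have : i.val ≠ j.val := fun hh => h (Fin.ext hh)
      omega)

/-- rank-nullity on a submodule -/
theorem finrank_map_add {E E' : Type*} [AddCommGroup E] [Module F E] [AddCommGroup E'] [Module F E']
    [FiniteDimensional F E] (f : E →ₗ[F] E') (W : Submodule F E) :
    Module.finrank F W = Module.finrank F (W.map f) + Module.finrank F (W ⊓ LinearMap.ker f : Submodule F E) := by
  have h := LinearMap.finrank_range_add_finrank_ker (f.domRestrict W)
  rw [LinearMap.range_domRestrict, LinearMap.ker_domRestrict] at h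
  rw [← h]
  congr 1
  have e := Submodule.finrank_map_subtype_eq W ((LinearMap.ker f).comap W.subtype)
  rw [Submodule.map_comap_subtype] at e
  exact e.symm

theorem tailSub_inf_ker (i : Fin ℓ) :
    tailSub 𝒞 (i.val + 1) ⊓ LinearMap.ker (LinearMap.proj i) = tailSub 𝒞 i.val := by
  apply le_antisymm
  · rintro C ⟨hC, hC0⟩
    exact mem_tailSub_of_succ 𝒞 hC (by simpa using hC0)
  · intro C hC
    exact ⟨tailSub_mono 𝒞 (Nat.le_succ _) hC, by simpa using hC.2 i le_rfl⟩

theorem finrank_tailSub (j : ℕ) (hj : j ≤ ℓ) :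
    Module.finrank F (tailSub 𝒞 j) = ∑ i : Fin ℓ with i.val < j, blockDim 𝒞 i := by
  induction j with
  | zero =>
    have : tailSub 𝒞 0 = ⊥ := by
      rw [eq_bot_iff]
      intro C hC
      exact funext fun i => hC.2 i (Nat.zero_le _)
    simp [this]
  | succ j ih =>
    have h := finrank_map_add (LinearMap.proj (⟨j, hj⟩ : Fin ℓ)) (tailSub 𝒞 (j + 1))
    have h2 := tailSub_inf_ker 𝒞 (⟨j, hj⟩ : Fin ℓ)
    simp only at h2
    rw [h, h2, ih (by omega)]
    have : (univ.filter fun i : Fin ℓ => i.val < j + 1) =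
        insert ⟨j, hj⟩ (univ.filter fun i : Fin ℓ => i.val < j) := by
      ext i
      simp only [mem_filter, mem_univ, true_and, mem_insert, Fin.ext_iff]
      omega
    rw [this, Finset.sum_insert (by simp)]
    rfl

theorem extend_tail (hnm : ∀ i, n i ≤ m i) (j : ℕ) (hj : j ≤ ℓ)
    (A : ∀ i : Fin ℓ, Matrix (Fin (m i)) (Fin (n i)) F) :
    ∃ v ∈ tailSub 𝒞 j, ∀ i : Fin ℓ, i.val < j → blockDim 𝒞 i ≤ m i * ((A + v) i).rank := by
  induction j generalizing A with
  | zero => exact ⟨0, Submodule.zero_mem _, fun i hi => absurd hi (by omega)⟩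
  | succ j ih =>
    obtain ⟨u, hu, hr⟩ := single_block (hnm ⟨j, hj⟩)
      ((tailSub 𝒞 (j + 1)).map (LinearMap.proj (⟨j, hj⟩ : Fin ℓ))) (A ⟨j, hj⟩)
    obtain ⟨v, hv, rfl⟩ := hu
    obtain ⟨v', hv', hr'⟩ := ih (by omega) (A + v)
    refine ⟨v + v', Submodule.add_mem _ hv (tailSub_mono 𝒞 (Nat.le_succ _) hv'), fun i hi => ?_⟩
    rw [← add_assoc]
    by_cases h : i.val < j
    · exact hr' i h
    · have : i = ⟨j, hj⟩ := Fin.ext (by simp; omega)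
      subst this
      have : (A + v + v') ⟨j, hj⟩ = A ⟨j, hj⟩ + v ⟨j, hj⟩ := by
        have := hv'.2 ⟨j, hj⟩ le_rfl
        simp [this]
      rw [this]
      exact hr

end Blocks

/-- Abel summation: dominance of weighted suffix sums gives dominance of suffix sums. -/
theorem abel_aux {ℓ : ℕ} (m : Fin ℓ → ℕ) (hm : ∀ i j : Fin ℓ, i ≤ j → m j ≤ m i)
    (hmpos : ∀ i, 0 < m i) (a : Fin ℓ → ℤ)
    (h : ∀ j : ℕ, 0 ≤ ∑ i : Fin ℓ with j ≤ i.val, (m i : ℤ) * a i) :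
    0 ≤ ∑ i, a i := by
  have key : ∀ k : ℕ, ∀ j : Fin ℓ, j.val + k + 1 = ℓ →
      ∑ i : Fin ℓ with j.val ≤ i.val, (m i : ℤ) * a i ≤
        m j * ∑ i : Fin ℓ with j.val ≤ i.val, a i := by
    intro k
    have hsplit : ∀ (j : Fin ℓ) (f : Fin ℓ → ℤ), ∑ i : Fin ℓ with j.val ≤ i.val, f i
        = f j + ∑ i : Fin ℓ with j.val + 1 ≤ i.val, f i := by
      intro j f
      have : (univ.filter fun i : Fin ℓ => j.val ≤ i.val) =
          insert j (univ.filter fun i : Fin ℓ => j.val + 1 ≤ i.val) := by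
        ext i
        simp only [mem_filter, mem_univ, true_and, mem_insert, Fin.ext_iff]
        omega
      rw [this, Finset.sum_insert (by simp)]
    induction k with
    | zero =>
      intro j hj
      have he : (univ.filter fun i : Fin ℓ => j.val + 1 ≤ i.val) = ∅ := by
        ext i
        have := i.2
        simp; omega
      rw [hsplit j, hsplit j, he]
      simp
    | succ k ih =>
      intro j hj
      have hlt : j.val + 1 < ℓ := by omega
      have h1 := ih ⟨j.val + 1, hlt⟩ (by simp; omega)
      have h2 := h (j.val + 1)
      have h3 : m ⟨j.val + 1, hlt⟩ ≤ m j := hm _ _ (by rw [Fin.le_def]; simp)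
      have h4 := hmpos ⟨j.val + 1, hlt⟩
      simp only at h1
      rw [hsplit j, hsplit j]
      set S := ∑ i : Fin ℓ with j.val + 1 ≤ i.val, a i
      have hS : 0 ≤ S := by
        by_contra hneg
        push Not at hneg
        have h4' : (0 : ℤ) < m ⟨j.val + 1, hlt⟩ := by exact_mod_cast h4
        nlinarith
      have h3' : (m ⟨j.val + 1, hlt⟩ : ℤ) ≤ m j := by exact_mod_cast h3
      nlinarith
  rcases Nat.eq_zero_or_pos ℓ with h0 | hpos
  · subst h0; simp
  · have h1 := key (ℓ - 1) ⟨0, hpos⟩ (by simp; omega)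
    have h2 := h 0
    simp only [Nat.zero_le, Finset.filter_true] at h1 h2
    have h4 : (0 : ℤ) < m ⟨0, hpos⟩ := by exact_mod_cast hmpos _
    by_contra hneg
    push Not at hneg
    nlinarith

theorem rank_le_m {F : Type*} [Field F] {m n : ℕ} (A : Matrix (Fin m) (Fin n) F) : A.rank ≤ m := by
  simpa using A.rank_le_card_height

theorem rank_pos_of_ne {F : Type*} [Field F] {m n : ℕ} (A : Matrix (Fin m) (Fin n) F) (h : A ≠ 0) :
    1 ≤ A.rank := by
  by_contra hc
  apply h
  have h0 : Module.finrank F (LinearMap.range A.mulVecLin) = 0 := by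
    have : A.rank = 0 := by omega
    exact this
  rw [Submodule.finrank_eq_zero, LinearMap.range_eq_bot] at h0
  ext i j
  have h1 := congrFun (LinearMap.congr_fun h0 (Pi.single j 1)) i
  simpa using h1

/-- The heart: a functional nonzero on the code is nonzero on a codeword with all pivot ranks. -/
theorem exists_full {F : Type*} [Field F] [Fintype F] {ℓ : ℕ}
    (m n : Fin ℓ → ℕ) (hm : ∀ i j : Fin ℓ, i ≤ j → m j ≤ m i)
    (hmpos : ∀ i, 0 < m i) (hnm : ∀ i, n i ≤ m i) 
    (hq : Fintype.card F ≠ 2 ∨ ∀ i : Fin ℓ, i.val + 1 < ℓ → 2 ≤ m i)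
    (𝒞 : Submodule F (∀ i : Fin ℓ, Matrix (Fin (m i)) (Fin (n i)) F))
    (E : ∀ i : Fin ℓ, Matrix (Fin (m i)) (Fin (n i)) F) (hE : E ∈ 𝒞)
    (hEd : ∀ i, blockDim 𝒞 i = m i * (E i).rank)
    (φ : (∀ i : Fin ℓ, Matrix (Fin (m i)) (Fin (n i)) F) →ₗ[F] F)
    (C0 : ∀ i : Fin ℓ, Matrix (Fin (m i)) (Fin (n i)) F) (hC0 : C0 ∈ 𝒞) (hφ : φ C0 ≠ 0) :
    ∃ C ∈ 𝒞, φ C ≠ 0 ∧ ∀ i, (E i).rank ≤ (C i).rank := by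
  classical
  have hex : ∃ j : ℕ, ∃ B ∈ tailSub 𝒞 j, φ B ≠ 0 := ⟨ℓ, C0, by rwa [tailSub_top], hφ⟩
  obtain ⟨B, hB, hφB⟩ := Nat.find_spec hex
  have hmin : ∀ k, k < Nat.find hex → ∀ B ∈ tailSub 𝒞 k, φ B = 0 := by
    intro k hk B hB
    by_contra hc
    exact Nat.find_min hex hk ⟨B, hB, hc⟩
  have hle : Nat.find hex ≤ ℓ := Nat.find_min' hex ⟨C0, by rwa [tailSub_top], hφ⟩
  have hpos : Nat.find hex ≠ 0 := by
    intro h0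
    rw [h0] at hB
    apply hφB
    have : B = 0 := funext fun i => hB.2 i (Nat.zero_le _)
    rw [this, map_zero]
  obtain ⟨j', hj'⟩ := Nat.exists_eq_succ_of_ne_zero hpos
  rw [hj'] at hB hmin hle
  obtain ⟨j, rfl⟩ : ∃ j : Fin ℓ, j' = j.val := ⟨⟨j', hle⟩, rfl⟩
  clear hj' hpos
  have hker : ∀ v ∈ tailSub 𝒞 j.val, φ v = 0 := hmin j.val (Nat.lt_succ_self _)
  have hB' : B ∈ tailSub 𝒞 (j.val + 1) := hB
  -- it suffices to find a codeword good on the blocks from `j` on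
  suffices hs : ∃ A ∈ 𝒞, φ A ≠ 0 ∧ ∀ i : Fin ℓ, j.val ≤ i.val → (E i).rank ≤ (A i).rank by
    obtain ⟨A, hA, hφA, hAr⟩ := hs
    obtain ⟨v, hv, hvr⟩ := extend_tail 𝒞 hnm j.val j.2.le A
    refine ⟨A + v, 𝒞.add_mem hA hv.1, by rwa [map_add, hker v hv, add_zero], fun i => ?_⟩
    by_cases hi : i.val < j.val
    · have := hvr i hi
      rw [hEd] at this
      exact Nat.le_of_mul_le_mul_left this (hmpos i)
    · have h0 := hv.2 i (by omega)
      have : (A + v) i = A i := by simp [h0]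
      rw [this]
      exact hAr i (by omega)
  have htail : ∀ v ∈ tailSub 𝒞 (j.val + 1), (E j).rank ≤ ((E + v) j).rank →
      ∀ i : Fin ℓ, j.val ≤ i.val → (E i).rank ≤ ((E + v) i).rank := by
    intro v hv hr i hi
    by_cases h : i = j
    · subst h; exact hr
    · have h0 := hv.2 i (by
        have : i.val ≠ j.val := fun hh => h (Fin.ext hh)
        omega)
      have : (E + v) i = E i := by simp [h0]
      rw [this]
  have hBj : B j ≠ 0 := fun h0 => hφB (hker B (mem_tailSub_of_succ 𝒞 hB' h0))
  by_cases hmj : 2 ≤ m j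
  · set K := tailSub 𝒞 (j.val + 1) ⊓ LinearMap.ker φ with hK
    have hKd : blockDim 𝒞 j ≤ Module.finrank F (K.map (LinearMap.proj j)) + 1 := by
      have h1 := finrank_map_add φ (tailSub 𝒞 (j.val + 1))
      have h2 := finrank_map_add (LinearMap.proj j) (tailSub 𝒞 (j.val + 1))
      have h3 := finrank_map_add (LinearMap.proj j) K
      rw [tailSub_inf_ker] at h2
      have h4 : K ⊓ LinearMap.ker (LinearMap.proj j) ≤ tailSub 𝒞 j.val := by
        rw [← tailSub_inf_ker]
        exact inf_le_inf_right _ inf_le_left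
      have h5 := Submodule.finrank_mono h4
      have h6 : Module.finrank F ((tailSub 𝒞 (j.val + 1)).map φ) ≤ 1 := by
        simpa using Submodule.finrank_le ((tailSub 𝒞 (j.val + 1)).map φ)
      unfold blockDim
      rw [← hK] at h1
      omega
    set A := E + ((1 - φ E) * (φ B)⁻¹) • B with hA
    have hφA : φ A = 1 := by
      rw [hA, map_add, map_smul, smul_eq_mul, mul_assoc, inv_mul_cancel₀ hφB]
      ring
    obtain ⟨u, hu, hr⟩ := single_block (hnm j) (K.map (LinearMap.proj j)) (A j)
    obtain ⟨v, hv, rfl⟩ := hu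
    have hmem : ((1 - φ E) * (φ B)⁻¹) • B + v ∈ tailSub 𝒞 (j.val + 1) :=
      Submodule.add_mem _ (Submodule.smul_mem _ _ hB') hv.1
    have heq : A + v = E + (((1 - φ E) * (φ B)⁻¹) • B + v) := by rw [hA, add_assoc]
    refine ⟨A + v, ?_, ?_, ?_⟩
    · rw [heq]; exact 𝒞.add_mem hE hmem.1
    · have : φ v = 0 := hv.2
      rw [map_add, hφA, this]; simp
    · rw [heq]
      apply htail _ hmem
      rw [← heq]
      have hr' : Module.finrank F (K.map (LinearMap.proj j)) ≤ m j * ((A + v) j).rank := hr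
      rw [hEd] at hKd
      by_contra hlt
      push Not at hlt
      have : m j * (((A + v) j).rank + 1) ≤ m j * (E j).rank := Nat.mul_le_mul_left _ hlt
      rw [Nat.mul_add] at this
      omega
  · have hm1 : m j = 1 := by have := hmpos j; omega
    have hE1 : (E j).rank ≤ 1 := by rw [← hm1]; exact rank_le_m _
    rcases hq with hq | hq
    · -- at least three scalars
      obtain ⟨a, b, hab⟩ : ∃ a b, B j a b ≠ 0 := by
        by_contra! hh
        exact hBj (Matrix.ext hh)
      obtain ⟨μ, hμ⟩ : ∃ μ : F, μ ∉ ({-(φ E) * (φ B)⁻¹, -(E j a b) * (B j a b)⁻¹} : Finset F) := by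
        by_contra! hh
        have h1 : Fintype.card F ≤ 2 := by
          rw [← Finset.card_univ]
          exact (Finset.card_le_card (fun x _ => hh x)).trans Finset.card_le_two
        have h2 := Fintype.one_lt_card (α := F)
        omega
      simp only [Finset.mem_insert, Finset.mem_singleton, not_or] at hμ
      have hmem := Submodule.smul_mem (tailSub 𝒞 (j.val + 1)) μ hB'
      refine ⟨E + μ • B, 𝒞.add_mem hE hmem.1, ?_, htail _ hmem (hE1.trans (rank_pos_of_ne _ ?_))⟩
      · intro h
        apply hμ.1
        rw [map_add, map_smul, smul_eq_mul] at h
        rw [eq_mul_inv_iff_mul_eq₀ hφB]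
        linear_combination h
      · intro h
        apply hμ.2
        have h' : E j a b + μ * B j a b = 0 := congrFun (congrFun h a) b
        rw [eq_mul_inv_iff_mul_eq₀ hab]
        linear_combination h'
    · have hlast : ¬ (j.val + 1 < ℓ) := fun h => hmj (hq j h)
      refine ⟨B, hB'.1, hφB, fun i hi => ?_⟩
      have : i = j := Fin.ext (by have := i.2; omega)
      subst this
      exact hE1.trans (rank_pos_of_ne _ hBj)

/-- Assume that either `q ≠ 2` or `m_{ℓ-1} ≥ 2` (1-based indexing), and let `𝒞 ⊆ 𝕄` be an
optimal anticode.  Then `𝒞` is generated, as an `𝔽_q`-vector space, by its elements of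
maximum sum-rank weight. -/
theorem optimal_anticode_generated_by_max_weight {F : Type*} [Field F] [Fintype F] {ℓ : ℕ}
    (m n : Fin ℓ → ℕ) (hℓ : 0 < ℓ) (hm : ∀ i j : Fin ℓ, i ≤ j → m j ≤ m i)
    (hmpos : ∀ i, 0 < m i) (hnm : ∀ i, n i ≤ m i) (hnpos : ∀ i, 0 < n i)
    (hq : Fintype.card F ≠ 2 ∨ 2 ≤ m ⟨ℓ - 2, by omega⟩)
    (𝒞 : Submodule F (∀ i : Fin ℓ, Matrix (Fin (m i)) (Fin (n i)) F))
    (h𝒞 : IsOptAnticode 𝒞) :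
    𝒞 = Submodule.span F {C | C ∈ 𝒞 ∧ srk C = maxsrk 𝒞} := by
  have hq' : Fintype.card F ≠ 2 ∨ ∀ i : Fin ℓ, i.val + 1 < ℓ → 2 ≤ m i := by
    rcases hq with h | h
    · exact Or.inl h
    · exact Or.inr fun i hi => h.trans (hm _ _ (by rw [Fin.le_def]; simp; omega))
  have hbdw : BddAbove {w | ∃ C ∈ 𝒞, w = wsum C} := by
    refine ⟨∑ i, m i * m i, ?_⟩
    rintro w ⟨C, -, rfl⟩
    exact Finset.sum_le_sum fun i _ => Nat.mul_le_mul_left _ (rank_le_m _)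
  have hbds : BddAbove {w | ∃ C ∈ 𝒞, srk C = w} := by
    refine ⟨∑ i, m i, ?_⟩
    rintro w ⟨C, -, rfl⟩
    exact Finset.sum_le_sum fun i _ => rank_le_m _
  have hopt : ∀ C ∈ 𝒞, wsum C ≤ ∑ i, blockDim 𝒞 i := by
    intro C hC
    have h1 := finrank_tailSub 𝒞 ℓ le_rfl
    rw [tailSub_top] at h1
    simp only [Fin.is_lt, Finset.filter_true] at h1
    rw [← h1, h𝒞]
    exact le_csSup hbdw ⟨C, hC, rfl⟩
  obtain ⟨E, hE0, hEr⟩ := extend_tail 𝒞 hnm ℓ le_rfl 0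
  have hE : E ∈ 𝒞 := hE0.1
  simp only [zero_add, Fin.is_lt, forall_const] at hEr
  have hEd : ∀ i, blockDim 𝒞 i = m i * (E i).rank := by
    have h1 := le_antisymm (Finset.sum_le_sum fun i (_ : i ∈ univ) => hEr i) (hopt E hE)
    have h2 := (Finset.sum_eq_sum_iff_of_le fun i (_ : i ∈ univ) => hEr i).1 h1
    exact fun i => h2 i (Finset.mem_univ i)
  -- every codeword has sum-rank at most that of `E`
  have hmax : ∀ A ∈ 𝒞, srk A ≤ srk E := by
    intro A hA
    have := abel_aux m hm hmpos (fun i => ((E i).rank : ℤ) - (A i).rank) (by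
      intro j
      by_cases hj : j ≤ ℓ
      · obtain ⟨v, hv, hvr⟩ := extend_tail 𝒞 hnm j hj A
        have h1 := hopt (A + v) (𝒞.add_mem hA hv.1)
        unfold wsum at h1
        rw [← Finset.sum_filter_add_sum_filter_not univ (fun i : Fin ℓ => j ≤ i.val),
          ← Finset.sum_filter_add_sum_filter_not univ (fun i : Fin ℓ => j ≤ i.val)
            (fun i => blockDim 𝒞 i)] at h1
        have h2 : ∑ i : Fin ℓ with ¬ j ≤ i.val, blockDim 𝒞 i ≤
            ∑ i : Fin ℓ with ¬ j ≤ i.val, m i * ((A + v) i).rank := by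
          refine Finset.sum_le_sum fun i hi => hvr i ?_
          have := (Finset.mem_filter.1 hi).2
          omega
        have h3 : ∑ i : Fin ℓ with j ≤ i.val, m i * ((A + v) i).rank =
            ∑ i : Fin ℓ with j ≤ i.val, m i * (A i).rank := by
          refine Finset.sum_congr rfl fun i hi => ?_
          have h0 := hv.2 i (Finset.mem_filter.1 hi).2
          have : (A + v) i = A i := by simp [h0]
          rw [this]
        have h4 : ∑ i : Fin ℓ with j ≤ i.val, m i * (A i).rank ≤
            ∑ i : Fin ℓ with j ≤ i.val, m i * (E i).rank := by
          have h5 : ∑ i : Fin ℓ with j ≤ i.val, blockDim 𝒞 i =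
            ∑ i : Fin ℓ with j ≤ i.val, m i * (E i).rank :=
            Finset.sum_congr rfl fun i _ => hEd i
          omega
        simp only [mul_sub, Finset.sum_sub_distrib]
        have h6 : ((∑ i : Fin ℓ with j ≤ i.val, m i * (A i).rank : ℕ) : ℤ) ≤
            (∑ i : Fin ℓ with j ≤ i.val, m i * (E i).rank : ℕ) := by exact_mod_cast h4
        push_cast at h6
        linarith
      · rw [Finset.sum_eq_zero]
        intro i hi
        have := (Finset.mem_filter.1 hi).2
        have := i.2
        omega)
    rw [Finset.sum_sub_distrib] at this
    unfold srk
    have h' : ((∑ i, (A i).rank : ℕ) : ℤ) ≤ (∑ i, (E i).rank : ℕ) := by push_cast; linarith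
    exact_mod_cast h'
  have hfull : ∀ C ∈ 𝒞, (∀ i, (E i).rank ≤ (C i).rank) → srk C = maxsrk 𝒞 := by
    intro C hC hr
    apply le_antisymm
    · exact le_csSup hbds ⟨C, hC, rfl⟩
    · refine csSup_le ⟨_, E, hE, rfl⟩ ?_
      rintro w ⟨A, hA, rfl⟩
      exact (hmax A hA).trans (Finset.sum_le_sum fun i _ => hr i)
  apply le_antisymm
  · intro C0 hC0
    by_contra hnot
    obtain ⟨φ, hφ, hle⟩ := Submodule.exists_le_ker_of_notMem hnot
    obtain ⟨C, hC, hφC, hr⟩ := exists_full m n hm hmpos hnm hq' 𝒞 E hE hEd φ C0 hC0 hφ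
    exact hφC (hle (Submodule.subset_span ⟨hC, hfull C hC hr⟩))
  · rw [Submodule.span_le]
    exact fun C hC => hC.1
end

section
/- Assume that either q ≠ 2 or m_{ℓ−2} ≥ 2. Then a code 𝒜 ⊆ 𝕄 is an optimal anticode if and only if its trace-dual 𝒜^⊥ ⊆ 𝕄 is an optimal anticode. -/
open Matrix Finset

section SumRank

variable {F : Type*} [Field F] [Fintype F] {ℓ : ℕ} {m n : Fin ℓ → ℕ}

/-- The trace-dual of a sum-rank metric code. -/
def dualCode (𝒞 : Submodule F (∀ i : Fin ℓ, Matrix (Fin (m i)) (Fin (n i)) F)) :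
    Submodule F (∀ i : Fin ℓ, Matrix (Fin (m i)) (Fin (n i)) F) where
  carrier := {D | ∀ C ∈ 𝒞, ∑ i, Matrix.trace (D i * (C i)ᵀ) = 0}
  add_mem' := by
    intro a b ha hb C hC
    have h1 := ha C hC
    have h2 := hb C hC
    simp only [Pi.add_apply, Matrix.add_mul, Matrix.trace_add, Finset.sum_add_distrib,
      Set.mem_setOf_eq] at *
    rw [h1, h2, add_zero]
  zero_mem' := by
    intro C hC
    simp
  smul_mem' := by
    intro r a ha C hC
    have h1 := ha C hC
    simp only [Pi.smul_apply, Matrix.smul_mul, Matrix.trace_smul, ← Finset.smul_sum,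
      Set.mem_setOf_eq] at *
    rw [h1, smul_zero]

end SumRank


section Core
variable {F : Type*} [Field F]

lemma indep_update_aux {κ E : Type*} [DecidableEq κ] [AddCommGroup E] [Module F E]
    (g : κ → E) (hg : LinearIndependent F g) (j : κ) (w : E) :
    ∃ bad : F, ∀ t, t ≠ bad → LinearIndependent F (Function.update g j (w + t • g j)) := by
  have key : ∀ x : E, x ∉ Submodule.span F (g '' {j}ᶜ) →
      LinearIndependent F (Function.update g j x) := by
    intro x hx
    rw [← linearIndepOn_univ_iff]
    have : (Set.univ : Set κ) = insert j {j}ᶜ := by ext k; simp [em]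
    rw [this, linearIndepOn_insert (by simp)]
    have himg : Function.update g j x '' {j}ᶜ = g '' {j}ᶜ := by
      apply Set.image_congr
      intro k hk
      exact Function.update_of_ne hk _ _
    refine ⟨?_, ?_⟩
    · refine (LinearIndepOn.congr (v := g) ?_ ?_)
      · exact (linearIndepOn_univ_iff.2 hg).mono (Set.subset_univ _)
      · intro k hk
        exact (Function.update_of_ne hk _ _).symm
    · rw [himg]; simpa using hx
  have hj : g j ∉ Submodule.span F (g '' {j}ᶜ) := hg.notMem_span_image (by simp)
  by_cases h : ∃ b : F, w + b • g j ∈ Submodule.span F (g '' {j}ᶜ)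
  · obtain ⟨b, hb⟩ := h
    refine ⟨b, fun t ht => key _ fun h' => hj ?_⟩
    have := Submodule.sub_mem _ h' hb
    rw [add_sub_add_left_eq_sub, ← sub_smul] at this
    exact (Submodule.smul_mem_iff _ (sub_ne_zero.2 ht)).1 this
  · push Not at h
    exact ⟨0, fun t _ => key _ (h t)⟩

/-- counting: large sizes at distinct positions -/
lemma exists_inj_of_count {m ρ : ℕ} (d : Fin m → ℕ)
    (hcount : ∀ i, i ≤ ρ → ρ + 1 ≤ (univ.filter fun a => i + 1 ≤ d a).card + i) :
    ∃ e : Fin (ρ + 1) → Fin m, Function.Injective e ∧ ∀ j, j.val + 1 ≤ d (e j) := by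
  classical
  have hall := (Finset.all_card_le_biUnion_card_iff_exists_injective
    (fun j : Fin (ρ + 1) => univ.filter fun a : Fin m => j.val + 1 ≤ d a)).1 (by
      intro s
      rcases s.eq_empty_or_nonempty with rfl | hs
      · simp
      · have hmin := s.min'_mem hs
        set j := s.min' hs
        have h1 : (univ.filter fun a : Fin m => j.val + 1 ≤ d a).card ≤
            (s.biUnion (fun j : Fin (ρ + 1) => univ.filter fun a : Fin m => j.val + 1 ≤ d a)).card :=
          Finset.card_le_card (Finset.subset_biUnion_of_mem
            (fun j : Fin (ρ + 1) => univ.filter fun a : Fin m => j.val + 1 ≤ d a) hmin)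
        have h2 : s.card ≤ (Finset.Ici j).card :=
          Finset.card_le_card (fun x hx => Finset.mem_Ici.2 (s.min'_le _ hx))
        rw [Fin.card_Ici] at h2
        have := hcount j.val (by omega)
        omega)
  obtain ⟨e, he, h⟩ := hall
  exact ⟨e, he, fun j => by simpa using h j⟩

lemma exists_inj_large {m n ρ : ℕ} (hnm : n ≤ m) (d : Fin m → ℕ) (hd : ∀ a, d a ≤ n)
    (hsum : m * ρ < ∑ a, d a) :
    ∃ e : Fin (ρ + 1) → Fin m, Function.Injective e ∧ ∀ j, j.val + 1 ≤ d (e j) := by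
  classical
  have hcount : ∀ i, i ≤ ρ → ρ + 1 ≤ (univ.filter fun a => i + 1 ≤ d a).card + i := by
    intro i hi
    by_contra hlt
    push Not at hlt
    set T := univ.filter fun a => i + 1 ≤ d a with hT
    have hTm : T.card ≤ m := by simpa using T.card_le_univ
    have h1 : ∑ a, d a ≤ T.card * n + (m - T.card) * i := by
      rw [← Finset.sum_add_sum_compl T]
      apply Nat.add_le_add
      · simpa using Finset.sum_le_card_nsmul T d n (fun a _ => hd a)
      · have := Finset.sum_le_card_nsmul Tᶜ d i (fun a ha => by
          simp [hT] at ha; omega)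
        simpa [Finset.card_compl] using this
    have h2 : T.card + i ≤ ρ := by omega
    obtain ⟨k, hk⟩ : ∃ k, m = T.card + k := ⟨m - T.card, by omega⟩
    have h3 : m - T.card = k := by omega
    rw [h3] at h1
    have h4 : T.card * n ≤ T.card * m := Nat.mul_le_mul_left _ hnm
    have h5 : m * (T.card + i) ≤ m * ρ := Nat.mul_le_mul_left _ h2
    have h6 : k * i ≤ m * i := Nat.mul_le_mul_right _ (by omega)
    nlinarith
  exact exists_inj_of_count d hcount

lemma exists_indep_transversal {E : Type*} [AddCommGroup E] [Module F E] [FiniteDimensional F E]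
    (k : ℕ) (U : Fin k → Submodule F E) (hU : ∀ j, j.val + 1 ≤ Module.finrank F (U j)) :
    ∃ f : Fin k → E, (∀ j, f j ∈ U j) ∧ LinearIndependent F f := by
  induction k with
  | zero => exact ⟨fun j => j.elim0, fun j => j.elim0, linearIndependent_empty_type⟩
  | succ k ih =>
    obtain ⟨f, hf, hi⟩ := ih (fun j => U j.castSucc) (fun j => hU j.castSucc)
    have : ∃ x ∈ U (Fin.last k), x ∉ Submodule.span F (Set.range f) := by
      by_contra hcon
      push Not at hcon
      have h1 := Submodule.finrank_mono (R := F) (show U (Fin.last k) ≤ _ from hcon)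
      have h2 := finrank_range_le_card (R := F) f
      have h3 := hU (Fin.last k)
      simp only [Set.finrank, Fintype.card_fin, Fin.val_last] at *
      omega
    obtain ⟨x, hx, hxs⟩ := this
    refine ⟨Fin.snoc f x, ?_, linearIndependent_finSnoc.2 ⟨hi, hxs⟩⟩
    intro j
    refine Fin.lastCases ?_ ?_ j
    · simpa using hx
    · intro i; simpa using hf i

/-- matrices with the first `a` rows zero -/
def zeroRows (F : Type*) [Field F] (m n a : ℕ) : Submodule F (Matrix (Fin m) (Fin n) F) where
  carrier := {M | ∀ i : Fin m, i.val < a → M i = 0}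
  add_mem' := by
    intro x y hx hy i hi
    have h1 := hx i hi
    have h2 := hy i hi
    ext j
    simp [Matrix.add_apply, h1, h2]
  zero_mem' := by intro i _; rfl
  smul_mem' := by
    intro c x hx i hi
    have h1 := hx i hi
    ext j
    simp [Matrix.smul_apply, h1]

def rowLin (F : Type*) [Field F] (m n : ℕ) (a : Fin m) :
    Matrix (Fin m) (Fin n) F →ₗ[F] (Fin n → F) where
  toFun M := M a
  map_add' _ _ := rfl
  map_smul' _ _ := rfl

lemma finrank_le_map_add {E E' : Type*} [AddCommGroup E] [Module F E] [FiniteDimensional F E]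
    [AddCommGroup E'] [Module F E'] (φ : E →ₗ[F] E') (V : Submodule F E) :
    Module.finrank F V = Module.finrank F (V.map φ) +
      Module.finrank F (V ⊓ LinearMap.ker φ : Submodule F E) := by
  have h := LinearMap.finrank_range_add_finrank_ker (φ.domRestrict V)
  rw [← h, LinearMap.range_domRestrict, LinearMap.ker_domRestrict]
  congr 1
  rw [← Submodule.finrank_map_subtype_eq V, Submodule.map_comap_subtype]

lemma finrank_le_sum_rows {m n : ℕ} (V : Submodule F (Matrix (Fin m) (Fin n) F)) :
    Module.finrank F V ≤
      ∑ a : Fin m, Module.finrank F ((V ⊓ zeroRows F m n a.val).map (rowLin F m n a)) := by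
  have key : ∀ k, k ≤ m → Module.finrank F V ≤
      ∑ a ∈ univ.filter (fun a : Fin m => a.val < k),
        Module.finrank F ((V ⊓ zeroRows F m n a.val).map (rowLin F m n a)) +
      Module.finrank F (V ⊓ zeroRows F m n k : Submodule F _) := by
    intro k
    induction k with
    | zero =>
      intro _
      have : zeroRows F m n 0 = ⊤ := by
        rw [eq_top_iff]; intro x _ i hi; omega
      rw [this, inf_top_eq]; omega
    | succ k ih =>
      intro hk
      have h1 := ih (by omega)
      have h2 : univ.filter (fun a : Fin m => a.val < k + 1) =
          insert ⟨k, hk⟩ (univ.filter (fun a : Fin m => a.val < k)) := by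
        ext a; simp [Fin.ext_iff]; omega
      rw [h2, Finset.sum_insert (by simp)]
      have h3 := finrank_le_map_add (rowLin F m n ⟨k, hk⟩) (V ⊓ zeroRows F m n k)
      have h4 : V ⊓ zeroRows F m n k ⊓ LinearMap.ker (rowLin F m n ⟨k, hk⟩) ≤
          V ⊓ zeroRows F m n (k + 1) := by
        rintro x ⟨⟨hx1, hx2⟩, hx3⟩
        refine ⟨hx1, fun i hi => ?_⟩
        by_cases hik : i.val < k
        · exact hx2 i hik
        · have : i = ⟨k, hk⟩ := Fin.ext (by simp; omega)
          rw [this]; exact hx3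
      have h5 := Submodule.finrank_mono (R := F) h4
      simp only at *
      omega
  have h := key m le_rfl
  have h0 : zeroRows F m n m = ⊥ := by
    rw [eq_bot_iff]; intro x hx
    rw [Submodule.mem_bot]
    ext i j
    rw [hx i i.2]; rfl
  rw [h0, inf_bot_eq, finrank_bot] at h
  simpa using h

lemma core_e {m n ρ : ℕ} (V : Submodule F (Matrix (Fin m) (Fin n) F))
    (e : Fin (ρ + 1) → Fin m) (he : Function.Injective e)
    (hd : ∀ j, j.val + 1 ≤
      Module.finrank F ((V ⊓ zeroRows F m n (e j).val).map (rowLin F m n (e j))))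
    (S : Set (Matrix (Fin m) (Fin n) F)) (hS : S.Nonempty)
    (hstep : ∀ s ∈ S, ∀ M ∈ V, ∀ bad : F, ∃ t, t ≠ bad ∧ s + t • M ∈ S) :
    ∃ s ∈ S, ρ < s.rank := by
  classical
  obtain ⟨f, hf, hfi⟩ := exists_indep_transversal (ρ + 1)
    (fun j => (V ⊓ zeroRows F m n (e j).val).map (rowLin F m n (e j))) hd
  have key : ∀ k, k ≤ m → ∃ s ∈ S,
      LinearIndependent F (fun j => if (e j).val < k then s (e j) else f j) := by
    intro k
    induction k with
    | zero =>
      intro _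
      obtain ⟨s, hs⟩ := hS
      exact ⟨s, hs, by simpa using hfi⟩
    | succ k ih =>
      intro hk
      obtain ⟨s, hs, hind⟩ := ih (by omega)
      by_cases hj : ∃ j, (e j).val = k
      · obtain ⟨j, hj⟩ := hj
        obtain ⟨M, ⟨hMV, hMz⟩, hMj⟩ := hf j
        obtain ⟨bad, hbad⟩ := indep_update_aux _ hind j (s (e j))
        obtain ⟨t, ht, hts⟩ := hstep s hs M hMV bad
        refine ⟨_, hts, ?_⟩
        refine (?_ : (fun j => if (e j).val < k + 1 then (s + t • M) (e j) else f j) = _) ▸ hbad t ht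
        ext i x
        by_cases hij : i = j
        · subst hij
          have : M (e i) = f i := hMj
          simp [hj, Matrix.add_apply, this]
        · have hne : (e i).val ≠ k := fun h => hij (he (Fin.ext (h.trans hj.symm)))
          rw [Function.update_of_ne hij]
          by_cases hlt : (e i).val < k
          · have : M (e i) = 0 := hMz _ (by rw [hj]; exact hlt)
            simp [hlt, Nat.lt_succ_of_lt hlt, Matrix.add_apply, this]
          · have : ¬ (e i).val < k + 1 := by omega
            simp [hlt, this]
      · push Not at hj
        refine ⟨s, hs, ?_⟩
        convert hind using 3 with j
        have := hj j
        simp; omega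
  obtain ⟨s, hs, hind⟩ := key m le_rfl
  refine ⟨s, hs, ?_⟩
  simp only [Fin.is_lt, if_true] at hind
  have h1 : (s.submatrix e id).rank = Fintype.card (Fin (ρ + 1)) :=
    LinearIndependent.rank_matrix hind
  have h2 := Matrix.rank_submatrix_le s e id
  simp at h1
  omega

lemma core {m n ρ : ℕ} (hnm : n ≤ m) (V : Submodule F (Matrix (Fin m) (Fin n) F))
    (hV : m * ρ < Module.finrank F V) (S : Set (Matrix (Fin m) (Fin n) F)) (hS : S.Nonempty)
    (hstep : ∀ s ∈ S, ∀ M ∈ V, ∀ bad : F, ∃ t, t ≠ bad ∧ s + t • M ∈ S) :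
    ∃ s ∈ S, ρ < s.rank := by
  obtain ⟨e, he, hd⟩ := exists_inj_large (ρ := ρ) hnm
    (fun a => Module.finrank F ((V ⊓ zeroRows F m n a.val).map (rowLin F m n a)))
    (fun a => by simpa using Submodule.finrank_le ((V ⊓ zeroRows F m n a.val).map (rowLin F m n a)))
    (lt_of_lt_of_le hV (finrank_le_sum_rows V))
  exact core_e V e he hd S hS hstep

lemma affine_bound {m n : ℕ} (hnm : n ≤ m) (V : Submodule F (Matrix (Fin m) (Fin n) F))
    (ρ : ℕ) (hV : m * ρ < Module.finrank F V) (b : Matrix (Fin m) (Fin n) F) :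
    ∃ v ∈ V, ρ < (b + v).rank := by
  obtain ⟨s, ⟨v, hv, rfl⟩, h⟩ := core hnm V hV {s | ∃ v ∈ V, s = b + v} ⟨b, 0, V.zero_mem, by simp⟩ (by
    rintro s ⟨v, hv, rfl⟩ M hM bad
    refine ⟨bad + 1, by simp, v + (bad + 1) • M, V.add_mem hv (V.smul_mem _ hM), by abel⟩)
  exact ⟨v, hv, h⟩

lemma affine_bound' {m n : ℕ} (hnm : n ≤ m) (V : Submodule F (Matrix (Fin m) (Fin n) F))
    (b : Matrix (Fin m) (Fin n) F) :
    ∃ v ∈ V, Module.finrank F V ≤ m * (b + v).rank := by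
  by_contra hcon
  push Not at hcon
  have h0 := hcon 0 V.zero_mem
  have key : ∀ ρ, m * ρ < Module.finrank F V := by
    intro ρ
    induction ρ with
    | zero => rw [mul_zero]; omega
    | succ ρ ih =>
      obtain ⟨v, hv, h⟩ := affine_bound hnm V ρ ih b
      exact lt_of_le_of_lt (Nat.mul_le_mul_left _ h) (hcon v hv)
  have hm : 0 < m := by
    rcases Nat.eq_zero_or_pos m with rfl | h
    · have : Module.finrank F V ≤ Module.finrank F (Matrix (Fin 0) (Fin n) F) := V.finrank_le
      simp [Module.finrank_matrix] at this
      rw [this, finrank_bot] at h0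
      omega
    · exact h
  have := key (Module.finrank F V)
  nlinarith

lemma exists_third [Fintype F] (h : Fintype.card F ≠ 2) (x y : F) : ∃ t, t ≠ x ∧ t ≠ y := by
  classical
  have h2 : 1 < Fintype.card F := Fintype.one_lt_card
  have : 2 < (univ : Finset F).card := by rw [card_univ]; omega
  have h3 : ({x, y} : Finset F).card ≤ 2 := Finset.card_le_two
  obtain ⟨t, -, ht⟩ := Finset.exists_mem_notMem_of_card_lt_card (lt_of_le_of_lt h3 this)
  exact ⟨t, by simpa using ht⟩

lemma functional_bound [Fintype F] (hq : Fintype.card F ≠ 2) {m n : ℕ} (hnm : n ≤ m)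
    (V : Submodule F (Matrix (Fin m) (Fin n) F))
    (ρ : ℕ) (hV : m * ρ < Module.finrank F V) (lam : Matrix (Fin m) (Fin n) F →ₗ[F] F)
    (x : Matrix (Fin m) (Fin n) F) (hx : x ∈ V) (hlx : lam x ≠ 0) :
    ∃ v ∈ V, lam v ≠ 0 ∧ ρ < v.rank := by
  obtain ⟨s, ⟨hs, hl⟩, h⟩ := core hnm V hV {s | s ∈ V ∧ lam s ≠ 0} ⟨x, hx, hlx⟩ (by
    rintro s ⟨hs, hl⟩ M hM bad
    obtain ⟨t, ht1, ht2⟩ := exists_third hq bad (-(lam s) / lam M)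
    refine ⟨t, ht1, V.add_mem hs (V.smul_mem _ hM), ?_⟩
    rw [map_add, map_smul, smul_eq_mul]
    intro h0
    by_cases hM0 : lam M = 0
    · simp [hM0] at h0; exact hl h0
    · apply ht2
      rw [eq_div_iff hM0]
      linear_combination h0)
  exact ⟨s, hs, hl, h⟩

lemma rank_smul_ne {m n : ℕ} (c : F) (hc : c ≠ 0) (M : Matrix (Fin m) (Fin n) F) :
    (c • M).rank = M.rank :=
  Matrix.rank_smul_of_mem_nonZeroDivisors M (mem_nonZeroDivisors_of_ne_zero hc)

/-- two elements of maximal rank in distinct cosets -/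
lemma two_choices [Fintype F] {m n : ℕ} (hm : 0 < m) (hnm : n ≤ m)
    (hq : Fintype.card F ≠ 2 ∨ 2 ≤ m) (P K : Submodule F (Matrix (Fin m) (Fin n) F))
    (hopt : ∀ c ∈ P, m * c.rank ≤ Module.finrank F P) (hKP : ∃ x ∈ P, x ∉ K) :
    ∃ c ∈ P, ∃ c' ∈ P, Module.finrank F P ≤ m * c.rank ∧ Module.finrank F P ≤ m * c'.rank ∧
      c - c' ∉ K := by
  obtain ⟨x, hxP, hxK⟩ := hKP
  obtain ⟨lam, hlx, hlK⟩ := Submodule.exists_le_ker_of_notMem hxK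
  have hsuf : ∀ y, lam y ≠ 0 → y ∉ K := fun y hy hyK => hy (hlK hyK)
  -- write the dimension as at most `m * (ρ+1)`
  have hdpos : 0 < Module.finrank F P := by
    rw [Module.finrank_pos_iff]
    refine ⟨⟨x, hxP⟩, 0, fun h => hxK ?_⟩
    rw [Subtype.ext_iff] at h
    simp only [ZeroMemClass.coe_zero] at h
    rw [h]; exact K.zero_mem
  obtain ⟨ρ, hρ1, hρ2⟩ : ∃ ρ, m * ρ < Module.finrank F P ∧ Module.finrank F P ≤ m * (ρ + 1) := by
    refine ⟨(Module.finrank F P - 1) / m, ?_, ?_⟩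
    · have := Nat.mul_div_le (Module.finrank F P - 1) m
      omega
    · have := Nat.lt_mul_div_succ (Module.finrank F P - 1) hm
      omega
  have hup : ∀ r, ρ < r → Module.finrank F P ≤ m * r := fun r hr =>
    hρ2.trans (Nat.mul_le_mul_left _ hr)
  by_cases hq2 : Fintype.card F ≠ 2
  · obtain ⟨v, hv, hlv, hvr⟩ := functional_bound hq2 hnm P ρ hρ1 lam x hxP hlx
    obtain ⟨t, ht0, ht1⟩ := exists_third hq2 (0 : F) 1
    refine ⟨v, hv, t • v, P.smul_mem _ hv, hup _ hvr, by rw [rank_smul_ne t ht0]; exact hup _ hvr, ?_⟩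
    apply hsuf
    rw [map_sub, map_smul, smul_eq_mul]
    have : lam v - t * lam v = (1 - t) * lam v := by ring
    rw [this]
    exact mul_ne_zero (sub_ne_zero.2 (Ne.symm ht1)) hlv
  · have hm2 : 2 ≤ m := by tauto
    obtain ⟨c0, hc0, hr0⟩ := affine_bound hnm P ρ hρ1 0
    rw [zero_add] at hr0
    have hdim : Module.finrank F P = m * ρ + m := by
      have h1 := hopt c0 hc0
      have h2 : m * (ρ + 1) ≤ m * c0.rank := Nat.mul_le_mul_left _ hr0
      rw [Nat.mul_succ] at h2 hρ2
      omega
    have hH := finrank_le_map_add lam P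
    have h1 : Module.finrank F (P.map lam) ≤ 1 := by
      simpa using (P.map lam).finrank_le
    have hHd : m * ρ < Module.finrank F (P ⊓ LinearMap.ker lam : Submodule F _) := by omega
    obtain ⟨v, hv, hvr⟩ := affine_bound hnm _ ρ hHd x
    obtain ⟨w, hw, hwr⟩ := affine_bound hnm _ ρ hHd 0
    rw [zero_add] at hwr
    refine ⟨x + v, P.add_mem hxP hv.1, w, hw.1, hup _ hvr, hup _ hwr, hsuf _ ?_⟩
    have e1 : lam v = 0 := hv.2
    have e2 : lam w = 0 := hw.2
    rw [map_sub, map_add, e1, e2]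
    simpa using hlx

/-- cosets of small rank -/
lemma coset_contra [Fintype F] {m n : ℕ} (hm : 0 < m) (hnm : n ≤ m)
    (K : Submodule F (Matrix (Fin m) (Fin n) F)) (x x' : Matrix (Fin m) (Fin n) F)
    (hxx : x - x' ∉ K) (hx : ∀ k ∈ K, m * (x + k).rank ≤ Module.finrank F K)
    (hx' : ∀ k ∈ K, m * (x' + k).rank ≤ Module.finrank F K) : False := by
  obtain ⟨k0, hk0, hk0r⟩ := affine_bound' hnm K x
  have hdim : Module.finrank F K = m * (x + k0).rank := le_antisymm hk0r (hx k0 hk0)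
  set ρ := (x + k0).rank
  have hlt : ∀ y, y ∉ K → m * ρ < Module.finrank F (K ⊔ Submodule.span F {y} : Submodule F _) := by
    intro y hy
    rw [← hdim]
    apply Submodule.finrank_lt_finrank_of_lt
    refine lt_of_le_of_ne le_sup_left fun h => hy ?_
    rw [h]
    exact Submodule.mem_sup_right (Submodule.mem_span_singleton_self y)
  have hle : ∀ r, m * r ≤ Module.finrank F K → r ≤ ρ := fun r hr => by
    rw [hdim] at hr; exact Nat.le_of_mul_le_mul_left hr hm
  by_cases hq2 : Fintype.card F = 2
  · obtain ⟨v, hv, hvr⟩ := affine_bound hnm _ ρ (hlt _ hxx) x'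
    obtain ⟨k, hk, y, hy, rfl⟩ := Submodule.mem_sup.1 hv
    obtain ⟨t, rfl⟩ := Submodule.mem_span_singleton.1 hy
    have ht : t = 0 ∨ t = 1 := by
      classical
      by_contra hcon
      push Not at hcon
      have : ({0, 1, t} : Finset F).card ≤ 2 := hq2 ▸ Finset.card_le_univ _
      rw [Finset.card_eq_three.2 ⟨0, 1, t, zero_ne_one, hcon.1.symm, hcon.2.symm, rfl⟩] at this
      omega
    rcases ht with rfl | rfl
    · have := hle _ (hx' k hk)
      simp at hvr; omega
    · have := hle _ (hx k hk)
      rw [show x' + (k + (1 : F) • (x - x')) = x + k by rw [one_smul]; abel] at hvr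
      omega
  · have main : ∀ y, y ∉ K → (∀ k ∈ K, m * (y + k).rank ≤ Module.finrank F K) → False := by
      intro y hy hyr
      obtain ⟨lam, hly, hlK⟩ := Submodule.exists_le_ker_of_notMem hy
      obtain ⟨v, hv, hlv, hvr⟩ := functional_bound hq2 hnm _ ρ (hlt _ hy) lam y
        (Submodule.mem_sup_right (Submodule.mem_span_singleton_self y)) hly
      obtain ⟨k, hk, z, hz, rfl⟩ := Submodule.mem_sup.1 hv
      obtain ⟨t, rfl⟩ := Submodule.mem_span_singleton.1 hz
      have ht : t ≠ 0 := by
        rintro rfl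
        apply hlv
        have : lam k = 0 := hlK hk
        simp [this]
      have := hle _ (hyr (t⁻¹ • k) (K.smul_mem _ hk))
      rw [← rank_smul_ne t ht, smul_add, smul_smul, mul_inv_cancel₀ ht, one_smul, add_comm] at this
      omega
    by_cases h : x ∈ K
    · exact main x' (fun h' => hxx (K.sub_mem h h')) hx'
    · exact main x h hx

end Core

section RankDual
variable {F : Type*} [Field F]

lemma eq_zero_of_rank_zero {m n : ℕ} (M : Matrix (Fin m) (Fin n) F) (h : M.rank = 0) : M = 0 := by
  rw [Matrix.rank_eq_finrank_span_row, Submodule.finrank_eq_zero, Submodule.span_eq_bot] at h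
  ext i j
  have := h (M i) ⟨i, rfl⟩
  rw [this]; rfl

lemma not_indep_aux {n r : ℕ} (hr : r < n) (T : Fin r → ((Fin n → F) →ₗ[F] (Fin n → F)))
    (h : ∀ x : Fin r → (Fin n → F), LinearIndependent F x →
      ∑ j, T j (x j) ∈ Submodule.span F (Set.range x)) (j : Fin r) (v : Fin n → F) :
    ¬ LinearIndependent F ![v, T j v] := by
  intro hli
  have hv : v ≠ 0 := by simpa using hli.ne_zero 0
  by_cases hr1 : r = 1
  · subst hr1
    have h1 := h (fun _ => v) (by
      rw [linearIndependent_unique_iff]; exact hv)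
    have hj : j = 0 := Subsingleton.elim _ _
    subst hj
    simp only [Finset.univ_unique, Finset.sum_singleton, Set.range_const] at h1
    obtain ⟨c, hc⟩ := Submodule.mem_span_singleton.1 h1
    rw [LinearIndependent.pair_iff' hv] at hli
    exact hli c hc
  · have hjr := j.2
    obtain ⟨i0, hi0⟩ : ∃ i0 : Fin r, i0 ≠ j := by
      by_cases h0 : j.val = 0
      · exact ⟨⟨1, by omega⟩, fun h => by rw [← h] at h0; simp at h0⟩
      · exact ⟨⟨0, by omega⟩, fun h => by rw [← h] at h0; simp at h0⟩
    obtain ⟨r', rfl⟩ : ∃ r', r = r' + 1 := ⟨r - 1, by omega⟩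
    obtain ⟨r'', rfl⟩ : ∃ r'', r' = r'' + 1 := ⟨r' - 1, by omega⟩
    obtain ⟨f, hfU, hf⟩ := exists_indep_transversal (F := F) (r'' + 1 + 1 + 1)
      (fun k : Fin (r'' + 1 + 1 + 1) => if k.val = 0 then Submodule.span F {v} else
        if k.val = 1 then Submodule.span F (Set.range ![v, T j v]) else
          (⊤ : Submodule F (Fin n → F))) (by
        intro k
        by_cases h0 : k.val = 0
        · rw [if_pos h0, finrank_span_singleton hv]; omega
        · by_cases h1 : k.val = 1
          · rw [if_neg h0, if_pos h1, finrank_span_eq_card hli]; simp [h1]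
          · rw [if_neg h0, if_neg h1, finrank_top]
            have := k.2
            simp; omega)
    have hf0 := hfU 0
    have hf1 := hfU 1
    simp only [Fin.val_zero, if_true] at hf0
    simp only [Fin.val_one, one_ne_zero, if_true, if_false] at hf1
    obtain ⟨c, hc⟩ := Submodule.mem_span_singleton.1 hf0
    have hc0 : c ≠ 0 := by
      rintro rfl
      rw [zero_smul] at hc
      exact hf.ne_zero 0 hc.symm
    set x : Fin (r'' + 1 + 1) → (Fin n → F) :=
      fun i => f (Fin.succAbove 1 (Equiv.swap 0 i0 i)) with hx
    have hxi0 : x i0 = f 0 := by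
      simp [hx]
    have hxi : LinearIndependent F x :=
      hf.comp _ (Fin.succAbove_right_injective.comp (Equiv.injective _))
    have hyi : LinearIndependent F (x + fun k => (Pi.single j (1 : F) : _ → F) k • x i0) :=
      (linearIndependent_add_smul_iff (by simp [hi0])).2 hxi
    have h1 := h _ hxi
    have h2 := h _ hyi
    have h3 : Submodule.span F (Set.range (x + fun k => (Pi.single j (1 : F) : _ → F) k • x i0)) ≤
        Submodule.span F (Set.range x) := by
      rw [Submodule.span_le]
      rintro _ ⟨k, rfl⟩
      exact Submodule.add_mem _ (Submodule.subset_span ⟨k, rfl⟩)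
        (Submodule.smul_mem _ _ (Submodule.subset_span ⟨i0, rfl⟩))
    have h4 := Submodule.sub_mem _ (h3 h2) h1
    rw [← Finset.sum_sub_distrib] at h4
    have h5 : ∑ k, (T k ((x + fun k => (Pi.single j (1 : F) : _ → F) k • x i0) k) - T k (x k)) =
        T j (x i0) := by
      rw [Finset.sum_eq_single j]
      · simp
      · intro b _ hb
        simp [hb]
      · simp
    rw [h5, hxi0, ← hc, map_smul] at h4
    have h6 : T j v ∈ Submodule.span F (Set.range x) := by
      have := Submodule.smul_mem _ c⁻¹ h4
      rwa [smul_smul, inv_mul_cancel₀ hc0, one_smul] at this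
    have h7 : Submodule.span F (Set.range x) ≤ Submodule.span F (f '' {1}ᶜ) := by
      apply Submodule.span_mono
      rintro _ ⟨k, rfl⟩
      exact ⟨_, Fin.succAbove_ne _ _, rfl⟩
    have h8 : v ∈ Submodule.span F (f '' {1}ᶜ) := by
      have h9 : f 0 ∈ Submodule.span F (f '' {1}ᶜ) := Submodule.subset_span ⟨0, by simp, rfl⟩
      have := Submodule.smul_mem _ c⁻¹ h9
      rwa [← hc, smul_smul, inv_mul_cancel₀ hc0, one_smul] at this
    have h9 : Submodule.span F (Set.range ![v, T j v]) ≤ Submodule.span F (f '' {1}ᶜ) := by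
      rw [Submodule.span_le]
      rintro _ ⟨k, rfl⟩
      fin_cases k
      · exact h8
      · exact h7 h6
    exact hf.notMem_span_image (s := {1}ᶜ) (x := 1) (by simp) (h9 hf1)

/-- the rank-metric duality property -/
def Good {m n : ℕ} (V : Submodule F (Matrix (Fin m) (Fin n) F)) (r : ℕ) : Prop :=
  ∀ X : Matrix (Fin m) (Fin n) F, (∀ M ∈ V, Matrix.trace (X * Mᵀ) = 0) → X.rank + r ≤ n

lemma good_case_two {n r : ℕ} (hr : r < n) (V : Submodule F (Matrix (Fin n) (Fin n) F))
    (hV : Module.finrank F V = n * r) (hrk : ∀ M ∈ V, M.rank ≤ r) (R : Finset (Fin n))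
    (hR : R.card = r)
    (hd : ∀ a, a ∉ R → Module.finrank F ((V ⊓ zeroRows F n n a.val).map (rowLin F n n a)) = 0) :
    Good V r := by
  classical
  let σ : Fin r → Fin n := fun j => (R.equivFinOfCardEq hR).symm j
  have hσR : ∀ a ∈ R, ∃ j, σ j = a := fun a ha =>
    ⟨R.equivFinOfCardEq hR ⟨a, ha⟩, by simp [σ]⟩
  let ψ : V →ₗ[F] (Fin r → Fin n → F) :=
    LinearMap.pi fun j => (rowLin F n n (σ j)).comp V.subtype
  have hψ : Function.Injective ψ := by
    rw [injective_iff_map_eq_zero]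
    rintro ⟨M, hM⟩ h
    have hz : ∀ a ∈ R, M a = 0 := by
      intro a ha
      obtain ⟨j, rfl⟩ := hσR a ha
      exact congrFun h j
    have key : ∀ k, ∀ a : Fin n, a.val < k → M a = 0 := by
      intro k
      induction k with
      | zero => intro a ha; omega
      | succ k ih =>
        intro a ha
        by_cases haR : a ∈ R
        · exact hz a haR
        · have h1 := hd a haR
          rw [Submodule.finrank_eq_zero] at h1
          have h2 : M a ∈ (V ⊓ zeroRows F n n a.val).map (rowLin F n n a) :=
            ⟨M, ⟨hM, fun i hi => ih i (by omega)⟩, rfl⟩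
          rw [h1] at h2
          exact h2
    ext i j
    have := key n i i.2
    simp [this]
  let Ψ := LinearEquiv.ofInjectiveOfFinrankEq ψ hψ (by
    rw [hV]; simp [Module.finrank_pi_fintype, mul_comm])
  have hΨ : ∀ x j, (Ψ.symm x : Matrix (Fin n) (Fin n) F) (σ j) = x j := by
    intro x j
    have : ψ (Ψ.symm x) = x := Ψ.apply_symm_apply x
    exact congrFun this j
  let T : Fin n → Fin r → ((Fin n → F) →ₗ[F] (Fin n → F)) := fun a j =>
    ((rowLin F n n a).comp V.subtype).comp
      (Ψ.symm.toLinearMap.comp (LinearMap.single F (fun _ : Fin r => Fin n → F) j))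
  have hT : ∀ a x, (Ψ.symm x : Matrix (Fin n) (Fin n) F) a = ∑ j, T a j (x j) := by
    intro a x
    have h1 : x = ∑ j, (LinearMap.single F (fun _ : Fin r => Fin n → F) j) (x j) := by
      simpa using (Finset.univ_sum_single x).symm
    have h2 := congrArg (((rowLin F n n a).comp V.subtype).comp Ψ.symm.toLinearMap) h1
    rw [map_sum] at h2
    exact h2
  have hc : ∀ a j, ∃ c : F, T a j = c • 1 := by
    intro a j
    apply LinearMap.exists_eq_smul_id_of_forall_notLinearIndependent
    apply not_indep_aux hr
    intro x hx
    rw [← hT]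
    have h1 := hrk _ (Ψ.symm x).2
    rw [Matrix.rank_eq_finrank_span_row] at h1
    have h2 : Submodule.span F (Set.range x) ≤
        Submodule.span F (Set.range (Ψ.symm x : Matrix (Fin n) (Fin n) F).row) := by
      apply Submodule.span_mono
      rintro _ ⟨j, rfl⟩
      exact ⟨σ j, hΨ x j⟩
    have h3 := Submodule.eq_of_le_of_finrank_le h2 (by
      rw [finrank_span_eq_card hx]; simpa using h1)
    rw [h3]
    exact Submodule.subset_span ⟨a, rfl⟩
  choose c hc using hc
  let C : Matrix (Fin n) (Fin r) F := Matrix.of c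
  have hC : ∀ x : Matrix (Fin r) (Fin n) F, C * x = (Ψ.symm x : Matrix (Fin n) (Fin n) F) := by
    intro x
    ext a k
    rw [hT a x, Matrix.mul_apply, Finset.sum_apply]
    apply Finset.sum_congr rfl
    intro j _
    rw [hc a j]
    simp [C]
  have hone : C.submatrix σ id = 1 := by
    ext j' j
    have h1 := congrFun (hΨ (Matrix.single j ⟨0, by omega⟩ 1) j') ⟨0, by omega⟩
    rw [← hC, Matrix.mul_apply] at h1
    rw [Finset.sum_eq_single j] at h1
    · simpa [Matrix.single_apply, Matrix.one_apply, eq_comm] using h1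
    · intro b _ hb
      simp [Matrix.single_apply, hb.symm]
    · simp
  have hCr : r ≤ Cᵀ.rank := by
    have h1 := Matrix.rank_submatrix_le C σ id
    rw [hone, Matrix.rank_one] at h1
    rw [Matrix.rank_transpose]
    simpa using h1
  intro X hX
  have h0 : Cᵀ * X = 0 := by
    rw [Matrix.ext_iff_trace_mul_right]
    intro x
    have h1 := hX _ (Ψ.symm xᵀ).2
    rw [← hC, Matrix.transpose_mul, Matrix.transpose_transpose, ← Matrix.mul_assoc,
      Matrix.trace_mul_comm, ← Matrix.mul_assoc] at h1
    simpa using h1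
  have := Matrix.rank_add_rank_le_card_of_mul_eq_zero h0
  rw [Fintype.card_fin] at this
  omega

lemma dichotomy {m n r : ℕ} (hr0 : 0 < r) (hr : r < n) (hnm : n ≤ m)
    (V : Submodule F (Matrix (Fin m) (Fin n) F))
    (hV : Module.finrank F V = m * r) (hrk : ∀ M ∈ V, M.rank ≤ r) :
    (∀ a : Fin m, Module.finrank F ((V ⊓ zeroRows F m n a.val).map (rowLin F m n a)) = r) ∨
      Good V r := by
  classical
  set d : Fin m → ℕ := fun a =>
    Module.finrank F ((V ⊓ zeroRows F m n a.val).map (rowLin F m n a)) with hd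
  have hdn : ∀ a, d a ≤ n := fun a => by
    simpa using Submodule.finrank_le ((V ⊓ zeroRows F m n a.val).map (rowLin F m n a))
  have hsum : m * r ≤ ∑ a, d a := hV ▸ finrank_le_sum_rows V
  have hno : ∃ i, i ≤ r ∧ (univ.filter fun a => i + 1 ≤ d a).card + i ≤ r := by
    by_contra hcon
    push Not at hcon
    obtain ⟨e, he, h⟩ := exists_inj_of_count (ρ := r) d (fun i hi => hcon i hi)
    obtain ⟨s, hs, hlt⟩ := core_e V e he h (V : Set _) ⟨0, V.zero_mem⟩ (by
      intro s hs M hM bad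
      exact ⟨bad + 1, by simp, V.add_mem hs (V.smul_mem _ hM)⟩)
    have := hrk s hs
    omega
  obtain ⟨i, hir, hi⟩ := hno
  set T := univ.filter fun a => i + 1 ≤ d a with hT
  have hTm : T.card ≤ m := by simpa using T.card_le_univ
  have hout : ∀ a ∈ Tᶜ, d a ≤ i := fun a ha => by simp [hT] at ha; omega
  have h1 : ∑ a, d a ≤ T.card * n + (m - T.card) * i := by
    rw [← Finset.sum_add_sum_compl T]
    apply Nat.add_le_add
    · simpa using Finset.sum_le_card_nsmul T d n (fun a _ => hdn a)
    · have := Finset.sum_le_card_nsmul Tᶜ d i hout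
      simpa [Finset.card_compl] using this
  by_cases hi1 : i = r
  · left
    have hT0 : T = ∅ := by
      rw [← Finset.card_eq_zero]; omega
    have hle : ∀ a ∈ univ, d a ≤ r := fun a _ => by
      rw [← hi1]; exact hout a (by rw [hT0]; simp)
    have heq : ∑ a : Fin m, d a = ∑ a : Fin m, r := by
      apply le_antisymm (Finset.sum_le_sum hle)
      simpa using hsum
    exact fun a => (Finset.sum_eq_sum_iff_of_le hle).1 heq a (mem_univ a)
  · right
    have hsum' := le_trans hsum h1
    obtain ⟨k, hk⟩ : ∃ k, m = T.card + k := ⟨m - T.card, by omega⟩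
    have h3 : m - T.card = k := by omega
    rw [h3] at hsum'
    obtain ⟨u, hu⟩ : ∃ u, r = i + u + 1 := ⟨r - i - 1, by omega⟩
    obtain ⟨w, hw⟩ : ∃ w, n = i + w := ⟨n - i, by omega⟩
    obtain ⟨z, hz⟩ : ∃ z, m = n + z := ⟨m - n, by omega⟩
    have h5 : T.card ≤ u + 1 := by omega
    have h6 : T.card * w ≤ (u + 1) * w := Nat.mul_le_mul_right _ h5
    -- `m * r ≤ T.card * w + m * i`
    have h7 : m * r ≤ T.card * w + m * i := by
      calc m * r ≤ T.card * n + k * i := hsum'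
        _ = T.card * w + (T.card + k) * i := by rw [hw]; ring
        _ = T.card * w + m * i := by rw [← hk]
    have h8 : m * (u + 1) ≤ T.card * w := by
      have : m * r = m * i + m * (u + 1) := by rw [hu]; ring
      omega
    have h9 : (u + 1) * m ≤ (u + 1) * w := by rw [mul_comm (u + 1) m]; omega
    have h10 : m ≤ w := Nat.le_of_mul_le_mul_left h9 (by omega)
    have hi0 : i = 0 := by omega
    have hmn : m = n := by omega
    have hmw : m = w := by omega
    have hTr : T.card = r := by
      rw [← hmw, mul_comm, ] at h8
      have := Nat.le_of_mul_le_mul_right h8 (by omega)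
      omega
    subst hmn
    refine good_case_two hr V hV hrk T hTr (fun a ha => ?_)
    have := hout a (by simpa using ha)
    show d a = 0
    omega

/-- left multiplication -/
def lmul {m n : ℕ} (P : Matrix (Fin m) (Fin m) F) :
    Matrix (Fin m) (Fin n) F →ₗ[F] Matrix (Fin m) (Fin n) F where
  toFun M := P * M
  map_add' _ _ := Matrix.mul_add _ _ _
  map_smul' _ _ := Matrix.mul_smul _ _ _

lemma dichotomy' {m n r : ℕ} (hr0 : 0 < r) (hr : r < n) (hnm : n ≤ m)
    (V : Submodule F (Matrix (Fin m) (Fin n) F))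
    (hV : Module.finrank F V = m * r) (hrk : ∀ M ∈ V, M.rank ≤ r) (hG : ¬ Good V r)
    (P Q : Matrix (Fin m) (Fin m) F) (hQP : Q * P = 1) (a : Fin m) :
    Module.finrank F ((V.map (lmul P) ⊓ zeroRows F m n a.val).map (rowLin F m n a)) = r := by
  have hinj : Function.Injective (lmul (n := n) P) := by
    intro x y h
    have : Q * (P * x) = Q * (P * y) := congrArg (Q * ·) h
    rwa [← Matrix.mul_assoc, ← Matrix.mul_assoc, hQP, Matrix.one_mul, Matrix.one_mul] at this
  rcases dichotomy hr0 hr hnm (V.map (lmul P)) (by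
    rw [← hV]; exact (LinearEquiv.finrank_eq (Submodule.equivMapOfInjective _ hinj V)).symm) (by
      rintro _ ⟨M, hM, rfl⟩
      exact (Matrix.rank_mul_le_right P M).trans (hrk M hM)) with h | h
  · exact h a
  · exfalso
    apply hG
    intro X hX
    have h1 := h (Qᵀ * X) (by
      rintro _ ⟨M, hM, rfl⟩
      show Matrix.trace (Qᵀ * X * (P * M)ᵀ) = 0
      rw [Matrix.transpose_mul, Matrix.trace_mul_comm, Matrix.mul_assoc, ← Matrix.mul_assoc Pᵀ,
        ← Matrix.transpose_mul, hQP, Matrix.transpose_one, Matrix.one_mul, Matrix.trace_mul_comm]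
      exact hX M hM)
    have h2 : X = Pᵀ * (Qᵀ * X) := by
      rw [← Matrix.mul_assoc, ← Matrix.transpose_mul, hQP, Matrix.transpose_one, Matrix.one_mul]
    have h3 := Matrix.rank_mul_le_right Pᵀ (Qᵀ * X)
    rw [← h2] at h3
    omega

/-- matrix with a single nonzero row -/
def srow (F : Type*) [Field F] (m n : ℕ) (a : Fin m) :
    (Fin n → F) →ₗ[F] Matrix (Fin m) (Fin n) F :=
  LinearMap.single F (fun _ : Fin m => Fin n → F) a

lemma srow_same {m n : ℕ} (a : Fin m) (x : Fin n → F) : srow F m n a x a = x :=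
  Pi.single_eq_same (M := fun _ : Fin m => Fin n → F) a x

lemma srow_ne {m n : ℕ} (a i : Fin m) (h : i ≠ a) (x : Fin n → F) : srow F m n a x i = 0 :=
  Pi.single_eq_of_ne (M := fun _ : Fin m => Fin n → F) h x

/-- swap matrix -/
def sw (F : Type*) [Field F] {m : ℕ} (a b : Fin m) : Matrix (Fin m) (Fin m) F :=
  (1 : Matrix (Fin m) (Fin m) F).submatrix (Equiv.swap a b) id

lemma sw_mul {m n : ℕ} (a b : Fin m) (M : Matrix (Fin m) (Fin n) F) (i : Fin m) :
    (sw F a b * M) i = M (Equiv.swap a b i) := by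
  ext j
  simp [sw, Matrix.mul_apply, Matrix.one_apply]

lemma sw_sw {m : ℕ} (a b : Fin m) : sw F a b * sw F a b = 1 := by
  ext i j
  rw [sw_mul]
  simp [sw, Matrix.one_apply]

lemma good_of_opt {m n r : ℕ} (hm : 0 < m) (hnm : n ≤ m)
    (V : Submodule F (Matrix (Fin m) (Fin n) F))
    (hV : Module.finrank F V = m * r) (hrk : ∀ M ∈ V, M.rank ≤ r) : Good V r := by
  classical
  by_cases hr0 : r = 0
  · subst hr0
    intro X _
    have := Matrix.rank_le_width X
    omega
  have hle : r ≤ n := by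
    have h1 := Submodule.finrank_le V
    rw [hV, Module.finrank_matrix] at h1
    simp at h1
    exact Nat.le_of_mul_le_mul_left h1 hm
  by_cases hrn : r = n
  · subst hrn
    have hT : V = ⊤ := Submodule.eq_top_of_finrank_eq (by
      rw [hV, Module.finrank_matrix]; simp)
    intro X hX
    have : X = 0 := by
      rw [Matrix.ext_iff_trace_mul_right]
      intro x
      have := hX xᵀ (by rw [hT]; trivial)
      simpa using this
    rw [this, Matrix.rank_zero]; omega
  by_contra hG
  have hD := fun P Q h a => dichotomy' (by omega) (by omega) hnm V hV hrk hG P Q h a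
  let z : Fin m := ⟨0, hm⟩
  let l : Fin m := ⟨m - 1, by omega⟩
  have hp : ∀ a, Module.finrank F (V.map (rowLin F m n a)) = r := by
    intro a
    rw [← hD _ _ (sw_sw a z) z]
    suffices h : V.map (rowLin F m n a) =
        (V.map (lmul (sw F a z)) ⊓ zeroRows F m n z.val).map (rowLin F m n z) by rw [h]
    have hrow : ∀ M : Matrix (Fin m) (Fin n) F, (sw F a z * M) z = M a := by
      intro M; rw [sw_mul, Equiv.swap_apply_right]
    ext x
    constructor
    · rintro ⟨M, hM, rfl⟩
      exact ⟨_, ⟨⟨M, hM, rfl⟩, fun i hi => by simp [z] at hi⟩, hrow M⟩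
    · rintro ⟨_, ⟨⟨M, hM, rfl⟩, -⟩, rfl⟩
      exact ⟨M, hM, (hrow M).symm⟩
  have hk : ∀ a, Module.finrank F (V.comap (srow F m n a)) = r := by
    intro a
    rw [← hD _ _ (sw_sw a l) l]
    suffices h : V.comap (srow F m n a) =
        (V.map (lmul (sw F a l)) ⊓ zeroRows F m n l.val).map (rowLin F m n l) by rw [h]
    have hrow : ∀ M : Matrix (Fin m) (Fin n) F, (sw F a l * M) l = M a := by
      intro M; rw [sw_mul, Equiv.swap_apply_right]
    ext x
    constructor
    · intro hx
      refine ⟨_, ⟨⟨_, hx, rfl⟩, fun i hi => ?_⟩, (hrow _).trans (srow_same a x)⟩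
      have hil : i ≠ l := by rintro rfl; omega
      refine (sw_mul a l _ i).trans (srow_ne _ _ ?_ x)
      intro h
      apply hil
      rw [Equiv.swap_apply_eq_iff] at h
      simpa using h
    · rintro ⟨_, ⟨⟨M, hM, rfl⟩, hz⟩, rfl⟩
      have hz' : ∀ i, i ≠ a → M i = 0 := by
        intro i hi
        have h1 : (sw F a l * M) (Equiv.swap a l i) = 0 := hz _ (by
            have h2 : Equiv.swap a l i ≠ l := by
              intro h
              rw [Equiv.swap_apply_eq_iff] at h
              simp at h
              exact hi h
            have h3 := (Equiv.swap a l i).2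
            have h4 : (Equiv.swap a l i).val ≠ m - 1 := fun h => h2 (Fin.ext h)
            show _ < m - 1
            omega)
        rwa [sw_mul, Equiv.swap_apply_self] at h1
      have h5 : srow F m n a (M a) = M := by
        funext i
        by_cases hi : i = a
        · subst hi
          exact srow_same _ _
        · rw [hz' i hi]
          exact srow_ne a i hi _
      show srow F m n a ((sw F a l * M) l) ∈ V
      rw [hrow, h5]; exact hM
  have hs : ∀ a b, a ≠ b → Module.finrank F (V.map (rowLin F m n a + rowLin F m n b)) = r := by
    intro a b hab
    have hPQ : (Matrix.transvection a b (-1 : F) * sw F a z) *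
        (sw F a z * Matrix.transvection a b 1) = 1 := by
      rw [Matrix.mul_assoc, ← Matrix.mul_assoc _ _ (Matrix.transvection a b 1), sw_sw,
        Matrix.one_mul, Matrix.transvection_mul_transvection_same _ _ hab]
      simp
    have hrow : ∀ M : Matrix (Fin m) (Fin n) F,
        ((sw F a z * Matrix.transvection a b 1) * M : Matrix (Fin m) (Fin n) F) z
          = M a + M b := by
      intro M
      rw [Matrix.mul_assoc, sw_mul, Equiv.swap_apply_right]
      ext j
      simp
    rw [← hD _ _ hPQ z]
    suffices h : V.map (rowLin F m n a + rowLin F m n b) =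
        (V.map (lmul (sw F a z * Matrix.transvection a b 1)) ⊓ zeroRows F m n z.val).map
          (rowLin F m n z) by rw [h]
    ext x
    constructor
    · rintro ⟨M, hM, rfl⟩
      exact ⟨_, ⟨⟨M, hM, rfl⟩, fun i hi => by simp [z] at hi⟩, hrow M⟩
    · rintro ⟨_, ⟨⟨M, hM, rfl⟩, -⟩, rfl⟩
      exact ⟨M, hM, (hrow M).symm⟩
  have hUU : ∀ a b, V.comap (srow F m n a) = V.comap (srow F m n b) := by
    intro a b
    by_cases hab : a = b
    · rw [hab]
    have h1 : V.comap (srow F m n a) ≤ V.map (rowLin F m n a + rowLin F m n b) := by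
      intro x hx
      exact ⟨_, hx, by
        show srow F m n a x a + srow F m n a x b = x
        rw [srow_same, srow_ne a b (Ne.symm hab), add_zero]⟩
    have h2 : V.comap (srow F m n b) ≤ V.map (rowLin F m n a + rowLin F m n b) := by
      intro x hx
      exact ⟨_, hx, by
        show srow F m n b x a + srow F m n b x b = x
        rw [srow_same, srow_ne b a hab, zero_add]⟩
    rw [Submodule.eq_of_le_of_finrank_eq h1 (by rw [hk, hs a b hab]),
      Submodule.eq_of_le_of_finrank_eq h2 (by rw [hk, hs a b hab])]
  apply hG
  intro X hX
  -- a matrix whose rows form a basis of the common row space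
  let U := V.comap (srow F m n z)
  let bU := Module.finBasisOfFinrankEq F U (hk z)
  let B : Matrix (Fin r) (Fin n) F := fun i => (bU i : Fin n → F)
  have hB : LinearIndependent F B.row :=
    bU.linearIndependent.map' U.subtype (Submodule.ker_subtype U)
  have hBr : Bᵀ.rank = r := by
    rw [Matrix.rank_transpose, hB.rank_matrix]; simp
  have h0 : X * Bᵀ = 0 := by
    ext a i
    have h1 : srow F m n a (B i) ∈ V := by
      have h2 : B i ∈ V.comap (srow F m n a) := by rw [hUU a z]; exact (bU i).2
      exact h2
    have h2 := hX _ h1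
    rw [Matrix.trace, Finset.sum_eq_single a] at h2
    · rw [Matrix.mul_apply]
      simpa [Matrix.mul_apply, srow_same] using h2
    · intro b _ hb
      simp [Matrix.mul_apply, srow_ne a b hb]
    · simp
  have := Matrix.rank_add_rank_le_card_of_mul_eq_zero h0
  rw [Fintype.card_fin] at this
  omega

end RankDual

section Structure
variable {F : Type*} [Field F] [Fintype F] {ℓ : ℕ} {m n : Fin ℓ → ℕ}

/-- projection to a block -/
def PP (A : Submodule F (∀ i : Fin ℓ, Matrix (Fin (m i)) (Fin (n i)) F)) (i : Fin ℓ) :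
    Submodule F (Matrix (Fin (m i)) (Fin (n i)) F) := A.map (LinearMap.proj i)

/-- shortening to a block -/
def KK (A : Submodule F (∀ i : Fin ℓ, Matrix (Fin (m i)) (Fin (n i)) F)) (i : Fin ℓ) :
    Submodule F (Matrix (Fin (m i)) (Fin (n i)) F) :=
  A.comap (LinearMap.single F (fun i => Matrix (Fin (m i)) (Fin (n i)) F) i)

/-- erasing a block -/
def er (F : Type*) [Field F] (m n : Fin ℓ → ℕ) (i : Fin ℓ) :
    (∀ i : Fin ℓ, Matrix (Fin (m i)) (Fin (n i)) F) →ₗ[F]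
      (∀ i : Fin ℓ, Matrix (Fin (m i)) (Fin (n i)) F) :=
  LinearMap.id - (LinearMap.single F (fun i => Matrix (Fin (m i)) (Fin (n i)) F) i).comp
    (LinearMap.proj i)

lemma er_same (i : Fin ℓ) (C : ∀ i : Fin ℓ, Matrix (Fin (m i)) (Fin (n i)) F) :
    er F m n i C i = 0 := by simp [er]

lemma er_ne (i k : Fin ℓ) (h : k ≠ i) (C : ∀ i : Fin ℓ, Matrix (Fin (m i)) (Fin (n i)) F) :
    er F m n i C k = C k := by simp [er, h]

lemma mem_PP {A : Submodule F (∀ i : Fin ℓ, Matrix (Fin (m i)) (Fin (n i)) F)} {i : Fin ℓ}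
    {c : Matrix (Fin (m i)) (Fin (n i)) F} : c ∈ PP A i ↔ ∃ a ∈ A, a i = c := Iff.rfl

lemma mem_KK {A : Submodule F (∀ i : Fin ℓ, Matrix (Fin (m i)) (Fin (n i)) F)} {i : Fin ℓ}
    {c : Matrix (Fin (m i)) (Fin (n i)) F} : c ∈ KK A i ↔ (Pi.single i c) ∈ A := Iff.rfl

lemma finrank_er (A : Submodule F (∀ i : Fin ℓ, Matrix (Fin (m i)) (Fin (n i)) F)) (i : Fin ℓ) :
    Module.finrank F A = Module.finrank F (A.map (er F m n i)) + Module.finrank F (KK A i) := by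
  rw [finrank_le_map_add (er F m n i) A]
  congr 1
  have hinj : Function.Injective
      (LinearMap.single F (fun i => Matrix (Fin (m i)) (Fin (n i)) F) i) :=
    fun x y h => Pi.single_injective i h
  rw [KK, LinearEquiv.finrank_eq (Submodule.equivMapOfInjective _ hinj _),
    Submodule.map_comap_eq, inf_comm A]
  suffices hk : LinearMap.ker (er F m n i) = LinearMap.range
      (LinearMap.single F (fun i => Matrix (Fin (m i)) (Fin (n i)) F) i) by rw [hk, inf_comm]
  apply le_antisymm
  · rintro x hx
    rw [LinearMap.mem_ker] at hx
    refine ⟨x i, ?_⟩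
    have : x - Pi.single i (x i) = 0 := hx
    exact (sub_eq_zero.1 this).symm
  · rintro _ ⟨c, rfl⟩
    rw [LinearMap.mem_ker]
    simp [er]

lemma finrank_le_sum_PP (A : Submodule F (∀ i : Fin ℓ, Matrix (Fin (m i)) (Fin (n i)) F)) :
    Module.finrank F A ≤ ∑ i, Module.finrank F (PP A i) := by
  let φ : A →ₗ[F] (∀ i, PP A i) := LinearMap.pi fun i =>
    ((LinearMap.proj i).comp A.subtype).codRestrict (PP A i) (fun a => ⟨a.1, a.2, rfl⟩)
  have hφ : Function.Injective φ := by
    intro x y h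
    ext1
    funext i
    exact congrArg Subtype.val (congrFun h i)
  have := LinearMap.finrank_le_finrank_of_injective hφ
  rwa [Module.finrank_pi_fintype] at this

lemma PP_er_ne (A : Submodule F (∀ i : Fin ℓ, Matrix (Fin (m i)) (Fin (n i)) F)) (i k : Fin ℓ)
    (h : k ≠ i) : PP (A.map (er F m n i)) k = PP A k := by
  ext c
  simp only [mem_PP, Submodule.mem_map]
  constructor
  · rintro ⟨_, ⟨a, ha, rfl⟩, rfl⟩
    exact ⟨a, ha, (er_ne i k h a).symm⟩
  · rintro ⟨a, ha, rfl⟩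
    exact ⟨_, ⟨a, ha, rfl⟩, er_ne i k h a⟩

lemma PP_er_same (A : Submodule F (∀ i : Fin ℓ, Matrix (Fin (m i)) (Fin (n i)) F)) (i : Fin ℓ) :
    PP (A.map (er F m n i)) i = ⊥ := by
  rw [eq_bot_iff]
  rintro c ⟨_, ⟨a, ha, rfl⟩, rfl⟩
  exact er_same i a

lemma finrank_le_KK (A : Submodule F (∀ i : Fin ℓ, Matrix (Fin (m i)) (Fin (n i)) F)) (i : Fin ℓ) :
    Module.finrank F A ≤
      Module.finrank F (KK A i) + ∑ k ∈ univ.erase i, Module.finrank F (PP A k) := by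
  have h1 := finrank_er A i
  have h2 := finrank_le_sum_PP (A.map (er F m n i))
  rw [← Finset.add_sum_erase _ _ (mem_univ i), PP_er_same, finrank_bot, zero_add] at h2
  rw [Finset.sum_congr rfl (fun k hk => by rw [PP_er_ne A i k (Finset.ne_of_mem_erase hk)])] at h2
  omega

def Opt (A : Submodule F (∀ i : Fin ℓ, Matrix (Fin (m i)) (Fin (n i)) F)) : Prop :=
  ∀ C ∈ A, wsum C ≤ Module.finrank F A

lemma Opt_er (hnm : ∀ i, n i ≤ m i)
    {A : Submodule F (∀ i : Fin ℓ, Matrix (Fin (m i)) (Fin (n i)) F)} (hA : Opt A) (i : Fin ℓ) :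
    Opt (A.map (er F m n i)) := by
  rintro _ ⟨a, ha, rfl⟩
  obtain ⟨k, hk, hkr⟩ := affine_bound' (hnm i) (KK A i) (a i)
  have h1 := hA (a + Pi.single i k) (A.add_mem ha (mem_KK.1 hk))
  have h2 := finrank_er A i
  unfold wsum at *
  rw [← Finset.add_sum_erase _ _ (mem_univ i)] at h1 ⊢
  have h3 : ∀ j ∈ univ.erase i, m j * (er F m n i a j).rank =
      m j * ((a + Pi.single i k : ∀ i : Fin ℓ, Matrix (Fin (m i)) (Fin (n i)) F) j).rank := by
    intro j hj
    have hj' := Finset.ne_of_mem_erase hj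
    rw [er_ne i j hj', Pi.add_apply, Pi.single_eq_of_ne hj', add_zero]
  rw [Finset.sum_congr rfl h3, er_same, Matrix.rank_zero, mul_zero, zero_add]
  rw [Pi.add_apply, Pi.single_eq_same] at h1
  omega

lemma prod_step (hnm : ∀ i, n i ≤ m i) (hmpos : ∀ i, 0 < m i)
    {A : Submodule F (∀ i : Fin ℓ, Matrix (Fin (m i)) (Fin (n i)) F)} (hA : Opt A)
    (i j : Fin ℓ) (hij : i ≠ j)
    (hPj : ∀ c ∈ PP A j, m j * c.rank ≤ Module.finrank F (PP A j))
    (IHi : ∀ C : (∀ i : Fin ℓ, Matrix (Fin (m i)) (Fin (n i)) F), (∀ k, C k ∈ PP A k) → ∃ a ∈ A, ∀ k, k ≠ i → a k = C k)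
    (IHj : ∀ C : (∀ i : Fin ℓ, Matrix (Fin (m i)) (Fin (n i)) F), (∀ k, C k ∈ PP A k) → ∃ a ∈ A, ∀ k, k ≠ j → a k = C k)
    (hcase : Fintype.card F ≠ 2 ∨ 2 ≤ m j ∨
      (m i = 1 ∧ m j = 1 ∧ ∀ k, k ≠ i → k ≠ j → PP A k = ⊥)) :
    ∀ C : (∀ i : Fin ℓ, Matrix (Fin (m i)) (Fin (n i)) F), (∀ k, C k ∈ PP A k) → C ∈ A := by
  by_contra hcon
  push Not at hcon
  obtain ⟨C0, hC0, hC0A⟩ := hcon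
  have hK : ∀ i, (∀ C : (∀ i : Fin ℓ, Matrix (Fin (m i)) (Fin (n i)) F), (∀ k, C k ∈ PP A k) → ∃ a ∈ A, ∀ k, k ≠ i → a k = C k) →
      ∃ x ∈ PP A i, x ∉ KK A i := by
    intro i IH
    obtain ⟨a, ha, hak⟩ := IH C0 hC0
    refine ⟨C0 i - a i, (PP A i).sub_mem (hC0 i) ⟨a, ha, rfl⟩, fun h => hC0A ?_⟩
    have h1 := A.add_mem (mem_KK.1 h) ha
    convert h1 using 1
    funext k
    by_cases hk : k = i
    · subst hk; simp
    · simp [hk, hak k hk]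
  have claim1 : ∀ a ∈ A, (∀ k, k ≠ i → Module.finrank F (PP A k) ≤ m k * (a k).rank) →
      m i * (a i).rank ≤ Module.finrank F (KK A i) := by
    intro a ha hak
    have h1 := hA a ha
    have h2 := finrank_le_KK A i
    unfold wsum at h1
    rw [← Finset.add_sum_erase _ _ (mem_univ i)] at h1
    have h3 := Finset.sum_le_sum (s := univ.erase i) (fun k hk => hak k (Finset.ne_of_mem_erase hk))
    omega
  have hmax : ∀ k, ∃ c ∈ PP A k, Module.finrank F (PP A k) ≤ m k * c.rank := by
    intro k
    obtain ⟨c, hc, h⟩ := affine_bound' (hnm k) (PP A k) 0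
    rw [zero_add] at h
    exact ⟨c, hc, h⟩
  choose c hcP hcr using hmax
  by_cases hB : Fintype.card F ≠ 2 ∨ 2 ≤ m j
  · obtain ⟨c1, hc1, c2, hc2, hr1, hr2, hcc⟩ :=
      two_choices (hmpos j) (hnm j) hB (PP A j) (KK A j) hPj (hK j IHj)
    have lift : ∀ d ∈ PP A j, Module.finrank F (PP A j) ≤ m j * d.rank →
        ∃ a ∈ A, a j = d ∧ (∀ k, k ≠ i → k ≠ j → a k = c k) ∧
          ∀ x ∈ KK A i, m i * (a i + x).rank ≤ Module.finrank F (KK A i) := by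
      intro d hd hdr
      obtain ⟨a, ha, hak⟩ := IHi (Function.update c j d) (by
        intro k
        by_cases hk : k = j
        · subst hk; simpa using hd
        · simpa [hk] using hcP k)
      refine ⟨a, ha, by simpa using hak j hij.symm, fun k h1 h2 => by simpa [h2] using hak k h1, ?_⟩
      intro x hx
      have := claim1 (a + Pi.single i x) (A.add_mem ha (mem_KK.1 hx)) (by
        intro k hk
        rw [Pi.add_apply, Pi.single_eq_of_ne hk, add_zero, hak k hk]
        by_cases hk : k = j
        · subst hk; simpa using hdr
        · simpa [hk] using hcr k)
      simpa using this
    obtain ⟨a1, ha1, h1j, h1k, h1r⟩ := lift c1 hc1 hr1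
    obtain ⟨a2, ha2, h2j, h2k, h2r⟩ := lift c2 hc2 hr2
    refine coset_contra (hmpos i) (hnm i) (KK A i) (a1 i) (a2 i) (fun h => hcc ?_) h1r h2r
    rw [mem_KK]
    have h3 := A.sub_mem (A.sub_mem ha1 ha2) (mem_KK.1 h)
    convert h3 using 1
    funext k
    by_cases hki : k = i
    · subst hki; simp [hij]
    · by_cases hkj : k = j
      · subst hkj; simp [hki, h1j, h2j]
      · simp [hki, hkj, h1k k hki hkj, h2k k hki hkj]
  · obtain ⟨hmi, hmj, hbot⟩ : m i = 1 ∧ m j = 1 ∧ ∀ k, k ≠ i → k ≠ j → PP A k = ⊥ := by tauto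
    have small : ∀ i, m i = 1 → (∃ x ∈ PP A i, x ∉ KK A i) →
        Module.finrank F (KK A i) = 0 := by
      intro i hmi ⟨x, hx, hxK⟩
      have h1 : Module.finrank F (KK A i) < Module.finrank F (⊤ : Submodule F (Matrix (Fin (m i)) (Fin (n i)) F)) := by
        apply Submodule.finrank_lt_finrank_of_lt
        rw [lt_top_iff_ne_top]
        intro h
        rw [h] at hxK
        exact hxK trivial
      rw [finrank_top, Module.finrank_matrix] at h1
      have := hnm i
      simp [hmi] at h1
      omega
    have hKi := small i hmi (hK i IHi)
    have hKj := small j hmj (hK j IHj)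
    obtain ⟨a, ha, hak⟩ := IHi c hcP
    have h1 := claim1 a ha (fun k hk => by rw [hak k hk]; exact hcr k)
    have hai : a i = 0 := by
      rw [hKi] at h1
      have h0 : m i * (a i).rank = 0 := by omega
      rcases Nat.mul_eq_zero.1 h0 with h | h
      · omega
      · exact eq_zero_of_rank_zero _ h
    have haj : a j ∈ KK A j := by
      rw [mem_KK]
      convert ha using 1
      funext k
      by_cases hkj : k = j
      · subst hkj; simp
      · by_cases hki : k = i
        · subst hki; simp [hkj, hai]
        · have : a k ∈ PP A k := ⟨a, ha, rfl⟩
          rw [hbot k hki hkj, Submodule.mem_bot] at this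
          simp [hkj, this]
    rw [Submodule.finrank_eq_zero.1 hKj, Submodule.mem_bot, hak j hij.symm] at haj
    have h2 := hcr j
    rw [haj, Matrix.rank_zero, mul_zero, Nat.le_zero, Submodule.finrank_eq_zero] at h2
    obtain ⟨x, hx, hxK⟩ := hK j IHj
    rw [h2, Submodule.mem_bot] at hx
    rw [hx] at hxK
    exact hxK (Submodule.zero_mem _)

lemma opt_of_prod (hnm : ∀ i, n i ≤ m i)
    {A : Submodule F (∀ i : Fin ℓ, Matrix (Fin (m i)) (Fin (n i)) F)} (hA : Opt A)
    (hprod : ∀ C : (∀ i : Fin ℓ, Matrix (Fin (m i)) (Fin (n i)) F), (∀ k, C k ∈ PP A k) → C ∈ A) :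
    ∀ k, ∀ c ∈ PP A k, m k * c.rank ≤ Module.finrank F (PP A k) := by
  intro i d hd
  have hmax : ∀ k, ∃ c ∈ PP A k, Module.finrank F (PP A k) ≤ m k * c.rank := by
    intro k
    obtain ⟨c, hc, h⟩ := affine_bound' (hnm k) (PP A k) 0
    rw [zero_add] at h
    exact ⟨c, hc, h⟩
  choose c hcP hcr using hmax
  have h1 := hA _ (hprod (Function.update c i d) (by
        intro k
        by_cases hk : k = i
        · subst hk; simpa using hd
        · simpa [hk] using hcP k))
  have h2 := finrank_le_sum_PP A
  unfold wsum at h1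
  rw [← Finset.add_sum_erase _ _ (mem_univ i)] at h1 h2
  have h3 := Finset.sum_le_sum (s := univ.erase i) (f := fun k => Module.finrank F (PP A k))
    (g := fun k => m k * (Function.update c i d k).rank) (fun k hk => by
      have := Finset.ne_of_mem_erase hk
      simpa [this] using hcr k)
  rw [Function.update_self] at h1
  omega

theorem structure_aux (hnm : ∀ i, n i ≤ m i) (hmpos : ∀ i, 0 < m i)
    (hq : Fintype.card F ≠ 2 ∨ ∀ i j k : Fin ℓ, i ≠ j → i ≠ k → j ≠ k →
      ¬ (m i = 1 ∧ m j = 1 ∧ m k = 1)) (N : ℕ) :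
    ∀ (J : Finset (Fin ℓ)), J.card = N →
      ∀ A : Submodule F (∀ i : Fin ℓ, Matrix (Fin (m i)) (Fin (n i)) F), Opt A →
      (∀ a ∈ A, ∀ k, k ∉ J → a k = 0) → ∀ C : (∀ i : Fin ℓ, Matrix (Fin (m i)) (Fin (n i)) F), (∀ k, C k ∈ PP A k) → C ∈ A := by
  induction N with
  | zero =>
    intro J hJ A hA hsup C hC
    have : C = 0 := by
      funext k
      obtain ⟨a, ha, hak⟩ := hC k
      rw [← hak]
      exact hsup a ha k (by rw [Finset.card_eq_zero.1 hJ]; simp)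
    rw [this]; exact A.zero_mem
  | succ N ih =>
    intro J hJ A hA hsup
    have IH : ∀ i ∈ J, (∀ C : (∀ i : Fin ℓ, Matrix (Fin (m i)) (Fin (n i)) F), (∀ k, C k ∈ PP A k) → ∃ a ∈ A, ∀ k, k ≠ i → a k = C k) ∧
        ∀ k, k ≠ i → ∀ c ∈ PP A k, m k * c.rank ≤ Module.finrank F (PP A k) := by
      intro i hi
      have h1 := ih (J.erase i) (by rw [Finset.card_erase_of_mem hi, hJ]; rfl)
        (A.map (er F m n i)) (Opt_er hnm hA i) (by
          rintro _ ⟨a, ha, rfl⟩ k hk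
          by_cases hki : k = i
          · subst hki; exact er_same _ _
          · rw [er_ne i k hki]
            exact hsup a ha k (fun h => hk (Finset.mem_erase.2 ⟨hki, h⟩)))
      constructor
      · intro C hC
        obtain ⟨a, ha, hak⟩ := h1 (er F m n i C) (by
          intro k
          by_cases hki : k = i
          · subst hki; rw [er_same]; exact Submodule.zero_mem _
          · rw [er_ne i k hki, PP_er_ne A i k hki]; exact hC k)
        refine ⟨a, ha, fun k hk => ?_⟩
        have := congrFun hak k
        rwa [er_ne i k hk, er_ne i k hk] at this
      · intro k hk
        have := opt_of_prod hnm (Opt_er hnm hA i) h1 k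
        rwa [PP_er_ne A i k hk] at this
    have fin : ∀ i ∈ J, ∀ j ∈ J, i ≠ j → (Fintype.card F ≠ 2 ∨ 2 ≤ m j ∨
        (m i = 1 ∧ m j = 1 ∧ ∀ k, k ≠ i → k ≠ j → PP A k = ⊥)) →
        ∀ C : (∀ i : Fin ℓ, Matrix (Fin (m i)) (Fin (n i)) F), (∀ k, C k ∈ PP A k) → C ∈ A := fun i hi j hj hij hc =>
      prod_step hnm hmpos hA i j hij ((IH i hi).2 j hij.symm) (IH i hi).1 (IH j hj).1 hc
    by_cases h1 : N = 0
    · subst h1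
      obtain ⟨i, rfl⟩ := Finset.card_eq_one.1 hJ
      intro C hC
      obtain ⟨a, ha, hai⟩ := hC i
      suffices hCa : C = a by rw [hCa]; exact ha
      funext k
      by_cases hk : k = i
      · subst hk; exact hai.symm
      · obtain ⟨b, hb, hbk⟩ := hC k
        rw [← hbk, hsup a ha k (by simpa using hk)]
        exact hsup b hb k (by simpa using hk)
    · have hone : 1 < J.card := by omega
      by_cases h2 : ∃ j ∈ J, 2 ≤ m j
      · obtain ⟨j, hj, hmj⟩ := h2
        obtain ⟨i, hi, hij⟩ := Finset.exists_mem_ne hone j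
        exact fin i hi j hj hij (Or.inr (Or.inl hmj))
      · push Not at h2
        obtain ⟨i, hi, j, hj, hij⟩ := Finset.one_lt_card.1 hone
        apply fin i hi j hj hij
        have hm1 : ∀ k ∈ J, m k = 1 := fun k hk => by
          have := h2 k hk
          have := hmpos k
          omega
        rcases hq with hq | hq
        · exact Or.inl hq
        · refine Or.inr (Or.inr ⟨hm1 i hi, hm1 j hj, fun k hki hkj => ?_⟩)
          have hkJ : k ∉ J := fun hk =>
            hq i j k hij hki.symm hkj.symm ⟨hm1 i hi, hm1 j hj, hm1 k hk⟩
          rw [eq_bot_iff]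
          rintro c ⟨a, ha, rfl⟩
          exact hsup a ha k hkJ

theorem structure_thm (hnm : ∀ i, n i ≤ m i) (hmpos : ∀ i, 0 < m i)
    (hq : Fintype.card F ≠ 2 ∨ ∀ i j k : Fin ℓ, i ≠ j → i ≠ k → j ≠ k →
      ¬ (m i = 1 ∧ m j = 1 ∧ m k = 1))
    {A : Submodule F (∀ i : Fin ℓ, Matrix (Fin (m i)) (Fin (n i)) F)} (hA : Opt A) :
    ∀ C : (∀ i : Fin ℓ, Matrix (Fin (m i)) (Fin (n i)) F), (∀ k, C k ∈ PP A k) → C ∈ A :=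
  structure_aux hnm hmpos hq _ univ rfl A hA (fun a _ k hk => absurd (mem_univ k) hk)

end Structure

section Final
variable {F : Type*} [Field F] [Fintype F] {ℓ : ℕ} {m n : Fin ℓ → ℕ}

/-- the trace form -/
def trForm (F : Type*) [Field F] (m n : Fin ℓ → ℕ) :
    LinearMap.BilinForm F (∀ i : Fin ℓ, Matrix (Fin (m i)) (Fin (n i)) F) :=
  LinearMap.mk₂ F (fun D C => ∑ i, Matrix.trace (D i * (C i)ᵀ))
    (fun a b c => by simp [Matrix.add_mul, Finset.sum_add_distrib])
    (fun r a c => by simp [Finset.mul_sum])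
    (fun a b c => by simp [Matrix.mul_add, Finset.sum_add_distrib])
    (fun r a c => by simp [Finset.mul_sum])

lemma trForm_apply (D C : ∀ i : Fin ℓ, Matrix (Fin (m i)) (Fin (n i)) F) :
    trForm F m n D C = ∑ i, Matrix.trace (D i * (C i)ᵀ) := rfl

lemma trForm_symm (D C : ∀ i : Fin ℓ, Matrix (Fin (m i)) (Fin (n i)) F) :
    trForm F m n D C = trForm F m n C D := by
  rw [trForm_apply, trForm_apply]
  refine Finset.sum_congr rfl fun i _ => ?_
  rw [← Matrix.trace_transpose, Matrix.transpose_mul, Matrix.transpose_transpose]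

lemma sum_trace_single (D : ∀ i : Fin ℓ, Matrix (Fin (m i)) (Fin (n i)) F) (i : Fin ℓ)
    (c : Matrix (Fin (m i)) (Fin (n i)) F) :
    ∑ k, Matrix.trace (D k *
      ((Pi.single i c : ∀ i : Fin ℓ, Matrix (Fin (m i)) (Fin (n i)) F) k)ᵀ) =
      Matrix.trace (D i * cᵀ) := by
  rw [Finset.sum_eq_single i]
  · rw [Pi.single_eq_same]
  · intro b _ hb
    rw [Pi.single_eq_of_ne hb]; simp
  · simp

lemma trForm_sep (D : ∀ i : Fin ℓ, Matrix (Fin (m i)) (Fin (n i)) F)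
    (h : ∀ C, trForm F m n D C = 0) : D = 0 := by
  funext i
  show D i = 0
  rw [Matrix.ext_iff_trace_mul_right]
  intro x
  have h1 := h (Pi.single i xᵀ)
  rw [trForm_apply, sum_trace_single] at h1
  simpa using h1

lemma trForm_nondeg : (trForm F m n).Nondegenerate :=
  ⟨fun D h => trForm_sep D h, fun D h => trForm_sep D (fun C => by rw [trForm_symm]; exact h C)⟩

lemma dualCode_eq (A : Submodule F (∀ i : Fin ℓ, Matrix (Fin (m i)) (Fin (n i)) F)) :
    dualCode A = (trForm F m n).orthogonal A := by
  ext D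
  constructor
  · intro h C hC
    rw [trForm_symm]
    exact h C hC
  · intro h C hC
    have := h C hC
    rw [trForm_symm] at this
    exact this

lemma dual_dual (A : Submodule F (∀ i : Fin ℓ, Matrix (Fin (m i)) (Fin (n i)) F)) :
    dualCode (dualCode A) = A := by
  rw [dualCode_eq, dualCode_eq]
  exact LinearMap.BilinForm.orthogonal_orthogonal trForm_nondeg
    (fun x y h => by rw [trForm_symm]; exact h) A

lemma finrank_dual (A : Submodule F (∀ i : Fin ℓ, Matrix (Fin (m i)) (Fin (n i)) F)) :
    Module.finrank F (dualCode A) = ∑ i, m i * n i - Module.finrank F A := by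
  rw [dualCode_eq, LinearMap.BilinForm.finrank_orthogonal trForm_nondeg, Module.finrank_pi_fintype]
  simp [Module.finrank_matrix]

lemma opt_of_isOpt {A : Submodule F (∀ i : Fin ℓ, Matrix (Fin (m i)) (Fin (n i)) F)}
    (h : IsOptAnticode A) : Opt A := by
  intro C hC
  rw [h]
  refine le_csSup ⟨∑ i, m i * n i, ?_⟩ ⟨C, hC, rfl⟩
  rintro w ⟨D, -, rfl⟩
  exact Finset.sum_le_sum fun i _ => Nat.mul_le_mul_left _ (Matrix.rank_le_width (D i))

lemma isOpt_of_opt (hnm : ∀ i, n i ≤ m i) (hmpos : ∀ i, 0 < m i)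
    (hq : Fintype.card F ≠ 2 ∨ ∀ i j k : Fin ℓ, i ≠ j → i ≠ k → j ≠ k →
      ¬ (m i = 1 ∧ m j = 1 ∧ m k = 1))
    {A : Submodule F (∀ i : Fin ℓ, Matrix (Fin (m i)) (Fin (n i)) F)} (hA : Opt A) :
    IsOptAnticode A := by
  have hmax : ∀ k, ∃ c ∈ PP A k, Module.finrank F (PP A k) ≤ m k * c.rank := by
    intro k
    obtain ⟨c, hc, h⟩ := affine_bound' (hnm k) (PP A k) 0
    rw [zero_add] at h
    exact ⟨c, hc, h⟩
  choose c hcP hcr using hmax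
  have hc := structure_thm hnm hmpos hq hA c hcP
  have h1 : Module.finrank F A ≤ wsum c :=
    (finrank_le_sum_PP A).trans (Finset.sum_le_sum fun i _ => hcr i)
  unfold IsOptAnticode
  symm
  apply le_antisymm
  · refine csSup_le ⟨_, c, hc, rfl⟩ ?_
    rintro w ⟨D, hD, rfl⟩
    exact hA D hD
  · refine h1.trans (le_csSup ⟨Module.finrank F A, ?_⟩ ⟨c, hc, rfl⟩)
    rintro w ⟨D, hD, rfl⟩
    exact hA D hD

lemma opt_dual (hnm : ∀ i, n i ≤ m i) (hmpos : ∀ i, 0 < m i)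
    (hq : Fintype.card F ≠ 2 ∨ ∀ i j k : Fin ℓ, i ≠ j → i ≠ k → j ≠ k →
      ¬ (m i = 1 ∧ m j = 1 ∧ m k = 1))
    {A : Submodule F (∀ i : Fin ℓ, Matrix (Fin (m i)) (Fin (n i)) F)} (hA : Opt A) :
    Opt (dualCode A) := by
  have hprod := structure_thm hnm hmpos hq hA
  have hopt := opt_of_prod hnm hA hprod
  intro X hX
  have key : ∀ i, m i * (X i).rank + Module.finrank F (PP A i) ≤ m i * n i := by
    intro i
    obtain ⟨c, hc, h⟩ := affine_bound' (hnm i) (PP A i) 0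
    rw [zero_add] at h
    have heq : Module.finrank F (PP A i) = m i * c.rank := le_antisymm h (hopt i c hc)
    have hgood := good_of_opt (hmpos i) (hnm i) (PP A i) heq (fun M hM => by
      have := hopt i M hM
      rw [heq] at this
      exact Nat.le_of_mul_le_mul_left this (hmpos i))
    have h1 := hgood (X i) (fun M hM => by
      have h2 : (Pi.single i M : ∀ i : Fin ℓ, Matrix (Fin (m i)) (Fin (n i)) F) ∈ A :=
        hprod _ (fun k => by
          by_cases hk : k = i
          · subst hk; simpa using hM
          · rw [Pi.single_eq_of_ne hk]; exact Submodule.zero_mem _)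
      have h3 := hX _ h2
      rwa [sum_trace_single] at h3)
    rw [heq, ← Nat.mul_add]
    exact Nat.mul_le_mul_left _ h1
  have h1 := Finset.sum_le_sum (s := univ) (fun i _ => key i)
  rw [Finset.sum_add_distrib] at h1
  have h2 := finrank_le_sum_PP A
  rw [finrank_dual]
  unfold wsum
  omega

end Final

/-- Assume that either `q ≠ 2` or `m_{ℓ-2} ≥ 2` (1-based indexing).  Then a code `𝒜 ⊆ 𝕄` is
an optimal anticode if and only if its trace-dual `𝒜^⊥` is an optimal anticode. -/
theorem optimal_anticode_iff_dual_optimal_anticode {F : Type*} [Field F] [Fintype F] {ℓ : ℕ}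
    (m n : Fin ℓ → ℕ) (hℓ : 0 < ℓ) (hm : ∀ i j : Fin ℓ, i ≤ j → m j ≤ m i)
    (hmpos : ∀ i, 0 < m i) (hnm : ∀ i, n i ≤ m i) (hnpos : ∀ i, 0 < n i)
    (hq : Fintype.card F ≠ 2 ∨ 2 ≤ m ⟨ℓ - 3, by omega⟩)
    (𝒜 : Submodule F (∀ i : Fin ℓ, Matrix (Fin (m i)) (Fin (n i)) F)) :
    IsOptAnticode 𝒜 ↔ IsOptAnticode (dualCode 𝒜) := by
  have hq' : Fintype.card F ≠ 2 ∨ ∀ i j k : Fin ℓ, i ≠ j → i ≠ k → j ≠ k →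
      ¬ (m i = 1 ∧ m j = 1 ∧ m k = 1) := by
    rcases hq with h | h
    · exact Or.inl h
    · right
      rintro i j k hij hik hjk ⟨hi, hj, hk⟩
      have hgt : ∀ t : Fin ℓ, m t = 1 → ℓ - 3 < t.val := by
        intro t ht
        by_contra hlt
        have := hm t ⟨ℓ - 3, by omega⟩ (Fin.le_def.2 (by simpa using hlt))
        omega
      have h1 := hgt i hi
      have h2 := hgt j hj
      have h3 := hgt k hk
      have h4 : i.val ≠ j.val := fun h => hij (Fin.ext h)
      have h5 : i.val ≠ k.val := fun h => hik (Fin.ext h)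
      have h6 : j.val ≠ k.val := fun h => hjk (Fin.ext h)
      have := i.2
      have := j.2
      have := k.2
      omega
  constructor
  · intro h
    exact isOpt_of_opt hnm hmpos hq' (opt_dual hnm hmpos hq' (opt_of_isOpt h))
  · intro h
    have h1 := opt_dual hnm hmpos hq' (opt_of_isOpt h)
    rw [dual_dual] at h1
    exact isOpt_of_opt hnm hmpos hq' h1
end
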